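/- There exist δ₀ ∈ (0,1/2) and constants C₀ > 0 and c₀ > 0 such that the following holds. Let μ, ν ∈ (0,1] and let k be a nonzero integer. Let W : [0,∞) × [-1,1] → ℝ be smooth with ∂_t W = μ·∂_y² W on [0,∞) × [-1,1], W(t,-1) = W(t,1) = 0 for all t ≥ 0, and Σ_{j=0}^{4} ‖∂_y^j W(0,·)‖²_{L²} ≤ δ₀². Define U(t,y) := y + ∂_y[∫_{-1}^{1} G(y,y')·W(t,y') dy']. Let ω, ψ, θ : [0,∞) × [-1,1] → ℂ be smooth with ω(t,±1) = 0, ψ(t,±1) = 0 and θ(t,±1) = 0 for all t ≥ 0, satisfying on [0,∞) × [-1,1] the linearized system: ∂_t ω + i·k·U·ω - i·k·(∂_y² U)·ψ - μ·∂_y² ω = -i·k·θ, ∂_t θ + i·k·U·θ - ν·∂_y² θ = 0, and ∂_y² ψ - k²·ψ = ω. Then for all t ≥ 0: ‖ω(t,·)‖²_{L²} + μ^{2/3}·|k|^{-2/3}·‖∂_y ω(t,·)‖²_{L²} ≤ C₀·Φ_ω·exp(-c₀·μ^{1/3}·|k|^{2/3}·t) + C₀·(min{μ,ν})^{-2/3}·|k|^{2/3}·Φ_θ·exp(-c₀·(min{μ,ν})^{1/3}·|k|^{2/3}·t),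 where Φ_ω := ‖ω(0,·)‖²_{L²} + μ^{2/3}·|k|^{-2/3}·‖∂_y ω(0,·)‖²_{L²} and Φ_θ := ‖θ(0,·)‖²_{L²} + ν^{2/3}·|k|^{-2/3}·‖∂_y θ(0,·)‖²_{L²}. -/

import Mathlib

open Set

/-- The Green's function of `d²/dy²` on `[-1,1]` with homogeneous Dirichlet
boundary conditions. -/
noncomputable def G (y y' : ℝ) : ℝ :=
  if y ≤ y' then -((y' - 1) / 2) * (y + 1) else -((y' + 1) / 2) * (y - 1)

section EnhancedDissipation

open MeasureTheory FourierTransform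
open scoped SchwartzMap

section TwoVariable

variable {E : Type*} [NormedAddCommGroup E] [NormedSpace ℝ E]

/-- The partial derivative in the second variable. -/
noncomputable def dY (f : ℝ → ℝ → E) : ℝ → ℝ → E := fun t y => deriv (f t) y

/-- The partial derivative in the first variable. -/
noncomputable def dT (f : ℝ → ℝ → E) : ℝ → ℝ → E := fun t y => deriv (fun s => f s y) t

/-- Joint smoothness of a function of two real variables. -/
def Smooth₂ (f : ℝ → ℝ → E) : Prop := ContDiff ℝ (⊤ : ℕ∞) (Function.uncurry f)

lemma Smooth₂.hasDerivAt_snd_fderiv {f : ℝ → ℝ → E} (hf : Smooth₂ f) (t y : ℝ) :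
    HasDerivAt (f t) (fderiv ℝ (Function.uncurry f) (t, y) (0, 1)) y := by
  have h1 : HasFDerivAt (Function.uncurry f) (fderiv ℝ (Function.uncurry f) (t, y)) (t, y) :=
    (hf.differentiable (by simp) (t, y)).hasFDerivAt
  have h2 : HasDerivAt (fun z : ℝ => (t, z)) ((0 : ℝ), (1 : ℝ)) y :=
    (hasDerivAt_const y t).prodMk (hasDerivAt_id y)
  exact h1.comp_hasDerivAt y h2

lemma Smooth₂.hasDerivAt_fst_fderiv {f : ℝ → ℝ → E} (hf : Smooth₂ f) (t y : ℝ) :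
    HasDerivAt (fun s => f s y) (fderiv ℝ (Function.uncurry f) (t, y) (1, 0)) t := by
  have h1 : HasFDerivAt (Function.uncurry f) (fderiv ℝ (Function.uncurry f) (t, y)) (t, y) :=
    (hf.differentiable (by simp) (t, y)).hasFDerivAt
  have h2 : HasDerivAt (fun z : ℝ => (z, y)) ((1 : ℝ), (0 : ℝ)) t :=
    (hasDerivAt_id t).prodMk (hasDerivAt_const t y)
  exact h1.comp_hasDerivAt t h2

lemma Smooth₂.uncurry_dY {f : ℝ → ℝ → E} (hf : Smooth₂ f) :
    Function.uncurry (dY f) = fun z => fderiv ℝ (Function.uncurry f) z (0, 1) := by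
  ext ⟨t, y⟩
  exact (hf.hasDerivAt_snd_fderiv t y).deriv

lemma Smooth₂.uncurry_dT {f : ℝ → ℝ → E} (hf : Smooth₂ f) :
    Function.uncurry (dT f) = fun z => fderiv ℝ (Function.uncurry f) z (1, 0) := by
  ext ⟨t, y⟩
  exact (hf.hasDerivAt_fst_fderiv t y).deriv

lemma Smooth₂.dY {f : ℝ → ℝ → E} (hf : Smooth₂ f) : Smooth₂ (dY f) := by
  rw [Smooth₂, hf.uncurry_dY]
  exact (hf.fderiv_right (m := (⊤ : ℕ∞)) (by simp)).clm_apply contDiff_const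

lemma Smooth₂.dT {f : ℝ → ℝ → E} (hf : Smooth₂ f) : Smooth₂ (dT f) := by
  rw [Smooth₂, hf.uncurry_dT]
  exact (hf.fderiv_right (m := (⊤ : ℕ∞)) (by simp)).clm_apply contDiff_const

lemma Smooth₂.hasDerivAt_snd {f : ℝ → ℝ → E} (hf : Smooth₂ f) (t y : ℝ) :
    HasDerivAt (f t) (_root_.dY f t y) y :=
  (hf.hasDerivAt_snd_fderiv t y).differentiableAt.hasDerivAt

lemma Smooth₂.hasDerivAt_fst {f : ℝ → ℝ → E} (hf : Smooth₂ f) (t y : ℝ) :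
    HasDerivAt (fun s => f s y) (_root_.dT f t y) t :=
  (hf.hasDerivAt_fst_fderiv t y).differentiableAt.hasDerivAt

lemma Smooth₂.continuous {f : ℝ → ℝ → E} (hf : Smooth₂ f) : Continuous (Function.uncurry f) :=
  ContDiff.continuous hf

lemma Smooth₂.continuous_snd {f : ℝ → ℝ → E} (hf : Smooth₂ f) (t : ℝ) : Continuous (f t) :=
  hf.continuous.comp (Continuous.prodMk_right t)

lemma Smooth₂.dT_dY {f : ℝ → ℝ → E} (hf : Smooth₂ f) :
    _root_.dT (_root_.dY f) = _root_.dY (_root_.dT f) := by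
  ext t y
  have hd : Differentiable ℝ (fderiv ℝ (Function.uncurry f)) :=
    (hf.fderiv_right (m := (⊤ : ℕ∞)) (by simp)).differentiable (by simp)
  have key : ∀ v w : ℝ × ℝ, fderiv ℝ (fun z => fderiv ℝ (Function.uncurry f) z v) (t, y) w
      = fderiv ℝ (fderiv ℝ (Function.uncurry f)) (t, y) w v := by
    intro v w
    rw [fderiv_clm_apply (hd _) (differentiableAt_const v)]
    simp
  have e1 := (hf.dY.hasDerivAt_fst_fderiv t y).deriv
  have e2 := (hf.dT.hasDerivAt_snd_fderiv t y).deriv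
  rw [hf.uncurry_dY, key] at e1
  rw [hf.uncurry_dT, key] at e2
  have hs : IsSymmSndFDerivAt ℝ (Function.uncurry f) (t, y) :=
    (ContDiff.contDiffAt hf).isSymmSndFDerivAt (by
      rw [minSmoothness_of_isRCLikeNormedField]; exact WithTop.coe_le_coe.2 le_top)
  show deriv (fun s => _root_.dY f s y) t = deriv (_root_.dT f t) y
  rw [e1, e2, hs.eq]

/-- Differentiation under an interval integral of a jointly continuous family. -/
lemma hasDerivAt_intervalIntegral_param {F F' : ℝ → ℝ → E} (a b : ℝ)
    (hF : Continuous (Function.uncurry F)) (hF' : Continuous (Function.uncurry F'))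
    (h : ∀ t y, HasDerivAt (fun s => F s y) (F' t y) t) (t : ℝ) :
    HasDerivAt (fun s => ∫ y in a..b, F s y) (∫ y in a..b, F' t y) t := by
  obtain ⟨C, hC⟩ := ((isCompact_Icc (a := t - 1) (b := t + 1)).prod
    (isCompact_uIcc (a := a) (b := b))).exists_bound_of_continuousOn hF'.continuousOn
  refine (intervalIntegral.hasDerivAt_integral_of_dominated_loc_of_deriv_le
    (bound := fun _ => C) (F' := F') (s := Icc (t - 1) (t + 1))
    (Icc_mem_nhds (by linarith) (by linarith)) ?_ ?_ ?_ ?_ ?_ ?_).2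
  · exact Filter.Eventually.of_forall fun s =>
      (hF.comp (Continuous.prodMk_right s)).aestronglyMeasurable
  · exact (hF.comp (Continuous.prodMk_right t)).intervalIntegrable _ _
  · exact (hF'.comp (Continuous.prodMk_right t)).aestronglyMeasurable
  · exact Filter.Eventually.of_forall fun y hy s hs =>
      hC (s, y) ⟨hs, uIoc_subset_uIcc hy⟩
  · exact intervalIntegrable_const
  · exact Filter.Eventually.of_forall fun y _ s _ => h s y

end TwoVariable

/-- On `L¹ ∩ L²` the `L²` Fourier transform is given by the Fourier integral. -/
lemma fourier_toLp_ae_eq {h : ℝ → ℂ} (h1 : Integrable h) (h2 : MemLp h 2) :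
    (𝓕 (h2.toLp h) : Lp ℂ 2 (volume : Measure ℝ)) =ᵐ[volume] 𝓕 h := by
  have hcont : Continuous (𝓕 h) :=
    VectorFourier.fourierIntegral_continuous Real.continuous_fourierChar
      (by exact continuous_inner) h1
  refine ae_eq_of_integral_contDiff_smul_eq
    ((Lp.memLp _).locallyIntegrable (by norm_num)) hcont.locallyIntegrable fun g hg hgc => ?_
  let φ : 𝓢(ℝ, ℂ) := HasCompactSupport.toSchwartzMap (f := fun x => (g x : ℂ))
    (hgc.comp_left (g := fun x : ℝ => (x : ℂ)) (by simp)) (Complex.ofRealCLM.contDiff.comp hg)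
  have hφ : ∀ x, φ x = (g x : ℂ) := fun x => rfl
  have e1 : ∫ x, φ x • (𝓕 (h2.toLp h) : Lp ℂ 2 (volume : Measure ℝ)) x
      = ∫ x, (𝓕 φ) x • (h2.toLp h) x := by
    rw [← Lp.toTemperedDistribution_apply, ← Lp.toTemperedDistribution_apply,
      ← Lp.fourier_toTemperedDistribution_eq]
    rfl
  have e2 : ∫ x, (𝓕 φ) x • (h2.toLp h) x = ∫ x, (𝓕 φ) x • h x := by
    refine integral_congr_ae ?_
    filter_upwards [h2.coeFn_toLp] with x hx
    rw [hx]
  have e3 : ∫ x, (𝓕 φ) x • h x = ∫ x, φ x • 𝓕 h x := by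
    have := VectorFourier.integral_bilin_fourierIntegral_eq_flip
      (ContinuousLinearMap.mul ℂ ℂ) (L := innerₗ ℝ) (μ := volume) (ν := volume)
      Real.continuous_fourierChar continuous_inner φ.integrable h1
    simpa using! this
  have := e1.trans (e2.trans e3)
  simpa [hφ, Complex.real_smul] using this

lemma memLp_fourier {h : ℝ → ℂ} (h1 : Integrable h) (h2 : MemLp h 2) : MemLp (𝓕 h) 2 :=
  (memLp_congr_ae (fourier_toLp_ae_eq h1 h2)).1 (Lp.memLp _)

/-- Parseval's identity on `L¹ ∩ L²`. -/
lemma integral_inner_fourier {f g : ℝ → ℂ} (f1 : Integrable f) (f2 : MemLp f 2)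
    (g1 : Integrable g) (g2 : MemLp g 2) :
    ∫ x, inner ℂ (𝓕 f x) (𝓕 g x) = ∫ x, inner ℂ (f x) (g x) := by
  have := Lp.inner_fourier_eq (f2.toLp f) (g2.toLp g)
  rw [L2.inner_def, L2.inner_def] at this
  have l : ∫ x, inner ℂ (𝓕 f x) (𝓕 g x) = ∫ x,
      inner ℂ ((𝓕 (f2.toLp f) : Lp ℂ 2 (volume : Measure ℝ)) x)
      ((𝓕 (g2.toLp g) : Lp ℂ 2 (volume : Measure ℝ)) x) := by
    refine integral_congr_ae ?_
    filter_upwards [fourier_toLp_ae_eq f1 f2, fourier_toLp_ae_eq g1 g2] with x hx hy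
    rw [hx, hy]
  rw [l, this]
  refine integral_congr_ae ?_
  filter_upwards [f2.coeFn_toLp, g2.coeFn_toLp] with x hx hy
  rw [hx, hy]

/-- The Fourier transform of `g` on `[-1,1]` along the phase `U`. -/
noncomputable def phaseFourier (U : ℝ → ℝ) (g : ℝ → ℂ) (ξ : ℝ) : ℂ :=
  ∫ y in (-1:ℝ)..1, Complex.exp (((-2 * Real.pi * U y * ξ : ℝ) : ℂ) * Complex.I) * g y

section Phase

/-- `U` is a `C¹` phase with derivative `1 - w`, where `w` is small on `[-1,1]`. -/
structure IsPhase (U w : ℝ → ℝ) : Prop where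
  hasDerivAt : ∀ y, HasDerivAt U (1 - w y) y
  continuous_defect : Continuous w
  abs_defect_le : ∀ y ∈ Icc (-1:ℝ) 1, |w y| ≤ 1 / 2

variable {U w : ℝ → ℝ}

lemma phase_injOn (hp : IsPhase U w) : InjOn U (Icc (-1:ℝ) 1) := by
  refine (strictMonoOn_of_deriv_pos (convex_Icc _ _)
    (fun y _ => (hp.hasDerivAt y).continuousAt.continuousWithinAt) fun y hy => ?_).injOn
  rw [(hp.hasDerivAt y).deriv]
  have := abs_le.1 (hp.abs_defect_le y (interior_subset hy))
  linarith

/-- The density on the line whose Fourier transform is `phaseFourier U g`. -/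
noncomputable def phaseDensity (U w : ℝ → ℝ) (g : ℝ → ℂ) : ℝ → ℂ :=
  indicator (U '' Icc (-1:ℝ) 1) fun v =>
    ((1 - w (Function.invFunOn U (Icc (-1:ℝ) 1) v) : ℝ) : ℂ)⁻¹ *
      g (Function.invFunOn U (Icc (-1:ℝ) 1) v)

lemma measurableSet_phase_image (hp : IsPhase U w) : MeasurableSet (U '' Icc (-1:ℝ) 1) :=
  (isCompact_Icc.image (continuous_iff_continuousAt.2
    fun y => (hp.hasDerivAt y).continuousAt)).measurableSet

lemma integral_phase_image (hp : IsPhase U w) {E : Type*} [NormedAddCommGroup E] [NormedSpace ℝ E]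
    (Φ : ℝ → ℝ → E) :
    ∫ v in U '' Icc (-1:ℝ) 1, Φ v (Function.invFunOn U (Icc (-1:ℝ) 1) v)
      = ∫ y in (-1:ℝ)..1, (1 - w y) • Φ (U y) y := by
  have hinj := phase_injOn hp
  rw [integral_image_eq_integral_abs_deriv_smul measurableSet_Icc
    (fun y _ => (hp.hasDerivAt y).hasDerivWithinAt) hinj, intervalIntegral.integral_of_le (by norm_num),
    ← integral_Icc_eq_integral_Ioc]
  refine setIntegral_congr_fun measurableSet_Icc fun y hy => ?_
  have := abs_le.1 (hp.abs_defect_le y hy)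
  simp only [hinj.leftInvOn_invFunOn hy]
  rw [abs_of_pos (by linarith)]

lemma integrableOn_phase_image (hp : IsPhase U w) {E : Type*} [NormedAddCommGroup E]
    [NormedSpace ℝ E]
    {Φ : ℝ → ℝ → E} (h : ContinuousOn (fun y => (1 - w y) • Φ (U y) y) (Icc (-1:ℝ) 1)) :
    IntegrableOn (fun v => Φ v (Function.invFunOn U (Icc (-1:ℝ) 1) v)) (U '' Icc (-1:ℝ) 1) := by
  have hinj := phase_injOn hp
  rw [integrableOn_image_iff_integrableOn_abs_deriv_smul measurableSet_Icc
    (fun y _ => (hp.hasDerivAt y).hasDerivWithinAt) hinj]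
  refine (h.integrableOn_compact isCompact_Icc).congr_fun (fun y hy => ?_) measurableSet_Icc
  have := abs_le.1 (hp.abs_defect_le y hy)
  simp only [hinj.leftInvOn_invFunOn hy]
  rw [abs_of_pos (by linarith)]

lemma continuousOn_inv_phase (hp : IsPhase U w) :
    ContinuousOn (fun y => ((1 - w y : ℝ) : ℂ)⁻¹) (Icc (-1:ℝ) 1) := by
  have hwc := hp.continuous_defect
  refine ContinuousOn.inv₀ (by fun_prop) fun y hy => ?_
  have := abs_le.1 (hp.abs_defect_le y hy)
  exact_mod_cast (by linarith : (1 - w y) ≠ 0)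

lemma integrable_phaseDensity (hp : IsPhase U w) {g : ℝ → ℂ} (hg : ContinuousOn g (Icc (-1:ℝ) 1)) :
    Integrable (phaseDensity U w g) := by
  refine (integrable_indicator_iff (measurableSet_phase_image hp)).2 ?_
  refine integrableOn_phase_image hp
    (Φ := fun _ y => ((1 - w y : ℝ) : ℂ)⁻¹ * g y) ?_
  exact (continuousOn_const.sub hp.continuous_defect.continuousOn).smul
    ((continuousOn_inv_phase hp).mul hg)

lemma memLp_phaseDensity (hp : IsPhase U w) {g : ℝ → ℂ} (hg : ContinuousOn g (Icc (-1:ℝ) 1)) :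
    MemLp (phaseDensity U w g) 2 := by
  refine (memLp_two_iff_integrable_sq_norm
    (integrable_phaseDensity hp hg).aestronglyMeasurable).2 ?_
  have : (fun v => ‖phaseDensity U w g v‖ ^ 2) = indicator (U '' Icc (-1:ℝ) 1) fun v =>
    ‖((1 - w (Function.invFunOn U (Icc (-1:ℝ) 1) v) : ℝ) : ℂ)⁻¹ *
      g (Function.invFunOn U (Icc (-1:ℝ) 1) v)‖ ^ 2 := by
    ext v
    by_cases hv : v ∈ U '' Icc (-1:ℝ) 1 <;> simp [phaseDensity, hv]
  rw [this]
  refine (integrable_indicator_iff (measurableSet_phase_image hp)).2 ?_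
  refine integrableOn_phase_image hp
    (Φ := fun _ y => ‖((1 - w y : ℝ) : ℂ)⁻¹ * g y‖ ^ 2) ?_
  exact (continuousOn_const.sub hp.continuous_defect.continuousOn).smul
    (((continuousOn_inv_phase hp).mul hg).norm.pow 2)

lemma fourier_phaseDensity (hp : IsPhase U w) (g : ℝ → ℂ) :
    𝓕 (phaseDensity U w g) = phaseFourier U g := by
  ext ξ
  rw [Real.fourier_real_eq_integral_exp_smul, phaseFourier]
  have : (fun v : ℝ => Complex.exp (((-2 * Real.pi * v * ξ : ℝ) : ℂ) * Complex.I) •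
      phaseDensity U w g v) = indicator (U '' Icc (-1:ℝ) 1) fun v =>
      (fun v y => Complex.exp (((-2 * Real.pi * v * ξ : ℝ) : ℂ) * Complex.I) *
        (((1 - w y : ℝ) : ℂ)⁻¹ * g y)) v (Function.invFunOn U (Icc (-1:ℝ) 1) v) := by
    ext v
    by_cases hv : v ∈ U '' Icc (-1:ℝ) 1 <;> simp [phaseDensity, hv]
  rw [this, integral_indicator (measurableSet_phase_image hp),
    integral_phase_image hp fun v y =>
      Complex.exp (((-2 * Real.pi * v * ξ : ℝ) : ℂ) * Complex.I) * (((1 - w y : ℝ) : ℂ)⁻¹ * g y)]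
  refine intervalIntegral.integral_congr fun y hy => ?_
  rw [uIcc_of_le (by norm_num)] at hy
  have h0 := abs_le.1 (hp.abs_defect_le y hy)
  have h1 : ((1 - w y : ℝ) : ℂ) ≠ 0 := by exact_mod_cast (by linarith : (1 - w y) ≠ 0)
  simp only [Complex.real_smul]
  field_simp

lemma integral_inner_phaseFourier (hp : IsPhase U w) {f g : ℝ → ℂ}
    (hf : ContinuousOn f (Icc (-1:ℝ) 1))
    (hg : ContinuousOn g (Icc (-1:ℝ) 1)) :
    ∫ ξ, inner ℂ (phaseFourier U f ξ) (phaseFourier U g ξ)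
      = ∫ y in (-1:ℝ)..1, (1 - w y)⁻¹ • inner ℂ (f y) (g y) := by
  rw [← fourier_phaseDensity hp f, ← fourier_phaseDensity hp g,
    integral_inner_fourier (integrable_phaseDensity hp hf) (memLp_phaseDensity hp hf)
    (integrable_phaseDensity hp hg) (memLp_phaseDensity hp hg)]
  have : (fun v : ℝ => inner ℂ (phaseDensity U w f v) (phaseDensity U w g v))
      = indicator (U '' Icc (-1:ℝ) 1) fun v =>
      (fun v y => inner ℂ (((1 - w y : ℝ) : ℂ)⁻¹ * f y) (((1 - w y : ℝ) : ℂ)⁻¹ * g y))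
        v (Function.invFunOn U (Icc (-1:ℝ) 1) v) := by
    ext v
    by_cases hv : v ∈ U '' Icc (-1:ℝ) 1 <;> simp [phaseDensity, hv]
  rw [this, integral_indicator (measurableSet_phase_image hp),
    integral_phase_image hp fun _ y =>
      inner ℂ (((1 - w y : ℝ) : ℂ)⁻¹ * f y) (((1 - w y : ℝ) : ℂ)⁻¹ * g y)]
  refine intervalIntegral.integral_congr fun y hy => ?_
  rw [uIcc_of_le (by norm_num)] at hy
  have h0 := abs_le.1 (hp.abs_defect_le y hy)
  have h1 : ((1 - w y : ℝ) : ℂ) ≠ 0 := by exact_mod_cast (by linarith : (1 - w y) ≠ 0)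
  simp only [Complex.real_smul, RCLike.inner_apply, map_mul, map_inv₀, Complex.conj_ofReal,
    Complex.ofReal_inv]
  field_simp

lemma integrable_phaseFourier_sq (hp : IsPhase U w) {g : ℝ → ℂ}
    (hg : ContinuousOn g (Icc (-1:ℝ) 1)) :
    Integrable fun ξ => ‖phaseFourier U g ξ‖ ^ 2 := by
  have := memLp_fourier (integrable_phaseDensity hp hg) (memLp_phaseDensity hp hg)
  rw [fourier_phaseDensity hp] at this
  exact (memLp_two_iff_integrable_sq_norm this.1).1 this

lemma integral_phaseFourier_sq_le (hp : IsPhase U w) {g : ℝ → ℂ}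
    (hg : ContinuousOn g (Icc (-1:ℝ) 1)) :
    ∫ ξ, ‖phaseFourier U g ξ‖ ^ 2 ≤ 2 * ∫ y in (-1:ℝ)..1, ‖g y‖ ^ 2 := by
  have key := integral_inner_phaseFourier hp hg hg
  have e1 : ∫ ξ, inner ℂ (phaseFourier U g ξ) (phaseFourier U g ξ)
      = ((∫ ξ, ‖phaseFourier U g ξ‖ ^ 2 : ℝ) : ℂ) := by
    rw [← integral_complex_ofReal]
    congr 1
    ext ξ
    rw [inner_self_eq_norm_sq_to_K]
    push_cast
    rfl
  have e2 : ∫ y in (-1:ℝ)..1, (1 - w y)⁻¹ • inner ℂ (g y) (g y)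
      = ((∫ y in (-1:ℝ)..1, (1 - w y)⁻¹ * ‖g y‖ ^ 2 : ℝ) : ℂ) := by
    rw [← intervalIntegral.integral_ofReal]
    congr 1
    ext ξ
    rw [inner_self_eq_norm_sq_to_K, Complex.real_smul]
    push_cast
    rfl
  rw [e1, e2] at key
  have key' : ∫ ξ, ‖phaseFourier U g ξ‖ ^ 2 = ∫ y in (-1:ℝ)..1, (1 - w y)⁻¹ * ‖g y‖ ^ 2 := by
    exact_mod_cast key
  rw [key', ← intervalIntegral.integral_const_mul]
  have hc : ContinuousOn (fun y => (1 - w y)⁻¹) (Icc (-1:ℝ) 1) := by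
    have hwc := hp.continuous_defect
    refine ContinuousOn.inv₀ (by fun_prop) fun y hy => ?_
    have := abs_le.1 (hp.abs_defect_le y hy)
    linarith
  refine intervalIntegral.integral_mono_on (by norm_num) ?_ ?_ fun y hy => ?_
  · exact ContinuousOn.intervalIntegrable_of_Icc (by norm_num) (hc.mul (hg.norm.pow 2))
  · exact ContinuousOn.intervalIntegrable_of_Icc (by norm_num)
      (continuousOn_const.mul (hg.norm.pow 2))
  · have := abs_le.1 (hp.abs_defect_le y hy)
    gcongr
    rw [inv_le_comm₀ (by linarith) (by norm_num)]
    linarith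

end Phase

section PhaseEstimates

variable {U w : ℝ → ℝ}

lemma IsPhase.continuous (hp : IsPhase U w) : Continuous U :=
  continuous_iff_continuousAt.2 fun y => (hp.hasDerivAt y).continuousAt

lemma IsPhase.half_le (hp : IsPhase U w) {y : ℝ} (hy : y ∈ Icc (-1:ℝ) 1) : 1 / 2 ≤ 1 - w y := by
  have := abs_le.1 (hp.abs_defect_le y hy)
  linarith

lemma hasDerivAt_phase_exp (hp : IsPhase U w) (ξ y : ℝ) :
    HasDerivAt (fun y => Complex.exp (((-2 * Real.pi * U y * ξ : ℝ) : ℂ) * Complex.I))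
      (Complex.exp (((-2 * Real.pi * U y * ξ : ℝ) : ℂ) * Complex.I) *
        (((-2 * Real.pi * (1 - w y) * ξ : ℝ) : ℂ) * Complex.I)) y :=
  (((((hp.hasDerivAt y).const_mul (-2 * Real.pi)).mul_const ξ).ofReal_comp).mul_const
    Complex.I).cexp

lemma continuous_phase_exp (hp : IsPhase U w) (ξ : ℝ) :
    Continuous fun y => Complex.exp (((-2 * Real.pi * U y * ξ : ℝ) : ℂ) * Complex.I) :=
  continuous_iff_continuousAt.2 fun y => (hasDerivAt_phase_exp hp ξ y).continuousAt

/-- Integration by parts against the phase. -/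
lemma phaseFourier_deriv (hp : IsPhase U w) {f f' : ℝ → ℂ}
    (hf : ∀ y ∈ Icc (-1:ℝ) 1, HasDerivAt f (f' y) y) (hf' : ContinuousOn f' (Icc (-1:ℝ) 1))
    (h0 : f (-1) = 0) (h1 : f 1 = 0) (ξ : ℝ) :
    ((2 * Real.pi * ξ : ℝ) : ℂ) * Complex.I *
      phaseFourier U (fun y => ((1 - w y : ℝ) : ℂ) * f y) ξ = phaseFourier U f' ξ := by
  have hu : uIcc (-1:ℝ) 1 = Icc (-1) 1 := uIcc_of_le (by norm_num)
  have hwc := hp.continuous_defect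
  have hUc := hp.continuous
  have := intervalIntegral.integral_mul_deriv_eq_deriv_mul (a := -1) (b := 1)
    (fun y _ => hasDerivAt_phase_exp hp ξ y) (fun y hy => hf y (hu ▸ hy))
    (Continuous.intervalIntegrable (by fun_prop) _ _)
    (ContinuousOn.intervalIntegrable (hu ▸ hf'))
  rw [h0, h1] at this
  rw [phaseFourier, phaseFourier, this, ← intervalIntegral.integral_const_mul, mul_zero, mul_zero,
    sub_zero, zero_sub, ← intervalIntegral.integral_neg]
  refine intervalIntegral.integral_congr fun y _ => ?_
  push_cast
  ring

lemma phaseFourier_congr {f g : ℝ → ℂ} (h : ∀ y ∈ Icc (-1:ℝ) 1, f y = g y) :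
    phaseFourier U f = phaseFourier U g := by
  ext ξ
  refine intervalIntegral.integral_congr fun y hy => ?_
  rw [uIcc_of_le (by norm_num)] at hy
  simp only [h y hy]

/-- The derivative of `g / (1 - w)` in expanded form. -/
noncomputable def phaseDeriv (w w' : ℝ → ℝ) (g g' : ℝ → ℂ) (y : ℝ) : ℂ :=
  ((1 - w y : ℝ) : ℂ)⁻¹ * g' y + ((w' y : ℝ) : ℂ) * (((1 - w y : ℝ) : ℂ)⁻¹) ^ 2 * g y

lemma continuousOn_phaseDeriv (hp : IsPhase U w) {w' : ℝ → ℝ} {g g' : ℝ → ℂ}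
    (hw' : ContinuousOn w' (Icc (-1:ℝ) 1)) (hg : ContinuousOn g (Icc (-1:ℝ) 1))
    (hg' : ContinuousOn g' (Icc (-1:ℝ) 1)) :
    ContinuousOn (phaseDeriv w w' g g') (Icc (-1:ℝ) 1) := by
  have h := continuousOn_inv_phase hp
  exact (h.mul hg').add (((Complex.continuous_ofReal.comp_continuousOn hw').mul (h.pow 2)).mul hg)

lemma phaseFourier_phaseDeriv (hp : IsPhase U w) {w' : ℝ → ℝ} {g g' : ℝ → ℂ}
    (hw : ∀ y ∈ Icc (-1:ℝ) 1, HasDerivAt w (w' y) y)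
    (hw' : ContinuousOn w' (Icc (-1:ℝ) 1))
    (hg : ∀ y ∈ Icc (-1:ℝ) 1, HasDerivAt g (g' y) y) (hg' : ContinuousOn g' (Icc (-1:ℝ) 1))
    (h0 : g (-1) = 0) (h1 : g 1 = 0) (ξ : ℝ) :
    ((2 * Real.pi * ξ : ℝ) : ℂ) * Complex.I * phaseFourier U g ξ
      = phaseFourier U (phaseDeriv w w' g g') ξ := by
  have hgc : ContinuousOn g (Icc (-1:ℝ) 1) :=
    fun y hy => (hg y hy).continuousAt.continuousWithinAt
  have hne : ∀ y ∈ Icc (-1:ℝ) 1, ((1 - w y : ℝ) : ℂ) ≠ 0 := fun y hy => by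
    have := hp.half_le hy
    exact_mod_cast (by linarith : (1 - w y) ≠ 0)
  have := phaseFourier_deriv hp (f := fun y => ((1 - w y : ℝ) : ℂ)⁻¹ * g y)
    (f' := phaseDeriv w w' g g') ?_ (continuousOn_phaseDeriv hp hw' hgc hg') (by simp [h0])
    (by simp [h1]) ξ
  · rw [← this]
    congr 1
    refine congrFun (phaseFourier_congr fun y hy => ?_) ξ
    rw [mul_inv_cancel_left₀ (hne y hy)]
  · intro y hy
    have hd := ((((hw y hy).const_sub 1).ofReal_comp).inv (hne y hy)).mul (hg y hy)
    refine hd.congr_deriv ?_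
    rw [phaseDeriv]
    have := hne y hy
    simp only [Pi.inv_apply]
    push_cast at this ⊢
    field_simp
    ring

lemma norm_phaseFourier_sq_mul (g h : ℝ → ℂ) (ξ : ℝ)
    (H : ((2 * Real.pi * ξ : ℝ) : ℂ) * Complex.I * phaseFourier U g ξ = phaseFourier U h ξ) :
    (2 * Real.pi) ^ 2 * (ξ ^ 2 * ‖phaseFourier U g ξ‖ ^ 2) = ‖phaseFourier U h ξ‖ ^ 2 := by
  rw [← H, norm_mul, norm_mul, Complex.norm_I, Complex.norm_real, mul_one,
    Real.norm_eq_abs, mul_pow |_|, sq_abs]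
  ring

lemma integrable_weighted_phaseFourier (hp : IsPhase U w) {g h : ℝ → ℂ} (K : ℝ)
    (hg : ContinuousOn g (Icc (-1:ℝ) 1)) (hh : ContinuousOn h (Icc (-1:ℝ) 1))
    (H : ∀ ξ : ℝ, ((2 * Real.pi * ξ : ℝ) : ℂ) * Complex.I * phaseFourier U g ξ
      = phaseFourier U h ξ) :
    Integrable fun ξ => (K ^ 2 + ξ ^ 2) * ‖phaseFourier U g ξ‖ ^ 2 := by
  have := ((integrable_phaseFourier_sq hp hg).const_mul (K ^ 2)).add
    ((integrable_phaseFourier_sq hp hh).const_mul ((2 * Real.pi) ^ 2)⁻¹)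
  refine this.congr (Filter.Eventually.of_forall fun ξ => ?_)
  simp only [Pi.add_apply]
  rw [← norm_phaseFourier_sq_mul g h ξ (H ξ), inv_mul_cancel_left₀ (by positivity)]
  ring

lemma integral_weighted_phaseFourier_le (hp : IsPhase U w) {g h : ℝ → ℂ} (K : ℝ)
    (hg : ContinuousOn g (Icc (-1:ℝ) 1)) (hh : ContinuousOn h (Icc (-1:ℝ) 1))
    (H : ∀ ξ : ℝ, ((2 * Real.pi * ξ : ℝ) : ℂ) * Complex.I * phaseFourier U g ξ
      = phaseFourier U h ξ) :
    ∫ ξ, (K ^ 2 + ξ ^ 2) * ‖phaseFourier U g ξ‖ ^ 2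
      ≤ 2 * K ^ 2 * (∫ y in (-1:ℝ)..1, ‖g y‖ ^ 2) + 1 / 18 * ∫ y in (-1:ℝ)..1, ‖h y‖ ^ 2 := by
  have e : (fun ξ => (K ^ 2 + ξ ^ 2) * ‖phaseFourier U g ξ‖ ^ 2) = fun ξ =>
      K ^ 2 * ‖phaseFourier U g ξ‖ ^ 2 + ((2 * Real.pi) ^ 2)⁻¹ * ‖phaseFourier U h ξ‖ ^ 2 := by
    ext ξ
    rw [← norm_phaseFourier_sq_mul g h ξ (H ξ), inv_mul_cancel_left₀ (by positivity)]
    ring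
  rw [e, integral_add ((integrable_phaseFourier_sq hp hg).const_mul _)
    ((integrable_phaseFourier_sq hp hh).const_mul _), integral_const_mul, integral_const_mul]
  have h1 := mul_le_mul_of_nonneg_left (integral_phaseFourier_sq_le hp hg) (sq_nonneg K)
  have hpi : ((2 * Real.pi) ^ 2)⁻¹ ≤ 1 / 36 := by
    rw [inv_le_comm₀ (by positivity) (by norm_num)]
    nlinarith [Real.pi_gt_three]
  have h0 : 0 ≤ ∫ ξ, ‖phaseFourier U h ξ‖ ^ 2 := integral_nonneg fun _ => by positivity
  have h2 : ((2 * Real.pi) ^ 2)⁻¹ * ∫ ξ, ‖phaseFourier U h ξ‖ ^ 2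
      ≤ 1 / 36 * (2 * ∫ y in (-1:ℝ)..1, ‖h y‖ ^ 2) :=
    mul_le_mul hpi (integral_phaseFourier_sq_le hp hh) h0 (by norm_num)
  linarith

lemma norm_intervalIntegral_sq_le {h : ℝ → ℂ} (hh : ContinuousOn h (Icc (-1:ℝ) 1)) :
    ‖∫ y in (-1:ℝ)..1, h y‖ ^ 2 ≤ 2 * ∫ y in (-1:ℝ)..1, ‖h y‖ ^ 2 := by
  set m := ‖∫ y in (-1:ℝ)..1, h y‖
  have i1 : IntervalIntegrable (fun y => ‖h y‖) volume (-1) 1 :=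
    ContinuousOn.intervalIntegrable_of_Icc (by norm_num) hh.norm
  have i2 : IntervalIntegrable (fun y => ‖h y‖ ^ 2) volume (-1) 1 :=
    ContinuousOn.intervalIntegrable_of_Icc (by norm_num) (hh.norm.pow 2)
  have hm : m ≤ ∫ y in (-1:ℝ)..1, ‖h y‖ :=
    intervalIntegral.norm_integral_le_integral_norm (by norm_num)
  have hm0 : 0 ≤ m := norm_nonneg _
  have h2 : ∫ y in (-1:ℝ)..1, m * ‖h y‖ ≤ ∫ y in (-1:ℝ)..1, (m ^ 2 / 4 + ‖h y‖ ^ 2) := by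
    refine intervalIntegral.integral_mono_on (by norm_num) (i1.const_mul _)
      (intervalIntegrable_const.add i2) fun y _ => ?_
    nlinarith [sq_nonneg (m / 2 - ‖h y‖)]
  rw [intervalIntegral.integral_const_mul, intervalIntegral.integral_add intervalIntegrable_const i2,
    intervalIntegral.integral_const] at h2
  have h3 := mul_le_mul_of_nonneg_left hm hm0
  rw [smul_eq_mul] at h2
  linarith

lemma norm_phaseFourier_sq_le (hp : IsPhase U w) {h : ℝ → ℂ}
    (hh : ContinuousOn h (Icc (-1:ℝ) 1)) (ξ : ℝ) :
    ‖phaseFourier U h ξ‖ ^ 2 ≤ 2 * ∫ y in (-1:ℝ)..1, ‖h y‖ ^ 2 := by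
  refine (norm_intervalIntegral_sq_le
    ((continuous_phase_exp hp ξ).continuousOn.mul hh)).trans_eq ?_
  congr 1
  refine intervalIntegral.integral_congr fun y _ => ?_
  rw [Pi.mul_apply, Complex.norm_mul, Complex.norm_exp_ofReal_mul_I, one_mul]

end PhaseEstimates

lemma integral_eq_zero_of_hasDerivAt {E : Type*} [NormedAddCommGroup E] [NormedSpace ℝ E]
    [CompleteSpace E] {T T' : ℝ → E} (h : ∀ y ∈ Icc (-1:ℝ) 1, HasDerivAt T (T' y) y)
    (hc : ContinuousOn T' (Icc (-1:ℝ) 1)) (h0 : T (-1) = 0) (h1 : T 1 = 0) :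
    ∫ y in (-1:ℝ)..1, T' y = 0 := by
  have hu : uIcc (-1:ℝ) 1 = Icc (-1) 1 := uIcc_of_le (by norm_num)
  rw [intervalIntegral.integral_eq_sub_of_hasDerivAt (fun y hy => h y (hu ▸ hy))
    (ContinuousOn.intervalIntegrable (hu ▸ hc)), h0, h1, sub_zero]

section StreamFunction

variable {U w : ℝ → ℝ} {ω ψ ψ' ψ'' : ℝ → ℂ} {K : ℝ}

lemma integral_inner_stream (hψ : ∀ y ∈ Icc (-1:ℝ) 1, HasDerivAt ψ (ψ' y) y)
    (hψ' : ∀ y ∈ Icc (-1:ℝ) 1, HasDerivAt ψ' (ψ'' y) y)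
    (hψ'' : ContinuousOn ψ'' (Icc (-1:ℝ) 1)) (h0 : ψ (-1) = 0) (h1 : ψ 1 = 0)
    (hω : ∀ y ∈ Icc (-1:ℝ) 1, ψ'' y - (K : ℂ) ^ 2 * ψ y = ω y) :
    ∫ y in (-1:ℝ)..1, inner ℂ (ω y) (ψ y)
      = -((∫ y in (-1:ℝ)..1, (‖ψ' y‖ ^ 2 + K ^ 2 * ‖ψ y‖ ^ 2) : ℝ) : ℂ) := by
  have c0 : ContinuousOn ψ (Icc (-1:ℝ) 1) := fun y hy => (hψ y hy).continuousAt.continuousWithinAt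
  have c1 : ContinuousOn ψ' (Icc (-1:ℝ) 1) :=
    fun y hy => (hψ' y hy).continuousAt.continuousWithinAt
  have hu : uIcc (-1:ℝ) 1 = Icc (-1) 1 := uIcc_of_le (by norm_num)
  have hz := integral_eq_zero_of_hasDerivAt (T := fun y => inner ℂ (ψ' y) (ψ y))
    (T' := fun y => inner ℂ (ψ' y) (ψ' y) + inner ℂ (ψ'' y) (ψ y))
    (fun y hy => (hψ' y hy).inner ℂ (hψ y hy)) ((c1.inner c1).add (hψ''.inner c0))
    (by simp [h0]) (by simp [h1])
  have i3 : IntervalIntegrable (fun y => ((‖ψ' y‖ ^ 2 + K ^ 2 * ‖ψ y‖ ^ 2 : ℝ) : ℂ)) volume (-1) 1 :=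
    ContinuousOn.intervalIntegrable_of_Icc (by norm_num)
      (Complex.continuous_ofReal.comp_continuousOn
        ((c1.norm.pow 2).add (continuousOn_const.mul (c0.norm.pow 2))))
  have cω : ContinuousOn ω (Icc (-1:ℝ) 1) :=
    (hψ''.sub (continuousOn_const.mul c0)).congr fun y hy => (hω y hy).symm
  have i2 : IntervalIntegrable (fun y => inner ℂ (ω y) (ψ y)) volume (-1) 1 :=
    ContinuousOn.intervalIntegrable_of_Icc (by norm_num) (cω.inner c0)
  rw [← intervalIntegral.integral_ofReal, eq_neg_iff_add_eq_zero,
    ← intervalIntegral.integral_add i2 i3, ← hz]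
  refine intervalIntegral.integral_congr fun y hy => ?_
  rw [hu] at hy
  simp only [← hω y hy, inner_sub_left, inner_self_eq_norm_sq_to_K]
  have : inner ℂ ((K:ℂ) ^ 2 * ψ y) (ψ y) = (K:ℂ) ^ 2 * (‖ψ y‖:ℂ) ^ 2 := by
    have e := inner_smul_left (𝕜 := ℂ) (ψ y) (ψ y) ((K:ℂ) ^ 2)
    rw [smul_eq_mul] at e
    rw [e, inner_self_eq_norm_sq_to_K]
    simp
  rw [this]
  simp only [Complex.coe_algebraMap]
  push_cast
  ring

/-- The energy of the stream function is controlled by the weighted Fourier mass of the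
vorticity, truncated to frequencies below `R`. -/
lemma stream_energy_le (hp : IsPhase U w) (hK : 0 < K) {R : ℝ} (hR : 0 < R)
    (hψ : ∀ y ∈ Icc (-1:ℝ) 1, HasDerivAt ψ (ψ' y) y)
    (hψ' : ∀ y ∈ Icc (-1:ℝ) 1, HasDerivAt ψ' (ψ'' y) y)
    (hψ'' : ContinuousOn ψ'' (Icc (-1:ℝ) 1)) (h0 : ψ (-1) = 0) (h1 : ψ 1 = 0)
    (hω : ∀ y ∈ Icc (-1:ℝ) 1, ψ'' y - (K : ℂ) ^ 2 * ψ y = ω y) :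
    ∫ y in (-1:ℝ)..1, (‖ψ' y‖ ^ 2 + K ^ 2 * ‖ψ y‖ ^ 2)
      ≤ 9 / 2 * ((∫ ξ in (-R)..R, ‖phaseFourier U ω ξ‖ ^ 2 / (K ^ 2 + ξ ^ 2))
        + 2 / R ^ 2 * ∫ y in (-1:ℝ)..1, ‖ω y‖ ^ 2) := by
  set D := ∫ y in (-1:ℝ)..1, (‖ψ' y‖ ^ 2 + K ^ 2 * ‖ψ y‖ ^ 2) with hD
  have c0 : ContinuousOn ψ (Icc (-1:ℝ) 1) := fun y hy => (hψ y hy).continuousAt.continuousWithinAt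
  have c1 : ContinuousOn ψ' (Icc (-1:ℝ) 1) :=
    fun y hy => (hψ' y hy).continuousAt.continuousWithinAt
  have hu : uIcc (-1:ℝ) 1 = Icc (-1) 1 := uIcc_of_le (by norm_num)
  have cω : ContinuousOn ω (Icc (-1:ℝ) 1) :=
    (hψ''.sub (continuousOn_const.mul c0)).congr fun y hy => (hω y hy).symm
  let v : ℝ → ℂ := fun y => ((1 - w y : ℝ) : ℂ) * ψ y
  have hwc := hp.continuous_defect
  have cv : ContinuousOn v (Icc (-1:ℝ) 1) := ContinuousOn.mul (by fun_prop) c0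
  have hv := phaseFourier_deriv hp hψ c1 h0 h1
  have hwv : ∫ ξ, (K ^ 2 + ξ ^ 2) * ‖phaseFourier U v ξ‖ ^ 2 ≤ 9 / 2 * D := by
    refine (integral_weighted_phaseFourier_le hp K cv c1 hv).trans ?_
    rw [hD, ← intervalIntegral.integral_const_mul, ← intervalIntegral.integral_const_mul,
      ← intervalIntegral.integral_const_mul, ← intervalIntegral.integral_add]
    · refine intervalIntegral.integral_mono_on (by norm_num) ?_ ?_ fun y hy => ?_
      · exact ContinuousOn.intervalIntegrable_of_Icc (by norm_num)
          ((continuousOn_const.mul (cv.norm.pow 2)).add (continuousOn_const.mul (c1.norm.pow 2)))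
      · exact ContinuousOn.intervalIntegrable_of_Icc (by norm_num)
          (continuousOn_const.mul ((c1.norm.pow 2).add (continuousOn_const.mul (c0.norm.pow 2))))
      · have hvy : ‖v y‖ ^ 2 ≤ 9 / 4 * ‖ψ y‖ ^ 2 := by
          have := abs_le.1 (hp.abs_defect_le y hy)
          simp only [v]
          rw [norm_mul, Complex.norm_real, mul_pow, Real.norm_eq_abs, sq_abs]
          gcongr
          nlinarith
        have := mul_le_mul_of_nonneg_left hvy (sq_nonneg K)
        nlinarith [sq_nonneg ‖ψ' y‖]
    · exact ContinuousOn.intervalIntegrable_of_Icc (by norm_num)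
        (continuousOn_const.mul (cv.norm.pow 2))
    · exact ContinuousOn.intervalIntegrable_of_Icc (by norm_num)
        (continuousOn_const.mul (c1.norm.pow 2))
  have iω := integrable_phaseFourier_sq hp cω
  have hpos : ∀ ξ : ℝ, 0 < K ^ 2 + ξ ^ 2 := fun ξ => by positivity
  have iA : Integrable fun ξ => ‖phaseFourier U ω ξ‖ ^ 2 / (K ^ 2 + ξ ^ 2) := by
    refine (iω.const_mul (K ^ 2)⁻¹).mono'
      (iω.aestronglyMeasurable.mul (Continuous.aestronglyMeasurable ?_))
      (Filter.Eventually.of_forall fun ξ => ?_)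
    · exact Continuous.inv₀ (by fun_prop) fun ξ => (hpos ξ).ne'
    · rw [Real.norm_of_nonneg (by positivity), div_eq_inv_mul]
      gcongr
      nlinarith [sq_nonneg ξ]
  have hA : ∫ ξ, ‖phaseFourier U ω ξ‖ ^ 2 / (K ^ 2 + ξ ^ 2)
      ≤ (∫ ξ in (-R)..R, ‖phaseFourier U ω ξ‖ ^ 2 / (K ^ 2 + ξ ^ 2))
        + 2 / R ^ 2 * ∫ y in (-1:ℝ)..1, ‖ω y‖ ^ 2 := by
    have hind : Integrable (indicator (Ioc (-R) R)
        fun ξ => ‖phaseFourier U ω ξ‖ ^ 2 / (K ^ 2 + ξ ^ 2)) := iA.indicator measurableSet_Ioc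
    have hsum := hind.add (iω.const_mul (R ^ 2)⁻¹)
    have := integral_mono iA hsum fun ξ => ?_
    · rw [integral_add' hind (iω.const_mul (R ^ 2)⁻¹), integral_indicator measurableSet_Ioc,
        ← intervalIntegral.integral_of_le (by linarith), integral_const_mul] at this
      refine this.trans ?_
      have := mul_le_mul_of_nonneg_left (integral_phaseFourier_sq_le hp cω)
        (by positivity : 0 ≤ (R ^ 2)⁻¹)
      rw [div_eq_inv_mul, mul_assoc]
      linarith
    · simp only [Pi.add_apply]
      by_cases hξ : ξ ∈ Ioc (-R) R
      · rw [indicator_of_mem hξ]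
        have : 0 ≤ (R ^ 2)⁻¹ * ‖phaseFourier U ω ξ‖ ^ 2 := by positivity
        linarith
      · rw [indicator_of_notMem hξ, zero_add, div_eq_inv_mul]
        gcongr
        have : R ^ 2 ≤ ξ ^ 2 := by
          rw [mem_Ioc, not_and_or, not_lt, not_le] at hξ
          rcases hξ with h | h <;> nlinarith
        nlinarith [sq_nonneg K]
  have hpars : ∫ ξ, inner ℂ (phaseFourier U ω ξ) (phaseFourier U v ξ) = -(D : ℂ) := by
    rw [integral_inner_phaseFourier hp cω cv, ← integral_inner_stream hψ hψ' hψ'' h0 h1 hω]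
    refine intervalIntegral.integral_congr fun y hy => ?_
    rw [hu] at hy
    have := hp.half_le hy
    have e := inner_smul_right (𝕜 := ℂ) (ω y) (ψ y) ((1 - w y : ℝ) : ℂ)
    rw [smul_eq_mul] at e
    simp only [v]
    rw [e, Complex.real_smul, Complex.ofReal_inv, inv_mul_cancel_left₀]
    exact_mod_cast (by linarith : 1 - w y ≠ 0)
  have iV := integrable_weighted_phaseFourier hp K cv c1 hv
  have hfin : ‖∫ ξ, inner ℂ (phaseFourier U ω ξ) (phaseFourier U v ξ)‖
      ≤ ∫ ξ, (9 / 4 * (‖phaseFourier U ω ξ‖ ^ 2 / (K ^ 2 + ξ ^ 2))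
        + 1 / 9 * ((K ^ 2 + ξ ^ 2) * ‖phaseFourier U v ξ‖ ^ 2)) := by
    refine norm_integral_le_of_norm_le ((iA.const_mul _).add (iV.const_mul _))
      (Filter.Eventually.of_forall fun ξ => ?_)
    refine (norm_inner_le_norm _ _).trans ?_
    set a := ‖phaseFourier U ω ξ‖
    set b := ‖phaseFourier U v ξ‖
    set p := K ^ 2 + ξ ^ 2
    have hp0 : 0 < p := hpos ξ
    have : 0 ≤ 1 / p * (3 / 2 * a - 1 / 3 * (p * b)) ^ 2 := by positivity
    have e : 1 / p * (3 / 2 * a - 1 / 3 * (p * b)) ^ 2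
        = 9 / 4 * (a ^ 2 / p) + 1 / 9 * (p * b ^ 2) - a * b := by
      field_simp
      ring
    linarith
  rw [hpars, norm_neg, Complex.norm_real, integral_add (iA.const_mul _) (iV.const_mul _),
    integral_const_mul, integral_const_mul] at hfin
  have := (le_abs_self D).trans hfin
  linarith

end StreamFunction

lemma cinner_eq (z v : ℂ) : inner ℝ z v = z.re * v.re + z.im * v.im := by
  simp [Complex.inner, mul_comm]

lemma cnorm_sq_eq (z : ℂ) : ‖z‖ ^ 2 = z.re ^ 2 + z.im ^ 2 := by
  rw [Complex.sq_norm, Complex.normSq_apply]; ring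

section Hypocoercivity

/-- The integrand of the time derivative of the hypocoercive energy. -/
noncomputable def hypoRate (a b σ : ℝ) (f f' f'' ft : ℂ) : ℝ :=
  2 * inner ℝ f ft - 2 * a * inner ℝ f'' ft + 2 * b * σ * inner ℝ (Complex.I * ft) f'

/-- The part of `hypoRate` left after removing a total derivative. -/
noncomputable def hypoBulk (a b σ k μ u' : ℝ) (f f' f'' g g' h : ℂ) : ℝ :=
  -2 * μ * ‖f'‖ ^ 2 - 2 * k * inner ℝ f (Complex.I * g) - 2 * k * inner ℝ f (Complex.I * h)
    - 2 * a * k * u' * inner ℝ f' (Complex.I * f) - 2 * a * k * inner ℝ f' (Complex.I * g')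
    - 2 * a * μ * ‖f''‖ ^ 2 + 2 * a * k * inner ℝ f'' (Complex.I * h)
    - b * σ * k * u' * ‖f‖ ^ 2 - 2 * b * σ * k * inner ℝ g' f
    + 2 * b * σ * μ * inner ℝ (Complex.I * f'') f' + 2 * b * σ * k * inner ℝ h f'

/-- The derivative of the flux produced by the integrations by parts. -/
noncomputable def hypoFlux (a b σ k μ u u' : ℝ) (f f' f'' g g' : ℂ) : ℝ :=
  2 * μ * (inner ℝ f f'' + inner ℝ f' f')
    + 2 * a * k * (u' * inner ℝ f' (Complex.I * f)
      + u * (inner ℝ f' (Complex.I * f') + inner ℝ f'' (Complex.I * f)))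
    + 2 * a * k * (inner ℝ f' (Complex.I * g') + inner ℝ f'' (Complex.I * g))
    + b * σ * k * (u' * inner ℝ f f + u * (inner ℝ f f' + inner ℝ f' f))
    + 2 * b * σ * k * (inner ℝ g f' + inner ℝ g' f)

lemma hypoRate_eq (a b σ k μ u u' : ℝ) (f f' f'' g g' h ft : ℂ)
    (hft : ft = -(Complex.I * k * u * f) - Complex.I * k * g + μ * f'' - Complex.I * k * h) :
    hypoRate a b σ f f' f'' ft
      = hypoBulk a b σ k μ u' f f' f'' g g' h + hypoFlux a b σ k μ u u' f f' f'' g g' := by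
  subst hft
  simp only [hypoRate, hypoBulk, hypoFlux, cinner_eq, cnorm_sq_eq, Complex.add_re, Complex.add_im,
    Complex.sub_re, Complex.sub_im, Complex.neg_re, Complex.neg_im, Complex.mul_re, Complex.mul_im,
    Complex.I_re, Complex.I_im, Complex.ofReal_re, Complex.ofReal_im]
  ring

lemma abs_inner_I_mul_le (z v : ℂ) : |inner ℝ z (Complex.I * v)| ≤ ‖z‖ * ‖v‖ := by
  simpa using abs_real_inner_le_norm z (Complex.I * v)

lemma abs_inner_I_mul_le' (z v : ℂ) : |inner ℝ (Complex.I * z) v| ≤ ‖z‖ * ‖v‖ := by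
  simpa using abs_real_inner_le_norm (Complex.I * z) v

lemma le_mul_of_abs_le {c x y : ℝ} (hc : |x| ≤ y) (d : ℝ) (hd : |d| ≤ c) : d * x ≤ c * y :=
  (le_abs_self _).trans (by
    rw [abs_mul]
    exact mul_le_mul hd hc (abs_nonneg _) ((abs_nonneg _).trans hd))

lemma hypo_quadratic_nonneg (X Y Z G H : ℝ) :
    0 ≤ Y ^ 2 + 1 / 100 * Z ^ 2 + 1 / 400 * X ^ 2 + 1601 * H ^ 2 + G ^ 2 - 2 * X * H
      - 3 / 100 * (X * Y) - 2 / 100 * (Y * G) - 2 / 100 * (Z * H) - 2 / 100 * (G * X)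
      - 2 / 100 * (Y * Z) - 2 / 100 * (H * Y) := by
  nlinarith [sq_nonneg (X / 40 - 40 * H), sq_nonneg (3 / 100 * X - Y / 2),
    sq_nonneg (Y / 10 - G / 10), sq_nonneg (Z / 50 - H / 2), sq_nonneg (X / 50 - G / 2),
    sq_nonneg (Y / 4 - Z / 25), sq_nonneg (Y / 10 - H / 10), sq_nonneg X, sq_nonneg Y,
    sq_nonneg Z, sq_nonneg G, sq_nonneg H]

set_option maxHeartbeats 1000000 in
lemma hypoBulk_le {s q σ u' : ℝ} (hs : 0 < s) (hq : 0 < q) (hσ : |σ| = 1)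
    (hu : |u' - 1| ≤ 1 / 2) (f f' f'' g g' h : ℂ) :
    hypoBulk (s ^ 4 / (100 * q ^ 2)) (s ^ 2 / (100 * q)) σ (σ * q ^ 3) (s ^ 6) u' f f' f'' g g' h
      ≤ -2 * (σ * q ^ 3) * inner ℝ f (Complex.I * g) - s ^ 6 * ‖f'‖ ^ 2
        - 1 / 100 * (s ^ 10 / q ^ 2) * ‖f''‖ ^ 2 - 1 / 400 * (s ^ 2 * q ^ 2) * ‖f‖ ^ 2
        + 1601 * (q ^ 4 / s ^ 2) * ‖h‖ ^ 2 + s ^ 2 * q ^ 2 * ‖g'‖ ^ 2 := by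
  have hσ2 : σ * σ = 1 := by
    rw [← abs_mul_abs_self, hσ, one_mul]
  have hu2 := abs_le.1 hu
  have key := hypo_quadratic_nonneg (s * q * ‖f‖) (s ^ 3 * ‖f'‖) (s ^ 5 * ‖f''‖ / q)
    (s * q * ‖g'‖) (q ^ 2 * ‖h‖ / s)
  have hq3 : |σ * q ^ 3| = q ^ 3 := by rw [abs_mul, hσ, one_mul, abs_of_pos (by positivity)]
  have t1 : -2 * (σ * q ^ 3) * inner ℝ f (Complex.I * h) ≤ 2 * q ^ 3 * (‖f‖ * ‖h‖) :=
    le_mul_of_abs_le (abs_inner_I_mul_le f h) _ (by rw [abs_mul, hq3]; norm_num)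
  have t2 : -2 * (s ^ 4 / (100 * q ^ 2)) * (σ * q ^ 3) * u' * inner ℝ f' (Complex.I * f)
      ≤ 3 / 100 * (s ^ 4 * q) * (‖f'‖ * ‖f‖) := by
    refine le_mul_of_abs_le (abs_inner_I_mul_le f' f) _ ?_
    have e : |-2 * (s ^ 4 / (100 * q ^ 2)) * (σ * q ^ 3) * u'| = 2 / 100 * (s ^ 4 * q) * |u'| := by
      rw [abs_mul, abs_mul, hq3, abs_mul, abs_of_pos (by positivity : 0 < s ^ 4 / (100 * q ^ 2))]
      rw [show |(-2:ℝ)| = 2 by norm_num]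
      field_simp
    rw [e]
    have : |u'| ≤ 3 / 2 := abs_le.2 ⟨by linarith, by linarith⟩
    calc 2 / 100 * (s ^ 4 * q) * |u'| ≤ 2 / 100 * (s ^ 4 * q) * (3 / 2) := by gcongr
      _ = _ := by ring
  have e3 : |2 * (s ^ 4 / (100 * q ^ 2)) * (σ * q ^ 3)| = 2 / 100 * (s ^ 4 * q) := by
    rw [abs_mul, hq3, abs_of_pos (by positivity)]
    field_simp
  have t3 : -(2 * (s ^ 4 / (100 * q ^ 2)) * (σ * q ^ 3)) * inner ℝ f' (Complex.I * g')
      ≤ 2 / 100 * (s ^ 4 * q) * (‖f'‖ * ‖g'‖) :=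
    le_mul_of_abs_le (abs_inner_I_mul_le f' g') _ (by rw [abs_neg, e3])
  have t4 : 2 * (s ^ 4 / (100 * q ^ 2)) * (σ * q ^ 3) * inner ℝ f'' (Complex.I * h)
      ≤ 2 / 100 * (s ^ 4 * q) * (‖f''‖ * ‖h‖) :=
    le_mul_of_abs_le (abs_inner_I_mul_le f'' h) _ e3.le
  have e5 : s ^ 2 / (100 * q) * σ * (σ * q ^ 3) = 1 / 100 * (s ^ 2 * q ^ 2) := by
    rw [mul_assoc, ← mul_assoc σ, hσ2]
    field_simp
  have a5 : |2 * (1 / 100 * (s ^ 2 * q ^ 2))| = 2 / 100 * (s ^ 2 * q ^ 2) := by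
    rw [abs_of_pos (by positivity)]
    ring
  have t5 : -(2 * (1 / 100 * (s ^ 2 * q ^ 2))) * inner ℝ g' f
      ≤ 2 / 100 * (s ^ 2 * q ^ 2) * (‖g'‖ * ‖f‖) :=
    le_mul_of_abs_le (abs_real_inner_le_norm _ _) _ (by rw [abs_neg, a5])
  have t6 : 2 * (1 / 100 * (s ^ 2 * q ^ 2)) * inner ℝ h f'
      ≤ 2 / 100 * (s ^ 2 * q ^ 2) * (‖h‖ * ‖f'‖) :=
    le_mul_of_abs_le (abs_real_inner_le_norm _ _) _ a5.le
  have t7 : 2 * (s ^ 2 / (100 * q)) * σ * s ^ 6 * inner ℝ (Complex.I * f'') f'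
      ≤ 2 / 100 * (s ^ 8 / q) * (‖f''‖ * ‖f'‖) := by
    refine le_mul_of_abs_le (abs_inner_I_mul_le' f'' f') _ (le_of_eq ?_)
    rw [abs_mul, abs_mul, hσ, abs_of_pos (by positivity), abs_of_pos (by positivity)]
    field_simp
  have t8 : -(1 / 100 * (s ^ 2 * q ^ 2) * u' * ‖f‖ ^ 2)
      ≤ -(1 / 100 * (s ^ 2 * q ^ 2) * (1 / 2) * ‖f‖ ^ 2) := by
    have : 0 ≤ 1 / 100 * (s ^ 2 * q ^ 2) * ‖f‖ ^ 2 := by positivity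
    nlinarith
  have id1 : s * q * ‖f‖ * (q ^ 2 * ‖h‖ / s) = q ^ 3 * (‖f‖ * ‖h‖) := by field_simp
  have id2 : s ^ 5 * ‖f''‖ / q * (q ^ 2 * ‖h‖ / s) = s ^ 4 * q * (‖f''‖ * ‖h‖) := by field_simp
  have id3 : s ^ 3 * ‖f'‖ * (s ^ 5 * ‖f''‖ / q) = s ^ 8 / q * (‖f''‖ * ‖f'‖) := by
    field_simp
  have id4 : q ^ 2 * ‖h‖ / s * (s ^ 3 * ‖f'‖) = s ^ 2 * q ^ 2 * (‖h‖ * ‖f'‖) := by field_simp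
  have id5 : (s ^ 5 * ‖f''‖ / q) ^ 2 = s ^ 10 / q ^ 2 * ‖f''‖ ^ 2 := by field_simp
  have id6 : (q ^ 2 * ‖h‖ / s) ^ 2 = q ^ 4 / s ^ 2 * ‖h‖ ^ 2 := by field_simp
  have id7 : 2 * (s ^ 4 / (100 * q ^ 2)) * s ^ 6 * ‖f''‖ ^ 2
      = 2 / 100 * (s ^ 10 / q ^ 2 * ‖f''‖ ^ 2) := by field_simp
  rw [mul_assoc 2 _ (q ^ 2 * ‖h‖ / s), id1, id2, id3, id4, id5, id6] at key
  have eq : hypoBulk (s ^ 4 / (100 * q ^ 2)) (s ^ 2 / (100 * q)) σ (σ * q ^ 3) (s ^ 6) u'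
      f f' f'' g g' h = -2 * (σ * q ^ 3) * inner ℝ f (Complex.I * g) - 2 * s ^ 6 * ‖f'‖ ^ 2
      + (-2 * (σ * q ^ 3) * inner ℝ f (Complex.I * h))
      + (-2 * (s ^ 4 / (100 * q ^ 2)) * (σ * q ^ 3) * u' * inner ℝ f' (Complex.I * f))
      + (-(2 * (s ^ 4 / (100 * q ^ 2)) * (σ * q ^ 3)) * inner ℝ f' (Complex.I * g'))
      + 2 * (s ^ 4 / (100 * q ^ 2)) * (σ * q ^ 3) * inner ℝ f'' (Complex.I * h)
      + (-(2 * (s ^ 2 / (100 * q) * σ * (σ * q ^ 3))) * inner ℝ g' f)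
      + 2 * (s ^ 2 / (100 * q) * σ * (σ * q ^ 3)) * inner ℝ h f'
      + 2 * (s ^ 2 / (100 * q)) * σ * s ^ 6 * inner ℝ (Complex.I * f'') f'
      + (-((s ^ 2 / (100 * q) * σ * (σ * q ^ 3)) * u' * ‖f‖ ^ 2))
      - 2 * (s ^ 4 / (100 * q ^ 2)) * s ^ 6 * ‖f''‖ ^ 2 := by
    rw [hypoBulk]
    ring
  rw [eq, e5, id7]
  linarith [key, t1, t2, t3, t4, t5, t6, t7, t8]

end Hypocoercivity

section HypocoerciveEnergy

lemma intervalIntegrable_norm_sq {E : Type*} [NormedAddCommGroup E] {v : ℝ → E}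
    (hv : ContinuousOn v (Icc (-1:ℝ) 1)) : IntervalIntegrable (fun y => ‖v y‖ ^ 2) volume (-1) 1 :=
  ContinuousOn.intervalIntegrable_of_Icc (by norm_num) (hv.norm.pow 2)

lemma integral_hypoRate_le {s q σ : ℝ} (hs : 0 < s) (hq : 0 < q) (hσ : |σ| = 1)
    {u w : ℝ → ℝ} (hp : IsPhase u w) {f f' f'' g g' h ft : ℝ → ℂ}
    (hf : ∀ y ∈ Icc (-1:ℝ) 1, HasDerivAt f (f' y) y)
    (hf' : ∀ y ∈ Icc (-1:ℝ) 1, HasDerivAt f' (f'' y) y)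
    (hf'' : ContinuousOn f'' (Icc (-1:ℝ) 1))
    (hg : ∀ y ∈ Icc (-1:ℝ) 1, HasDerivAt g (g' y) y)
    (hg' : ContinuousOn g' (Icc (-1:ℝ) 1)) (hh : ContinuousOn h (Icc (-1:ℝ) 1))
    (f0 : f (-1) = 0) (f1 : f 1 = 0) (g0 : g (-1) = 0) (g1 : g 1 = 0)
    (hft : ∀ y ∈ Icc (-1:ℝ) 1, ft y = -(Complex.I * (σ * q ^ 3 : ℝ) * u y * f y)
      - Complex.I * (σ * q ^ 3 : ℝ) * g y + (s ^ 6 : ℝ) * f'' y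
      - Complex.I * (σ * q ^ 3 : ℝ) * h y) :
    ∫ y in (-1:ℝ)..1, hypoRate (s ^ 4 / (100 * q ^ 2)) (s ^ 2 / (100 * q)) σ
        (f y) (f' y) (f'' y) (ft y)
      ≤ -2 * (σ * q ^ 3) * (∫ y in (-1:ℝ)..1, inner ℝ (f y) (Complex.I * g y))
        - s ^ 6 * (∫ y in (-1:ℝ)..1, ‖f' y‖ ^ 2)
        - 1 / 100 * (s ^ 10 / q ^ 2) * (∫ y in (-1:ℝ)..1, ‖f'' y‖ ^ 2)
        - 1 / 400 * (s ^ 2 * q ^ 2) * (∫ y in (-1:ℝ)..1, ‖f y‖ ^ 2)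
        + 1601 * (q ^ 4 / s ^ 2) * (∫ y in (-1:ℝ)..1, ‖h y‖ ^ 2)
        + s ^ 2 * q ^ 2 * (∫ y in (-1:ℝ)..1, ‖g' y‖ ^ 2) := by
  set a := s ^ 4 / (100 * q ^ 2) with ha
  set b := s ^ 2 / (100 * q) with hb
  set k := σ * q ^ 3 with hk
  have hu : uIcc (-1:ℝ) 1 = Icc (-1) 1 := uIcc_of_le (by norm_num)
  have cw := hp.continuous_defect.continuousOn (s := Icc (-1:ℝ) 1)
  have cu := hp.continuous.continuousOn (s := Icc (-1:ℝ) 1)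
  have c0 : ContinuousOn f (Icc (-1:ℝ) 1) := fun y hy => (hf y hy).continuousAt.continuousWithinAt
  have c1 : ContinuousOn f' (Icc (-1:ℝ) 1) :=
    fun y hy => (hf' y hy).continuousAt.continuousWithinAt
  have cg : ContinuousOn g (Icc (-1:ℝ) 1) := fun y hy => (hg y hy).continuousAt.continuousWithinAt
  have cI : ∀ {v : ℝ → ℂ}, ContinuousOn v (Icc (-1:ℝ) 1) →
      ContinuousOn (fun y => Complex.I * v y) (Icc (-1:ℝ) 1) :=
    fun hv => continuousOn_const.mul hv
  have cInt : ∀ {v : ℝ → ℝ}, ContinuousOn v (Icc (-1:ℝ) 1) →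
      IntervalIntegrable v volume (-1) 1 :=
    fun hv => ContinuousOn.intervalIntegrable_of_Icc (by norm_num) hv
  have cflux : ContinuousOn (fun y => hypoFlux a b σ k (s ^ 6) (u y) (1 - w y) (f y) (f' y) (f'' y)
      (g y) (g' y)) (Icc (-1:ℝ) 1) := by
    have cI0 := cI c0
    have cI1 := cI c1
    have cIg := cI cg
    have cIg' := cI hg'
    unfold hypoFlux
    fun_prop
  have hflux : ∫ y in (-1:ℝ)..1, hypoFlux a b σ k (s ^ 6) (u y) (1 - w y) (f y) (f' y) (f'' y)
      (g y) (g' y) = 0 := by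
    refine integral_eq_zero_of_hasDerivAt (T := fun y => 2 * s ^ 6 * inner ℝ (f y) (f' y)
      + 2 * a * k * (u y * inner ℝ (f' y) (Complex.I * f y))
      + 2 * a * k * inner ℝ (f' y) (Complex.I * g y) + b * σ * k * (u y * inner ℝ (f y) (f y))
      + 2 * b * σ * k * inner ℝ (g y) (f y)) (fun y hy => ?_) cflux (by simp [f0, g0])
      (by simp [f1, g1])
    have d0 := hf y hy
    have d1 := hf' y hy
    have dg := hg y hy
    have du := hp.hasDerivAt y
    exact (((((d0.inner ℝ d1).const_mul (2 * s ^ 6)).add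
      ((du.mul (d1.inner ℝ (d0.const_mul Complex.I))).const_mul (2 * a * k))).add
      ((d1.inner ℝ (dg.const_mul Complex.I)).const_mul (2 * a * k))).add
      ((du.mul (d0.inner ℝ d0)).const_mul (b * σ * k))).add
      ((dg.inner ℝ d0).const_mul (2 * b * σ * k))
  have cbulk : ContinuousOn (fun y => hypoBulk a b σ k (s ^ 6) (1 - w y) (f y) (f' y) (f'' y)
      (g y) (g' y) (h y)) (Icc (-1:ℝ) 1) := by
    have cI0 := cI c0
    have cI2 := cI hf''
    have cIg := cI cg
    have cIg' := cI hg'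
    have cIh := cI hh
    unfold hypoBulk
    fun_prop
  have e : ∫ y in (-1:ℝ)..1, hypoRate a b σ (f y) (f' y) (f'' y) (ft y)
      = ∫ y in (-1:ℝ)..1, hypoBulk a b σ k (s ^ 6) (1 - w y) (f y) (f' y) (f'' y)
        (g y) (g' y) (h y) := by
    rw [← add_zero (∫ y in (-1:ℝ)..1, hypoBulk a b σ k (s ^ 6) (1 - w y) (f y) (f' y) (f'' y)
        (g y) (g' y) (h y)), ← hflux, ← intervalIntegral.integral_add (cInt cbulk) (cInt cflux)]
    refine intervalIntegral.integral_congr fun y hy => ?_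
    exact hypoRate_eq _ _ _ _ _ _ _ _ _ _ _ _ _ _ (hft y (hu ▸ hy))
  rw [e]
  have i0 := cInt (c0.inner (cI cg) (𝕜 := ℝ))
  have i1 := intervalIntegrable_norm_sq c1
  have i2 := intervalIntegrable_norm_sq hf''
  have i3 := intervalIntegrable_norm_sq c0
  have i4 := intervalIntegrable_norm_sq hh
  have i5 := intervalIntegrable_norm_sq hg'
  have mono := intervalIntegral.integral_mono_on (by norm_num : (-1:ℝ) ≤ 1) (cInt cbulk)
    ((((((i0.const_mul (-2 * k)).sub (i1.const_mul (s ^ 6))).sub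
      (i2.const_mul (1 / 100 * (s ^ 10 / q ^ 2)))).sub
      (i3.const_mul (1 / 400 * (s ^ 2 * q ^ 2)))).add
      (i4.const_mul (1601 * (q ^ 4 / s ^ 2)))).add (i5.const_mul (s ^ 2 * q ^ 2)))
    (fun y hy => hypoBulk_le hs hq hσ (by simpa using hp.abs_defect_le y hy)
      (f y) (f' y) (f'' y) (g y) (g' y) (h y))
  refine mono.trans_eq ?_
  rw [← intervalIntegral.integral_const_mul, ← intervalIntegral.integral_const_mul,
    ← intervalIntegral.integral_const_mul, ← intervalIntegral.integral_const_mul,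
    ← intervalIntegral.integral_const_mul, ← intervalIntegral.integral_const_mul,
    ← intervalIntegral.integral_sub (i0.const_mul _) (i1.const_mul _),
    ← intervalIntegral.integral_sub ((i0.const_mul _).sub (i1.const_mul _)) (i2.const_mul _),
    ← intervalIntegral.integral_sub (((i0.const_mul _).sub (i1.const_mul _)).sub (i2.const_mul _))
      (i3.const_mul _),
    ← intervalIntegral.integral_add ((((i0.const_mul _).sub (i1.const_mul _)).sub
      (i2.const_mul _)).sub (i3.const_mul _)) (i4.const_mul _),
    ← intervalIntegral.integral_add (((((i0.const_mul _).sub (i1.const_mul _)).sub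
      (i2.const_mul _)).sub (i3.const_mul _)).add (i4.const_mul _)) (i5.const_mul _)]

/-- The hypocoercive energy `‖f‖² + a ‖∂_y f‖² + b σ ⟨i f, ∂_y f⟩`. -/
noncomputable def hypoEnergy (a b σ : ℝ) (f : ℝ → ℝ → ℂ) (t : ℝ) : ℝ :=
  ∫ y in (-1:ℝ)..1, (‖f t y‖ ^ 2 + a * ‖dY f t y‖ ^ 2
    + b * σ * inner ℝ (Complex.I * f t y) (dY f t y))

lemma hasDerivAt_hypoEnergy (a b σ : ℝ) {f : ℝ → ℝ → ℂ} (hf : Smooth₂ f) {t : ℝ}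
    (h0 : dT f t (-1) = 0) (h1 : dT f t 1 = 0) :
    HasDerivAt (hypoEnergy a b σ f)
      (∫ y in (-1:ℝ)..1, hypoRate a b σ (f t y) (dY f t y) (dY (dY f) t y) (dT f t y)) t := by
  have c0 := hf.continuous
  have c1 := hf.dY.continuous
  have ct := hf.dT.continuous
  have ct1 := hf.dT.dY.continuous
  have D := hasDerivAt_intervalIntegral_param (-1) 1
    (F := fun t y => ‖f t y‖ ^ 2 + a * ‖dY f t y‖ ^ 2
      + b * σ * inner ℝ (Complex.I * f t y) (dY f t y))
    (F' := fun t y => 2 * inner ℝ (f t y) (dT f t y)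
      + a * (2 * inner ℝ (dY f t y) (dY (dT f) t y))
      + b * σ * (inner ℝ (Complex.I * f t y) (dY (dT f) t y)
        + inner ℝ (Complex.I * dT f t y) (dY f t y))) ?_ ?_ ?_ t
  · refine D.congr_deriv ?_
    have cs0 := hf.continuous_snd t
    have cs1 := hf.dY.continuous_snd t
    have cs2 := hf.dY.dY.continuous_snd t
    have cst := hf.dT.continuous_snd t
    have cst1 := hf.dT.dY.continuous_snd t
    have ctot : Continuous fun y => 2 * a * (inner ℝ (dY f t y) (dY (dT f) t y)
        + inner ℝ (dY (dY f) t y) (dT f t y))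
        + b * σ * (inner ℝ (Complex.I * f t y) (dY (dT f) t y)
          + inner ℝ (Complex.I * dY f t y) (dT f t y)) := by fun_prop
    have hz := integral_eq_zero_of_hasDerivAt
      (T := fun y => 2 * a * inner ℝ (dY f t y) (dT f t y)
        + b * σ * inner ℝ (Complex.I * f t y) (dT f t y))
      (T' := fun y => 2 * a * (inner ℝ (dY f t y) (dY (dT f) t y)
        + inner ℝ (dY (dY f) t y) (dT f t y))
        + b * σ * (inner ℝ (Complex.I * f t y) (dY (dT f) t y)
          + inner ℝ (Complex.I * dY f t y) (dT f t y)))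
      (fun y _ => ((hf.dY.hasDerivAt_snd t y).inner ℝ (hf.dT.hasDerivAt_snd t y)).const_mul
        (2 * a) |>.add ((((hf.hasDerivAt_snd t y).const_mul Complex.I).inner ℝ
          (hf.dT.hasDerivAt_snd t y)).const_mul (b * σ)))
      ctot.continuousOn (by simp [h0]) (by simp [h1])
    have crate : Continuous fun y =>
        hypoRate a b σ (f t y) (dY f t y) (dY (dY f) t y) (dT f t y) := by
      unfold hypoRate
      fun_prop
    rw [← add_zero (∫ y in (-1:ℝ)..1, hypoRate a b σ (f t y) (dY f t y) (dY (dY f) t y)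
      (dT f t y)), ← hz, ← intervalIntegral.integral_add (crate.intervalIntegrable _ _)
      (ctot.intervalIntegrable _ _)]
    refine intervalIntegral.integral_congr fun y _ => ?_
    simp only [hypoRate, cinner_eq, Complex.mul_re, Complex.mul_im, Complex.I_re, Complex.I_im]
    ring
  · simp only [Function.uncurry_def] at *
    fun_prop
  · simp only [Function.uncurry_def] at *
    fun_prop
  · intro t y
    have dt := hf.hasDerivAt_fst t y
    have dt1 := hf.dY.hasDerivAt_fst t y
    rw [hf.dT_dY] at dt1
    exact (dt.norm_sq.add (dt1.norm_sq.const_mul a)).add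
      (((dt.const_mul Complex.I).inner ℝ dt1).const_mul (b * σ))

lemma hypoEnergy_bounds {s q σ : ℝ} (hs : 0 < s) (hq : 0 < q) (hσ : |σ| = 1)
    {f : ℝ → ℝ → ℂ} (hf : Smooth₂ f) (t : ℝ) :
    |hypoEnergy (s ^ 4 / (100 * q ^ 2)) (s ^ 2 / (100 * q)) σ f t
      - ((∫ y in (-1:ℝ)..1, ‖f t y‖ ^ 2)
        + s ^ 4 / (100 * q ^ 2) * ∫ y in (-1:ℝ)..1, ‖dY f t y‖ ^ 2)|
      ≤ 1 / 200 * ((∫ y in (-1:ℝ)..1, ‖f t y‖ ^ 2)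
        + s ^ 4 / q ^ 2 * ∫ y in (-1:ℝ)..1, ‖dY f t y‖ ^ 2) := by
  have cs0 := hf.continuous_snd t
  have cs1 := hf.dY.continuous_snd t
  have i0 := intervalIntegrable_norm_sq cs0.continuousOn
  have i1 := intervalIntegrable_norm_sq cs1.continuousOn
  have i2 : IntervalIntegrable (fun y => inner ℝ (Complex.I * f t y) (dY f t y)) volume (-1) 1 :=
    Continuous.intervalIntegrable (by fun_prop) _ _
  rw [hypoEnergy, intervalIntegral.integral_add (i0.add (i1.const_mul _)) (i2.const_mul _),
    intervalIntegral.integral_add i0 (i1.const_mul _), intervalIntegral.integral_const_mul,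
    add_sub_cancel_left, ← Real.norm_eq_abs, ← intervalIntegral.integral_const_mul (s ^ 4 / q ^ 2),
    ← intervalIntegral.integral_add i0 (i1.const_mul _), ← intervalIntegral.integral_const_mul]
  refine intervalIntegral.norm_integral_le_of_norm_le (by norm_num)
    (Filter.Eventually.of_forall fun y _ => ?_) ((i0.add (i1.const_mul _)).const_mul _)
  rw [norm_mul, norm_mul, Real.norm_eq_abs, Real.norm_eq_abs, Real.norm_eq_abs, hσ, mul_one,
    abs_of_pos (by positivity)]
  have h1 := mul_le_mul_of_nonneg_left (abs_inner_I_mul_le' (f t y) (dY f t y))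
    (by positivity : 0 ≤ s ^ 2 / (100 * q))
  refine h1.trans ?_
  have h2 : 0 ≤ (‖f t y‖ - s ^ 2 / q * ‖dY f t y‖) ^ 2 := sq_nonneg _
  have e1 : (s ^ 2 / q) ^ 2 = s ^ 4 / q ^ 2 := by rw [div_pow]; ring
  have e2 : s ^ 2 / (100 * q) = 1 / 100 * (s ^ 2 / q) := by field_simp
  rw [e2]
  nlinarith

end HypocoerciveEnergy

lemma Smooth₂.dT_eq_zero {E : Type*} [NormedAddCommGroup E] [NormedSpace ℝ E]
    {f : ℝ → ℝ → E} (hf : Smooth₂ f) {y : ℝ} (h : ∀ t ≥ (0:ℝ), f t y = 0) {t : ℝ} (ht : 0 ≤ t) :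
    _root_.dT f t y = 0 := by
  have h1 := (hf.hasDerivAt_fst t y).hasDerivWithinAt (s := Ici t)
  have h2 : HasDerivWithinAt (fun s => f s y) 0 (Ici t) t :=
    (hasDerivWithinAt_const t (Ici t) (0 : E)).congr (fun s hs => h s (ht.trans hs)) (h t ht)
  exact (uniqueDiffWithinAt_Ici t).eq_deriv _ h1 h2

/-- Grönwall's inequality with an exponentially decaying source. -/
lemma gronwall_exp_source {E : ℝ → ℝ} {A B L M : ℝ} (hL : 0 < L) (hLA : L ≤ A) (hLB : L ≤ B)
    (hM : 0 ≤ M)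
    (hE : ∀ t ≥ (0:ℝ), ∃ e', HasDerivAt E e' t ∧
      e' ≤ -(2 * A) * E t + M * Real.exp (-(2 * B * t))) {t : ℝ} (ht : 0 ≤ t) :
    E t ≤ E 0 * Real.exp (-(2 * A * t)) + M / L * Real.exp (-(L * t)) := by
  choose! e' he' hle using hE
  let φ : ℝ → ℝ := fun t => Real.exp (2 * A * t) * (E t - M / L * Real.exp (-(L * t)))
  have hφ : ∀ t ≥ 0, HasDerivAt φ (Real.exp (2 * A * t) * (2 * A * (E t - M / L *
      Real.exp (-(L * t))) + (e' t + M * Real.exp (-(L * t))))) t := by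
    intro t ht
    have d1 : HasDerivAt (fun t => Real.exp (2 * A * t)) (Real.exp (2 * A * t) * (2 * A)) t := by
      simpa using ((hasDerivAt_id t).const_mul (2 * A)).exp
    have d2 : HasDerivAt (fun t => Real.exp (-(L * t))) (Real.exp (-(L * t)) * (-L)) t := by
      simpa using ((hasDerivAt_id t).const_mul L).neg.exp
    refine (d1.mul ((he' t ht).sub (d2.const_mul (M / L)))).congr_deriv ?_
    simp only [Pi.sub_apply]
    field_simp
    ring
  have anti : AntitoneOn φ (Ici 0) := by
    refine antitoneOn_of_deriv_nonpos (convex_Ici 0)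
      (fun t ht => (hφ t ht).continuousAt.continuousWithinAt)
      (fun t ht => (hφ t (interior_subset ht)).differentiableAt.differentiableWithinAt)
        fun t ht => ?_
    have ht0 : 0 ≤ t := interior_subset ht
    rw [(hφ t ht0).deriv]
    refine mul_nonpos_of_nonneg_of_nonpos (Real.exp_pos _).le ?_
    have h1 := hle t ht0
    have h2 : M * Real.exp (-(2 * B * t)) ≤ M * Real.exp (-(L * t)) := by
      gcongr
      nlinarith
    have h3 : M * Real.exp (-(L * t)) ≤ A * (M / L * Real.exp (-(L * t))) := by
      have : 1 ≤ A / L := (one_le_div hL).2 hLA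
      calc M * Real.exp (-(L * t)) ≤ A / L * (M * Real.exp (-(L * t))) :=
            le_mul_of_one_le_left (by positivity) this
        _ = _ := by ring
    linarith
  have h := anti (mem_Ici.2 le_rfl) (mem_Ici.2 ht) ht
  simp only [φ, mul_zero, Real.exp_zero, one_mul, neg_zero, mul_one] at h
  have h4 : E t - M / L * Real.exp (-(L * t)) ≤ E 0 * Real.exp (-(2 * A * t)) := by
    have h5 : Real.exp (2 * A * t) * (E t - M / L * Real.exp (-(L * t))) ≤ E 0 := by
      have : 0 ≤ M / L := by positivity
      linarith
    rw [Real.exp_neg (2 * A * t), ← div_eq_mul_inv, le_div_iff₀ (Real.exp_pos _), mul_comm]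
    exact h5
  linarith

/-- Enhanced dissipation for the passive scalar. -/
lemma passive_scalar_decay {s q σ : ℝ} (hs : 0 < s) (hq : 1 ≤ q) (hσ : |σ| = 1)
    {u w : ℝ → ℝ → ℝ} (hp : ∀ t ≥ (0:ℝ), IsPhase (u t) (w t)) {f : ℝ → ℝ → ℂ} (hf : Smooth₂ f)
    (hb : ∀ t ≥ (0:ℝ), f t (-1) = 0 ∧ f t 1 = 0)
    (heq : ∀ t ≥ (0:ℝ), ∀ y ∈ Icc (-1:ℝ) 1, dT f t y
      = -(Complex.I * (σ * q ^ 3 : ℝ) * u t y * f t y) + (s ^ 6 : ℝ) * dY (dY f) t y)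
    {t : ℝ} (ht : 0 ≤ t) :
    ∫ y in (-1:ℝ)..1, ‖f t y‖ ^ 2 ≤ 2 * ((∫ y in (-1:ℝ)..1, ‖f 0 y‖ ^ 2)
        + s ^ 4 / q ^ 2 * ∫ y in (-1:ℝ)..1, ‖dY f 0 y‖ ^ 2)
      * Real.exp (-(2 * (1 / 3200 * (s ^ 2 * q ^ 2)) * t)) := by
  have hq0 : 0 < q := by linarith
  have hN0 : ∀ t, 0 ≤ ∫ y in (-1:ℝ)..1, ‖f t y‖ ^ 2 := fun t =>
    intervalIntegral.integral_nonneg (by norm_num) fun _ _ => by positivity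
  have hN1 : ∀ t, 0 ≤ ∫ y in (-1:ℝ)..1, ‖dY f t y‖ ^ 2 := fun t =>
    intervalIntegral.integral_nonneg (by norm_num) fun _ _ => by positivity
  have hN2 : ∀ t, 0 ≤ ∫ y in (-1:ℝ)..1, ‖dY (dY f) t y‖ ^ 2 := fun t =>
    intervalIntegral.integral_nonneg (by norm_num) fun _ _ => by positivity
  have hbd := fun t => abs_le.1 (hypoEnergy_bounds hs hq0 hσ hf t)
  have e100 : s ^ 4 / (100 * q ^ 2) = 1 / 100 * (s ^ 4 / q ^ 2) := by field_simp
  rw [e100] at hbd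
  have hA : 0 < 1 / 3200 * (s ^ 2 * q ^ 2) := by positivity
  have := gronwall_exp_source (E := hypoEnergy (1 / 100 * (s ^ 4 / q ^ 2)) (s ^ 2 / (100 * q)) σ f)
    (M := 0) hA le_rfl le_rfl le_rfl (fun t ht => ?_) ht
  · rw [zero_div, zero_mul, add_zero] at this
    have hr : 0 ≤ s ^ 4 / q ^ 2 * ∫ y in (-1:ℝ)..1, ‖dY f 0 y‖ ^ 2 :=
      mul_nonneg (by positivity) (hN1 0)
    have hr' : 0 ≤ s ^ 4 / q ^ 2 * ∫ y in (-1:ℝ)..1, ‖dY f t y‖ ^ 2 :=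
      mul_nonneg (by positivity) (hN1 t)
    have h1 : hypoEnergy (1 / 100 * (s ^ 4 / q ^ 2)) (s ^ 2 / (100 * q)) σ f 0
        ≤ 199 / 100 * ((∫ y in (-1:ℝ)..1, ‖f 0 y‖ ^ 2)
        + s ^ 4 / q ^ 2 * ∫ y in (-1:ℝ)..1, ‖dY f 0 y‖ ^ 2) := by
      have := (hbd 0).2
      have := hN0 0
      linarith
    have h2 : 199 / 200 * (∫ y in (-1:ℝ)..1, ‖f t y‖ ^ 2)
        ≤ hypoEnergy (1 / 100 * (s ^ 4 / q ^ 2)) (s ^ 2 / (100 * q)) σ f t := by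
      have := (hbd t).1
      have := hN0 t
      linarith
    have h3 := mul_le_mul_of_nonneg_right h1
      (Real.exp_pos (-(2 * (1 / 3200 * (s ^ 2 * q ^ 2)) * t))).le
    linarith
  · have hd := hasDerivAt_hypoEnergy (1 / 100 * (s ^ 4 / q ^ 2)) (s ^ 2 / (100 * q)) σ hf
      (hf.dT_eq_zero (fun t ht => (hb t ht).1) ht) (hf.dT_eq_zero (fun t ht => (hb t ht).2) ht)
    refine ⟨_, hd, ?_⟩
    have hle := integral_hypoRate_le hs hq0 hσ (hp t ht) (f := f t) (f' := dY f t)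
      (f'' := dY (dY f) t) (g := 0) (g' := 0) (h := 0) (ft := dT f t)
      (fun y _ => hf.hasDerivAt_snd t y) (fun y _ => hf.dY.hasDerivAt_snd t y)
      (hf.dY.dY.continuous_snd t).continuousOn (fun y _ => hasDerivAt_const y 0)
      continuousOn_const continuousOn_const (hb t ht).1 (hb t ht).2 rfl rfl
      (fun y hy => by rw [heq t ht y hy]; simp)
    rw [e100] at hle
    refine hle.trans ?_
    simp only [Pi.zero_apply, mul_zero, inner_zero_right, norm_zero, ne_eq, OfNat.ofNat_ne_zero,
      not_false_eq_true, zero_pow, intervalIntegral.integral_zero, zero_mul, add_zero]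
    have hub := (hbd t).2
    have e1 : s ^ 2 * q ^ 2 * (s ^ 4 / q ^ 2) = s ^ 6 := by field_simp
    have h2 := mul_nonneg (by positivity : 0 ≤ 1 / 100 * (s ^ 10 / q ^ 2)) (hN2 t)
    have h3 := mul_nonneg (by positivity : 0 ≤ s ^ 2 * q ^ 2) (hN0 t)
    have h4 := mul_nonneg (by positivity : 0 ≤ s ^ 6) (hN1 t)
    have h5 := mul_le_mul_of_nonneg_left hub (by positivity : 0 ≤ s ^ 2 * q ^ 2)
    have e2 : s ^ 2 * q ^ 2 * (s ^ 4 / q ^ 2 * ∫ y in (-1:ℝ)..1, ‖dY f t y‖ ^ 2)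
      = s ^ 6 * ∫ y in (-1:ℝ)..1, ‖dY f t y‖ ^ 2 := by rw [← mul_assoc, e1]
    nlinarith [h2, h3, h4, h5, e2]

lemma eqOn_Icc_of_Ioo {E : Type*} [TopologicalSpace E] [T2Space E] {f g : ℝ → E}
    (hf : Continuous f) (hg : Continuous g) (h : ∀ y ∈ Ioo (-1:ℝ) 1, f y = g y) :
    ∀ y ∈ Icc (-1:ℝ) 1, f y = g y := by
  have : EqOn f g (closure (Ioo (-1:ℝ) 1)) := EqOn.closure h hf hg
  rwa [closure_Ioo (by norm_num)] at this

lemma le_of_hasDerivAt_nonpos {N N' : ℝ → ℝ} (h : ∀ t ≥ (0:ℝ), HasDerivAt N (N' t) t)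
    (hle : ∀ t ≥ (0:ℝ), N' t ≤ 0) {t : ℝ} (ht : 0 ≤ t) : N t ≤ N 0 := by
  have anti : AntitoneOn N (Ici 0) := by
    refine antitoneOn_of_deriv_nonpos (convex_Ici 0)
      (fun t ht => (h t ht).continuousAt.continuousWithinAt)
      (fun t ht => (h t (interior_subset ht)).differentiableAt.differentiableWithinAt)
        fun t ht => ?_
    rw [(h t (interior_subset ht)).deriv]
    exact hle t (interior_subset ht)
  exact anti (mem_Ici.2 le_rfl) (mem_Ici.2 ht) ht

/-- A smooth solution of the heat equation on `[-1,1]` with Dirichlet boundary conditions. -/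
structure IsHeatSolution (μ : ℝ) (f : ℝ → ℝ → ℝ) : Prop where
  smooth : Smooth₂ f
  eq : ∀ t ≥ (0:ℝ), ∀ y ∈ Icc (-1:ℝ) 1, dT f t y = μ * dY (dY f) t y
  left : ∀ t ≥ (0:ℝ), f t (-1) = 0
  right : ∀ t ≥ (0:ℝ), f t 1 = 0

namespace IsHeatSolution

variable {μ : ℝ} {f : ℝ → ℝ → ℝ}

lemma dY_dY (hμ : 0 < μ) (hf : IsHeatSolution μ f) : IsHeatSolution μ (dY (dY f)) := by
  have hs := hf.smooth
  have hbd : ∀ y ∈ Icc (-1:ℝ) 1, (∀ t ≥ (0:ℝ), f t y = 0) → ∀ t ≥ (0:ℝ), dY (dY f) t y = 0 := by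
    intro y hy h t ht
    have := hf.eq t ht y hy
    rw [hs.dT_eq_zero h ht] at this
    rcases mul_eq_zero.1 this.symm with h | h
    · exact absurd h hμ.ne'
    · exact h
  refine ⟨hs.dY.dY, fun t ht => ?_, hbd _ (by norm_num) hf.left, hbd _ (by norm_num) hf.right⟩
  refine eqOn_Icc_of_Ioo (hs.dY.dY.dT.continuous_snd t)
    (continuous_const.mul (hs.dY.dY.dY.dY.continuous_snd t)) fun y hy => ?_
  rw [hs.dY.dT_dY, hs.dT_dY]
  have h1 : ∀ y ∈ Ioo (-1:ℝ) 1, dY (dT f) t y = μ * dY (dY (dY f)) t y := by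
    intro y hy
    have hev : dT f t =ᶠ[nhds y] fun y => μ * dY (dY f) t y := by
      filter_upwards [Ioo_mem_nhds hy.1 hy.2] with z hz
      exact hf.eq t ht z (Ioo_subset_Icc_self hz)
    have := hev.deriv_eq
    rw [((hs.dY.dY.hasDerivAt_snd t y).const_mul μ).deriv] at this
    exact this
  have hev : dY (dT f) t =ᶠ[nhds y] fun y => μ * dY (dY (dY f)) t y := by
    filter_upwards [Ioo_mem_nhds hy.1 hy.2] with z hz
    exact h1 z hz
  have := hev.deriv_eq
  rw [((hs.dY.dY.dY.hasDerivAt_snd t y).const_mul μ).deriv] at this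
  exact this

lemma integral_sq_le (hμ : 0 < μ) (hf : IsHeatSolution μ f) {t : ℝ} (ht : 0 ≤ t) :
    ∫ y in (-1:ℝ)..1, f t y ^ 2 ≤ ∫ y in (-1:ℝ)..1, f 0 y ^ 2 := by
  have hs := hf.smooth
  have c0 := hs.continuous
  have ct := hs.dT.continuous
  refine le_of_hasDerivAt_nonpos (N := fun t => ∫ y in (-1:ℝ)..1, f t y ^ 2)
    (fun t _ => hasDerivAt_intervalIntegral_param (-1) 1
    (F := fun t y => f t y ^ 2) (F' := fun t y => 2 * f t y * dT f t y) ?_ ?_ ?_ t)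
    (fun t ht => ?_) ht
  · simp only [Function.uncurry_def] at *
    fun_prop
  · simp only [Function.uncurry_def] at *
    fun_prop
  · intro t y
    exact ((hs.hasDerivAt_fst t y).pow 2).congr_deriv (by norm_num)
  · have cs0 := hs.continuous_snd t
    have cs1 := hs.dY.continuous_snd t
    have cs2 := hs.dY.dY.continuous_snd t
    have hz := integral_eq_zero_of_hasDerivAt
      (T := fun y => 2 * μ * (f t y * dY f t y))
      (T' := fun y => 2 * μ * (dY f t y * dY f t y + f t y * dY (dY f) t y))
      (fun y _ => ((hs.hasDerivAt_snd t y).mul (hs.dY.hasDerivAt_snd t y)).const_mul (2 * μ))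
      (Continuous.continuousOn (by fun_prop)) (by simp [hf.left t ht]) (by simp [hf.right t ht])
    rw [← hz]
    refine intervalIntegral.integral_mono_on (by norm_num)
      (((continuous_const.mul cs0).mul (hs.dT.continuous_snd t)).intervalIntegrable _ _)
      (Continuous.intervalIntegrable (by fun_prop) _ _) fun y hy => ?_
    rw [hf.eq t ht y hy]
    nlinarith [mul_nonneg hμ.le (sq_nonneg (dY f t y))]

lemma integral_dY_sq_le (hμ : 0 < μ) (hf : IsHeatSolution μ f) {t : ℝ} (ht : 0 ≤ t) :
    ∫ y in (-1:ℝ)..1, dY f t y ^ 2 ≤ ∫ y in (-1:ℝ)..1, dY f 0 y ^ 2 := by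
  have hs := hf.smooth
  have c1 := hs.dY.continuous
  have ct1 := hs.dT.dY.continuous
  refine le_of_hasDerivAt_nonpos (N := fun t => ∫ y in (-1:ℝ)..1, dY f t y ^ 2)
    (fun t _ => hasDerivAt_intervalIntegral_param (-1) 1
    (F := fun t y => dY f t y ^ 2) (F' := fun t y => 2 * dY f t y * dY (dT f) t y) ?_ ?_ ?_ t)
    (fun t ht => ?_) ht
  · simp only [Function.uncurry_def] at *
    fun_prop
  · simp only [Function.uncurry_def] at *
    fun_prop
  · intro t y
    exact ((hs.dY.hasDerivAt_fst t y).pow 2).congr_deriv (by rw [hs.dT_dY]; norm_num)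
  · have cs1 := hs.dY.continuous_snd t
    have cs2 := hs.dY.dY.continuous_snd t
    have cst := hs.dT.continuous_snd t
    have cst1 := hs.dT.dY.continuous_snd t
    have hz := integral_eq_zero_of_hasDerivAt
      (T := fun y => 2 * (dY f t y * dT f t y))
      (T' := fun y => 2 * (dY (dY f) t y * dT f t y + dY f t y * dY (dT f) t y))
      (fun y _ => ((hs.dY.hasDerivAt_snd t y).mul (hs.dT.hasDerivAt_snd t y)).const_mul 2)
      (Continuous.continuousOn (by fun_prop))
      (by simp [hs.dT_eq_zero hf.left ht]) (by simp [hs.dT_eq_zero hf.right ht])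
    rw [← hz]
    refine intervalIntegral.integral_mono_on (by norm_num)
      (Continuous.intervalIntegrable (by fun_prop) _ _)
      (Continuous.intervalIntegrable (by fun_prop) _ _) fun y hy => ?_
    rw [hf.eq t ht y hy]
    nlinarith [mul_nonneg hμ.le (sq_nonneg (dY (dY f) t y))]

end IsHeatSolution

lemma abs_le_of_integral_deriv_sq_le {f f' : ℝ → ℝ} (hf : ∀ y, HasDerivAt f (f' y) y)
    (hf' : Continuous f') {y₀ : ℝ} (hy₀ : y₀ ∈ Icc (-1:ℝ) 1) (h0 : f y₀ = 0) {δ : ℝ} (hδ : 0 < δ)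
    (h : ∫ y in (-1:ℝ)..1, f' y ^ 2 ≤ δ ^ 2) {y : ℝ} (hy : y ∈ Icc (-1:ℝ) 1) :
    |f y| ≤ 3 / 2 * δ := by
  have e : ∫ z in y₀..y, f' z = f y := by
    rw [intervalIntegral.integral_eq_sub_of_hasDerivAt (fun z _ => hf z)
      (hf'.intervalIntegrable _ _), h0, sub_zero]
  have h1 : |f y| ≤ abs (∫ z in y₀..y, |f' z|) := by
    rw [← e]
    exact intervalIntegral.norm_integral_le_abs_integral_norm (f := f')
  have h2 : abs (∫ z in y₀..y, |f' z|) ≤ abs (∫ z in (-1:ℝ)..1, |f' z|) := by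
    refine intervalIntegral.abs_integral_mono_interval ?_
      (Filter.Eventually.of_forall fun z => abs_nonneg _) (hf'.abs.intervalIntegrable _ _)
    exact uIoc_subset_uIoc_of_uIcc_subset_uIcc (uIcc_subset_uIcc
      (by rwa [uIcc_of_le (by norm_num)]) (by rwa [uIcc_of_le (by norm_num)]))
  have i2 : IntervalIntegrable (fun z => 1 / (2 * δ) * f' z ^ 2) volume (-1) 1 :=
    Continuous.intervalIntegrable (by fun_prop) _ _
  have h3 : ∫ z in (-1:ℝ)..1, |f' z| ≤ ∫ z in (-1:ℝ)..1, (δ / 2 + 1 / (2 * δ) * f' z ^ 2) := by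
    refine intervalIntegral.integral_mono_on (by norm_num) (hf'.abs.intervalIntegrable _ _)
      (intervalIntegrable_const.add i2) fun z _ => ?_
    have : δ / 2 + 1 / (2 * δ) * f' z ^ 2 - |f' z| = 1 / (2 * δ) * (δ - |f' z|) ^ 2 := by
      rw [sub_sq, sq_abs]
      field_simp
      ring
    have : 0 ≤ 1 / (2 * δ) * (δ - |f' z|) ^ 2 := by positivity
    linarith
  rw [intervalIntegral.integral_add intervalIntegrable_const i2,
    intervalIntegral.integral_const_mul, intervalIntegral.integral_const, smul_eq_mul] at h3
  have h4 : 1 / (2 * δ) * ∫ y in (-1:ℝ)..1, f' y ^ 2 ≤ 1 / (2 * δ) * δ ^ 2 := by gcongr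
  have h5 : 1 / (2 * δ) * δ ^ 2 = δ / 2 := by field_simp
  rw [abs_of_nonneg (intervalIntegral.integral_nonneg (by norm_num : (-1:ℝ) ≤ 1)
    fun _ _ => abs_nonneg _)] at h2
  linarith

lemma IsHeatSolution.sup_bounds {μ : ℝ} {W : ℝ → ℝ → ℝ} (hμ : 0 < μ) (hW : IsHeatSolution μ W)
    {δ : ℝ} (hδ : 0 < δ) (h1 : ∫ y in (-1:ℝ)..1, dY W 0 y ^ 2 ≤ δ ^ 2)
    (h2 : ∫ y in (-1:ℝ)..1, dY (dY W) 0 y ^ 2 ≤ δ ^ 2)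
    (h3 : ∫ y in (-1:ℝ)..1, dY (dY (dY W)) 0 y ^ 2 ≤ δ ^ 2) {t : ℝ} (ht : 0 ≤ t) {y : ℝ}
    (hy : y ∈ Icc (-1:ℝ) 1) :
    |W t y| ≤ 3 / 2 * δ ∧ |dY W t y| ≤ 3 / 2 * δ ∧ |dY (dY W) t y| ≤ 3 / 2 * δ := by
  have hs := hW.smooth
  have hW2 := hW.dY_dY hμ
  refine ⟨?_, ?_, ?_⟩
  · exact abs_le_of_integral_deriv_sq_le (hs.hasDerivAt_snd t) (hs.dY.continuous_snd t)
      (y₀ := -1) (by norm_num) (hW.left t ht) hδ ((hW.integral_dY_sq_le hμ ht).trans h1) hy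
  · obtain ⟨y₀, hy₀, h0⟩ := exists_hasDerivAt_eq_zero (f := W t) (f' := dY W t)
      (by norm_num : (-1:ℝ) < 1) (hs.continuous_snd t).continuousOn
      (by rw [hW.left t ht, hW.right t ht]) (fun y _ => hs.hasDerivAt_snd t y)
    exact abs_le_of_integral_deriv_sq_le (hs.dY.hasDerivAt_snd t) (hs.dY.dY.continuous_snd t)
      (Ioo_subset_Icc_self hy₀) h0 hδ ((hW2.integral_sq_le hμ ht).trans h2) hy
  · exact abs_le_of_integral_deriv_sq_le (hs.dY.dY.hasDerivAt_snd t)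
      (hs.dY.dY.dY.continuous_snd t) (y₀ := -1) (by norm_num) (hW2.left t ht) hδ
      ((hW2.integral_dY_sq_le hμ ht).trans h3) hy

/-- The Couette flow perturbed by the velocity induced by the vorticity `W`. -/
noncomputable def shearFlow (W : ℝ → ℝ → ℝ) (t y : ℝ) : ℝ :=
  y + 1 / 2 * (∫ x in (-1:ℝ)..1, (1 - x) * W t x) - ∫ x in (-1:ℝ)..y, W t x

lemma integral_G_mul {v : ℝ → ℝ} (hv : Continuous v) {z : ℝ} (hz : z ∈ Icc (-1:ℝ) 1) :
    ∫ x in (-1:ℝ)..1, G z x * v x = (1 - z) / 2 * (∫ x in (-1:ℝ)..z, (1 + x) * v x)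
      + (z + 1) / 2 * ((∫ x in (-1:ℝ)..1, (1 - x) * v x) - ∫ x in (-1:ℝ)..z, (1 - x) * v x) := by
  have hcont : Continuous fun x => -((max x z - 1) / 2) * (min z x + 1) * v x := by fun_prop
  have e : ∀ x, G z x * v x = -((max x z - 1) / 2) * (min z x + 1) * v x := by
    intro x
    rw [G]
    split_ifs with h
    · rw [max_eq_left h, min_eq_left h]
    · rw [max_eq_right (by linarith), min_eq_right (by linarith)]
      ring
  have i1 : ∀ a b, IntervalIntegrable (fun x => (1 - x) * v x) volume a b := fun a b =>
    Continuous.intervalIntegrable (by fun_prop) _ _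
  rw [intervalIntegral.integral_congr fun x _ => e x,
    ← intervalIntegral.integral_add_adjacent_intervals (b := z) (hcont.intervalIntegrable _ _)
      (hcont.intervalIntegrable _ _),
    intervalIntegral.integral_interval_sub_left (i1 _ _) (i1 _ _),
    ← intervalIntegral.integral_const_mul, ← intervalIntegral.integral_const_mul]
  congr 1
  · refine intervalIntegral.integral_congr fun x hx => ?_
    rw [uIcc_of_le hz.1] at hx
    simp only [max_eq_right hx.2, min_eq_right hx.2]
    ring
  · refine intervalIntegral.integral_congr fun x hx => ?_
    rw [uIcc_of_le hz.2] at hx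
    simp only [max_eq_left hx.1, min_eq_left hx.1]
    ring

lemma shearFlow_eq {W : ℝ → ℝ → ℝ} {t : ℝ} (hW : Continuous (W t)) {y : ℝ}
    (hy : y ∈ Ioo (-1:ℝ) 1) :
    y + deriv (fun z => ∫ x in (-1:ℝ)..1, G z x * W t x) y = shearFlow W t y := by
  have hev : (fun z => ∫ x in (-1:ℝ)..1, G z x * W t x) =ᶠ[nhds y] fun z =>
      (1 - z) / 2 * (∫ x in (-1:ℝ)..z, (1 + x) * W t x) + (z + 1) / 2 *
        ((∫ x in (-1:ℝ)..1, (1 - x) * W t x) - ∫ x in (-1:ℝ)..z, (1 - x) * W t x) := by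
    filter_upwards [Ioo_mem_nhds hy.1 hy.2] with z hz
    exact integral_G_mul hW (Ioo_subset_Icc_self hz)
  have c1 : Continuous fun x => (1 + x) * W t x := by fun_prop
  have c2 : Continuous fun x => (1 - x) * W t x := by fun_prop
  have d1 := c1.integral_hasStrictDerivAt (-1) y |>.hasDerivAt
  have d2 := c2.integral_hasStrictDerivAt (-1) y |>.hasDerivAt
  have d3 := (((hasDerivAt_id y).const_sub 1).div_const 2).mul d1
  have d4 := (((hasDerivAt_id y).add_const 1).div_const 2).mul
    (d2.const_sub (∫ x in (-1:ℝ)..1, (1 - x) * W t x))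
  have hd := (d3.add d4).deriv
  rw [hev.deriv_eq]
  refine (congrArg (y + ·) hd).trans ?_
  rw [shearFlow]
  have e : ∫ x in (-1:ℝ)..y, W t x = 1 / 2 * (∫ x in (-1:ℝ)..y, (1 + x) * W t x)
      + 1 / 2 * ∫ x in (-1:ℝ)..y, (1 - x) * W t x := by
    rw [← mul_add, ← intervalIntegral.integral_add (c1.intervalIntegrable _ _)
      (c2.intervalIntegrable _ _), ← intervalIntegral.integral_const_mul]
    refine intervalIntegral.integral_congr fun x _ => ?_
    ring
  rw [e]
  simp only [id_eq]
  ring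

section ShearFlow

variable {W : ℝ → ℝ → ℝ}

lemma hasDerivAt_shearFlow (t : ℝ) (hW : Continuous (W t)) (y : ℝ) :
    HasDerivAt (shearFlow W t) (1 - W t y) y :=
  ((hasDerivAt_id y).add_const _).sub (hW.integral_hasStrictDerivAt (-1) y).hasDerivAt

lemma continuous_shearFlow (hW : Continuous (Function.uncurry W)) :
    Continuous (Function.uncurry (shearFlow W)) := by
  have h1 : Continuous fun p : ℝ × ℝ => ∫ x in (-1:ℝ)..1, (1 - x) * W p.1 x := by
    refine intervalIntegral.continuous_parametric_intervalIntegral_of_continuous' ?_ _ _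
    simp only [Function.uncurry_def] at *
    fun_prop
  have h2 : Continuous fun p : ℝ × ℝ => ∫ x in (-1:ℝ)..p.2, W p.1 x := by
    exact intervalIntegral.continuous_parametric_primitive_of_continuous (a₀ := -1) hW
  exact (continuous_snd.add (continuous_const.mul h1)).sub h2

lemma hasDerivAt_shearFlow_time (hW : Smooth₂ W) (t y : ℝ) :
    HasDerivAt (fun s => shearFlow W s y) (shearFlow (dT W) t y - y) t := by
  have c0 := hW.continuous
  have ct := hW.dT.continuous
  have d1 := hasDerivAt_intervalIntegral_param (-1) y c0 ct (fun t y => hW.hasDerivAt_fst t y) t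
  have d2 := hasDerivAt_intervalIntegral_param (-1) 1 (F := fun t x => (1 - x) * W t x)
    (F' := fun t x => (1 - x) * dT W t x) (by simp only [Function.uncurry_def] at *; fun_prop)
    (by simp only [Function.uncurry_def] at *; fun_prop)
    (fun t y => (hW.hasDerivAt_fst t y).const_mul _) t
  refine (((hasDerivAt_const t y).add (d2.const_mul (1 / 2))).sub d1).congr_deriv ?_
  rw [shearFlow]
  ring

lemma IsHeatSolution.shearFlow_dT {μ : ℝ} (hW : IsHeatSolution μ W) {t : ℝ} (ht : 0 ≤ t) {y : ℝ}
    (hy : y ∈ Icc (-1:ℝ) 1) : shearFlow (dT W) t y - y = -(μ * dY W t y) := by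
  have hs := hW.smooth
  have c0 := hs.continuous_snd t
  have c1 := hs.dY.continuous_snd t
  have c2 := hs.dY.dY.continuous_snd t
  have e1 : ∫ x in (-1:ℝ)..y, dT W t x = μ * (dY W t y - dY W t (-1)) := by
    rw [← intervalIntegral.integral_eq_sub_of_hasDerivAt
      (fun x _ => hs.dY.hasDerivAt_snd t x) (c2.intervalIntegrable _ _),
      ← intervalIntegral.integral_const_mul]
    refine intervalIntegral.integral_congr fun x hx => ?_
    rw [uIcc_of_le hy.1] at hx
    exact hW.eq t ht x ⟨hx.1, hx.2.trans hy.2⟩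
  have e2 : ∫ x in (-1:ℝ)..1, (1 - x) * dT W t x = μ * (-2 * dY W t (-1)) := by
    have : ∫ x in (-1:ℝ)..1, (-1 * dY W t x + (1 - x) * dY (dY W) t x + dY W t x)
        = -2 * dY W t (-1) := by
      rw [intervalIntegral.integral_eq_sub_of_hasDerivAt
        (f := fun x => (1 - x) * dY W t x + W t x)
        (f' := fun x => -1 * dY W t x + (1 - x) * dY (dY W) t x + dY W t x)
        (fun x _ => (((hasDerivAt_id x).const_sub 1).mul (hs.dY.hasDerivAt_snd t x)).add
          (hs.hasDerivAt_snd t x)) (Continuous.intervalIntegrable (by fun_prop) _ _),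
        hW.left t ht, hW.right t ht]
      ring
    rw [← this, ← intervalIntegral.integral_const_mul]
    refine intervalIntegral.integral_congr fun x hx => ?_
    rw [uIcc_of_le (by norm_num)] at hx
    simp only [hW.eq t ht x hx]
    ring
  rw [shearFlow, e1, e2]
  ring

lemma isPhase_shearFlow (hW : Smooth₂ W) {t : ℝ}
    (h : ∀ y ∈ Icc (-1:ℝ) 1, |W t y| ≤ 1 / 2) : IsPhase (shearFlow W t) (W t) :=
  ⟨hasDerivAt_shearFlow t (hW.continuous_snd t), hW.continuous_snd t, h⟩

lemma deriv_deriv_shearFlow (hW : Smooth₂ W) {u : ℝ → ℝ} {t y : ℝ} (hy : y ∈ Ioo (-1:ℝ) 1)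
    (hu : ∀ z ∈ Ioo (-1:ℝ) 1, u z = shearFlow W t z) : deriv (deriv u) y = -dY W t y := by
  have h1 : ∀ z ∈ Ioo (-1:ℝ) 1, deriv u z = 1 - W t z := by
    intro z hz
    have hev : u =ᶠ[nhds z] shearFlow W t := by
      filter_upwards [Ioo_mem_nhds hz.1 hz.2] with x hx
      exact hu x hx
    rw [hev.deriv_eq, (hasDerivAt_shearFlow t (hW.continuous_snd t) z).deriv]
  have hev : deriv u =ᶠ[nhds y] fun z => 1 - W t z := by
    filter_upwards [Ioo_mem_nhds hy.1 hy.2] with x hx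
    exact h1 x hx
  rw [hev.deriv_eq, ((hW.hasDerivAt_snd t y).const_sub 1).deriv]

end ShearFlow

section PhaseParameter

lemma continuous_phaseFourier_param {X : Type*} [TopologicalSpace X] [FirstCountableTopology X]
    [LocallyCompactSpace X]
    {u : X → ℝ → ℝ} {f : X → ℝ → ℂ} {ξ : X → ℝ} (hu : Continuous (Function.uncurry u))
    (hf : Continuous (Function.uncurry f)) (hξ : Continuous ξ) :
    Continuous fun x => phaseFourier (u x) (f x) (ξ x) := by
  refine intervalIntegral.continuous_parametric_intervalIntegral_of_continuous'
    (f := fun x y => Complex.exp (((-2 * Real.pi * u x y * ξ x : ℝ) : ℂ) * Complex.I) * f x y)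
    ?_ _ _
  simp only [Function.uncurry_def] at *
  fun_prop

lemma hasDerivAt_phaseFourier_time {u v : ℝ → ℝ → ℝ} {f : ℝ → ℝ → ℂ}
    (hu : Continuous (Function.uncurry u)) (hv : Continuous (Function.uncurry v))
    (huv : ∀ t y, HasDerivAt (fun s => u s y) (v t y) t) (hf : Smooth₂ f) (ξ t : ℝ) :
    HasDerivAt (fun s => phaseFourier (u s) (f s) ξ)
      (phaseFourier (u t) (fun y =>
        ((-2 * Real.pi * v t y * ξ : ℝ) : ℂ) * Complex.I * f t y + dT f t y) ξ) t := by
  have c0 := hf.continuous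
  have ct := hf.dT.continuous
  refine hasDerivAt_intervalIntegral_param (-1) 1
    (F := fun s y => Complex.exp (((-2 * Real.pi * u s y * ξ : ℝ) : ℂ) * Complex.I) * f s y)
    (F' := fun s y => Complex.exp (((-2 * Real.pi * u s y * ξ : ℝ) : ℂ) * Complex.I) *
      (((-2 * Real.pi * v s y * ξ : ℝ) : ℂ) * Complex.I * f s y + dT f s y)) ?_ ?_ ?_ t
  · simp only [Function.uncurry_def] at *
    fun_prop
  · simp only [Function.uncurry_def] at *
    fun_prop
  · intro t y
    refine ((((((huv t y).const_mul (-2 * Real.pi)).mul_const ξ).ofReal_comp).mul_const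
      Complex.I).cexp.mul (hf.hasDerivAt_fst t y)).congr_deriv ?_
    ring

lemma hasDerivAt_phaseFourier {U : ℝ → ℝ} (hU : Continuous U) {f : ℝ → ℂ} (hf : Continuous f)
    (ξ : ℝ) : HasDerivAt (phaseFourier U f)
      (phaseFourier U (fun y => ((-2 * Real.pi * U y : ℝ) : ℂ) * Complex.I * f y) ξ) ξ := by
  refine hasDerivAt_intervalIntegral_param (-1) 1
    (F := fun ξ y => Complex.exp (((-2 * Real.pi * U y * ξ : ℝ) : ℂ) * Complex.I) * f y)
    (F' := fun ξ y => Complex.exp (((-2 * Real.pi * U y * ξ : ℝ) : ℂ) * Complex.I) *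
      (((-2 * Real.pi * U y : ℝ) : ℂ) * Complex.I * f y)) ?_ ?_ ?_ ξ
  · simp only [Function.uncurry_def]
    fun_prop
  · simp only [Function.uncurry_def]
    fun_prop
  · intro ξ y
    refine (((((hasDerivAt_id ξ).const_mul (-2 * Real.pi * U y)).ofReal_comp).mul_const
      Complex.I).cexp.mul_const (f y)).congr_deriv ?_
    simp only [id_eq]
    push_cast
    ring

lemma continuous_phaseFourier {U : ℝ → ℝ} (hU : Continuous U) {f : ℝ → ℂ} (hf : Continuous f) :
    Continuous (phaseFourier U f) :=
  continuous_iff_continuousAt.2 fun ξ => (hasDerivAt_phaseFourier hU hf ξ).continuousAt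

lemma phaseFourier_add {U : ℝ → ℝ} (hU : Continuous U) {f g : ℝ → ℂ} (hf : Continuous f)
    (hg : Continuous g) (ξ : ℝ) :
    phaseFourier U (fun y => f y + g y) ξ = phaseFourier U f ξ + phaseFourier U g ξ := by
  simp only [phaseFourier, mul_add]
  exact intervalIntegral.integral_add (Continuous.intervalIntegrable (by fun_prop) _ _)
    (Continuous.intervalIntegrable (by fun_prop) _ _)

lemma phaseFourier_const_mul (U : ℝ → ℝ) (c : ℂ) (f : ℝ → ℂ) (ξ : ℝ) :
    phaseFourier U (fun y => c * f y) ξ = c * phaseFourier U f ξ := by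
  simp only [phaseFourier, mul_left_comm _ c]
  exact intervalIntegral.integral_const_mul _ _

lemma intervalIntegral_phaseFourier_sq_le {U w : ℝ → ℝ} (hp : IsPhase U w) {g : ℝ → ℂ}
    (hg : ContinuousOn g (Icc (-1:ℝ) 1)) {R : ℝ} (hR : 0 < R) :
    ∫ ξ in (-R)..R, ‖phaseFourier U g ξ‖ ^ 2 ≤ 2 * ∫ y in (-1:ℝ)..1, ‖g y‖ ^ 2 := by
  refine le_trans ?_ (integral_phaseFourier_sq_le hp hg)
  rw [intervalIntegral.integral_of_le (by linarith)]
  exact setIntegral_le_integral (integrable_phaseFourier_sq hp hg)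
    (Filter.Eventually.of_forall fun _ => by positivity)

lemma norm_phaseDeriv_le {U w : ℝ → ℝ} (hp : IsPhase U w) (w' : ℝ → ℝ) (g g' : ℝ → ℂ) {y : ℝ}
    (hy : y ∈ Icc (-1:ℝ) 1) :
    ‖phaseDeriv w w' g g' y‖ ≤ 2 * ‖g' y‖ + 4 * |w' y| * ‖g y‖ := by
  have h := hp.half_le hy
  have h2 : ‖((1 - w y : ℝ) : ℂ)⁻¹‖ ≤ 2 := by
    rw [norm_inv, Complex.norm_real, Real.norm_of_nonneg (by linarith), inv_le_comm₀ (by linarith)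
      (by norm_num)]
    linarith
  refine (norm_add_le _ _).trans ?_
  rw [norm_mul, norm_mul, norm_mul, norm_pow, Complex.norm_real, Real.norm_eq_abs]
  have h4 : ‖((1 - w y : ℝ) : ℂ)⁻¹‖ ^ 2 ≤ 4 := by nlinarith [norm_nonneg ((1 - w y : ℝ) : ℂ)⁻¹]
  have := mul_le_mul_of_nonneg_right h2 (norm_nonneg (g' y))
  have := mul_le_mul_of_nonneg_left h4 (by positivity : 0 ≤ |w' y| * ‖g y‖)
  nlinarith

end PhaseParameter

section ArctanMultiplier

variable {P : ℝ → ℂ} {K R : ℝ}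

lemma abs_arctan_le_two (x : ℝ) : |Real.arctan x| ≤ 2 := by
  have h1 := Real.neg_pi_div_two_lt_arctan x
  have h2 := Real.arctan_lt_pi_div_two x
  have h3 := Real.pi_le_four
  rw [abs_le]
  constructor <;> linarith

lemma continuous_arctan_div (K : ℝ) : Continuous fun ξ : ℝ => Real.arctan (ξ / K) :=
  Real.continuous_arctan.comp (continuous_id.div_const K)

lemma abs_integral_arctan_inner_le (hR : 0 < R) (hP : Continuous P) {S : ℝ → ℂ}
    (hS : Continuous S) (c : ℂ) {m : ℝ → ℝ} (hm : Continuous m) (hpos : ∀ ξ, 0 < m ξ) :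
    |∫ ξ in (-R)..R, Real.arctan (ξ / K) * (2 * inner ℝ (P ξ) (c * S ξ))|
      ≤ 2 * ((∫ ξ in (-R)..R, m ξ * ‖P ξ‖ ^ 2)
        + ‖c‖ ^ 2 * ∫ ξ in (-R)..R, (m ξ)⁻¹ * ‖S ξ‖ ^ 2) := by
  have hm' : Continuous fun ξ => (m ξ)⁻¹ := hm.inv₀ fun ξ => (hpos ξ).ne'
  have i1 : IntervalIntegrable (fun ξ => m ξ * ‖P ξ‖ ^ 2) volume (-R) R :=
    Continuous.intervalIntegrable (by fun_prop) _ _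
  have i2 : IntervalIntegrable (fun ξ => (m ξ)⁻¹ * ‖S ξ‖ ^ 2) volume (-R) R :=
    Continuous.intervalIntegrable (by fun_prop) _ _
  rw [← intervalIntegral.integral_const_mul (‖c‖ ^ 2),
    ← intervalIntegral.integral_add i1 (i2.const_mul _), ← intervalIntegral.integral_const_mul,
    ← Real.norm_eq_abs]
  refine intervalIntegral.norm_integral_le_of_norm_le (by linarith)
    (Filter.Eventually.of_forall fun ξ _ => ?_) ((i1.add (i2.const_mul _)).const_mul _)
  have h1 := abs_real_inner_le_norm (P ξ) (c * S ξ)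
  rw [norm_mul] at h1
  have h2 := abs_arctan_le_two (ξ / K)
  rw [norm_mul, norm_mul, Real.norm_eq_abs, Real.norm_eq_abs, Real.norm_eq_abs, abs_two]
  have h3 : |Real.arctan (ξ / K)| * (2 * |inner ℝ (P ξ) (c * S ξ)|)
      ≤ 2 * (2 * (‖P ξ‖ * (‖c‖ * ‖S ξ‖))) := by gcongr
  refine h3.trans ?_
  have hmξ := hpos ξ
  have h4 : m ξ * ‖P ξ‖ ^ 2 + ‖c‖ ^ 2 * ((m ξ)⁻¹ * ‖S ξ‖ ^ 2) - 2 * (‖P ξ‖ * (‖c‖ * ‖S ξ‖))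
      = (m ξ)⁻¹ * (m ξ * ‖P ξ‖ - ‖c‖ * ‖S ξ‖) ^ 2 := by
    field_simp
    ring
  have h5 : 0 ≤ (m ξ)⁻¹ * (m ξ * ‖P ξ‖ - ‖c‖ * ‖S ξ‖) ^ 2 := by positivity
  linarith

lemma integral_arctan_inner_deriv (hK : 0 < K) {P' : ℝ → ℂ}
    (hP : ∀ ξ, HasDerivAt P (P' ξ) ξ) (hP' : Continuous P') :
    ∫ ξ in (-R)..R, Real.arctan (ξ / K) * (2 * inner ℝ (P ξ) (P' ξ))
      = Real.arctan (R / K) * (‖P R‖ ^ 2 + ‖P (-R)‖ ^ 2)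
        - K * ∫ ξ in (-R)..R, ‖P ξ‖ ^ 2 / (K ^ 2 + ξ ^ 2) := by
  have hPc : Continuous P := continuous_iff_continuousAt.2 fun ξ => (hP ξ).continuousAt
  have hpos : ∀ ξ : ℝ, K ^ 2 + ξ ^ 2 ≠ 0 := fun ξ => by positivity
  have da : ∀ ξ : ℝ, HasDerivAt (fun ξ => Real.arctan (ξ / K)) (K / (K ^ 2 + ξ ^ 2)) ξ := by
    intro ξ
    refine ((hasDerivAt_id ξ).div_const K).arctan.congr_deriv ?_
    have := hpos ξ
    simp only [id_eq]
    field_simp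
  have ca : Continuous fun ξ : ℝ => K / (K ^ 2 + ξ ^ 2) :=
    continuous_const.div (by fun_prop) hpos
  have ci : Continuous fun ξ => 2 * inner ℝ (P ξ) (P' ξ) := by fun_prop
  rw [intervalIntegral.integral_mul_deriv_eq_deriv_mul (fun ξ _ => da ξ)
    (fun ξ _ => (hP ξ).norm_sq) (ca.intervalIntegrable _ _) (ci.intervalIntegrable _ _),
    neg_div, Real.arctan_neg, ← intervalIntegral.integral_const_mul]
  congr 1
  · ring
  · refine intervalIntegral.integral_congr fun ξ _ => ?_
    ring

end ArctanMultiplier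

/-- The quadratic functional with Fourier multiplier `arctan (ξ / K)`, truncated to `|ξ| ≤ R`,
in the coordinate given by the phase `u`. -/
noncomputable def arctanEnergy (K R : ℝ) (u : ℝ → ℝ → ℝ) (f : ℝ → ℝ → ℂ) (t : ℝ) : ℝ :=
  ∫ ξ in (-R)..R, Real.arctan (ξ / K) * ‖phaseFourier (u t) (f t) ξ‖ ^ 2

lemma hasDerivAt_arctanEnergy (K R : ℝ) {u v : ℝ → ℝ → ℝ} {f : ℝ → ℝ → ℂ}
    (hu : Continuous (Function.uncurry u)) (hv : Continuous (Function.uncurry v))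
    (huv : ∀ t y, HasDerivAt (fun s => u s y) (v t y) t) (hf : Smooth₂ f) (t : ℝ) :
    HasDerivAt (arctanEnergy K R u f) (∫ ξ in (-R)..R, Real.arctan (ξ / K) *
      (2 * inner ℝ (phaseFourier (u t) (f t) ξ) (phaseFourier (u t) (fun y =>
        ((-2 * Real.pi * v t y * ξ : ℝ) : ℂ) * Complex.I * f t y + dT f t y) ξ))) t := by
  have c0 := hf.continuous
  have ct := hf.dT.continuous
  have ca := continuous_arctan_div K
  have c1 : Continuous fun p : ℝ × ℝ => phaseFourier (u p.1) (f p.1) p.2 := by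
    refine continuous_phaseFourier_param (u := fun p : ℝ × ℝ => u p.1)
      (f := fun p : ℝ × ℝ => f p.1) ?_ ?_ continuous_snd
    all_goals
      simp only [Function.uncurry_def] at *
      fun_prop
  have c2 : Continuous fun p : ℝ × ℝ => phaseFourier (u p.1) (fun y =>
        ((-2 * Real.pi * v p.1 y * p.2 : ℝ) : ℂ) * Complex.I * f p.1 y + dT f p.1 y) p.2 := by
    refine continuous_phaseFourier_param (u := fun p : ℝ × ℝ => u p.1)
      (f := fun (p : ℝ × ℝ) y =>
        ((-2 * Real.pi * v p.1 y * p.2 : ℝ) : ℂ) * Complex.I * f p.1 y + dT f p.1 y)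
      ?_ ?_ continuous_snd
    all_goals
      simp only [Function.uncurry_def] at *
      fun_prop
  have ca2 : Continuous fun p : ℝ × ℝ => Real.arctan (p.2 / K) := ca.comp continuous_snd
  have c3 : Continuous fun p : ℝ × ℝ =>
      Real.arctan (p.2 / K) * ‖phaseFourier (u p.1) (f p.1) p.2‖ ^ 2 := ca2.mul (c1.norm.pow 2)
  have c4 := ca2.mul ((continuous_const (y := (2:ℝ))).mul (c1.inner (𝕜 := ℝ) c2))
  exact hasDerivAt_intervalIntegral_param (-R) R
    (F := fun t ξ => Real.arctan (ξ / K) * ‖phaseFourier (u t) (f t) ξ‖ ^ 2)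
    (F' := fun t ξ => Real.arctan (ξ / K) *
      (2 * inner ℝ (phaseFourier (u t) (f t) ξ) (phaseFourier (u t) (fun y =>
        ((-2 * Real.pi * v t y * ξ : ℝ) : ℂ) * Complex.I * f t y + dT f t y) ξ)))
    c3 c4
    (fun t ξ => (hasDerivAt_phaseFourier_time hu hv huv hf ξ t).norm_sq.const_mul _) t

lemma abs_arctanEnergy_le {K R : ℝ} (hR : 0 < R) {u : ℝ → ℝ → ℝ} {f : ℝ → ℝ → ℂ} {t : ℝ}
    {w : ℝ → ℝ} (hp : IsPhase (u t) w) (hf : Continuous (f t)) :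
    |arctanEnergy K R u f t| ≤ 4 * ∫ y in (-1:ℝ)..1, ‖f t y‖ ^ 2 := by
  have cP := continuous_phaseFourier hp.continuous hf
  have i : IntervalIntegrable (fun ξ => 2 * ‖phaseFourier (u t) (f t) ξ‖ ^ 2) volume (-R) R :=
    Continuous.intervalIntegrable (by fun_prop) _ _
  have h : |arctanEnergy K R u f t| ≤ ∫ ξ in (-R)..R, 2 * ‖phaseFourier (u t) (f t) ξ‖ ^ 2 := by
    rw [← Real.norm_eq_abs]
    refine intervalIntegral.norm_integral_le_of_norm_le (by linarith)
      (Filter.Eventually.of_forall fun ξ _ => ?_) i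
    rw [norm_mul, norm_pow, norm_norm, Real.norm_eq_abs]
    have := abs_arctan_le_two (ξ / K)
    gcongr
  rw [intervalIntegral.integral_const_mul] at h
  have := intervalIntegral_phaseFourier_sq_le hp hf.continuousOn hR
  linarith

/-- The data of the linearized vorticity equation at a fixed time. The perturbation of the shear
has size `δ`; the wave number is `σ q³` and the viscosity is `s⁶`. -/
structure IsVorticityState (s q σ δ : ℝ) (U w w' w'' : ℝ → ℝ)
    (f f' f'' ψ ψ' ψ'' h ft : ℝ → ℂ) : Prop where
  s_pos : 0 < s
  s_le : s ≤ 1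
  one_le_q : 1 ≤ q
  abs_sign : |σ| = 1
  δ_pos : 0 < δ
  δ_le : δ ≤ 1 / 40000000
  phase : IsPhase U w
  dw : ∀ y, HasDerivAt w (w' y) y
  dw' : ∀ y, HasDerivAt w' (w'' y) y
  cw'' : Continuous w''
  w'_le : ∀ y ∈ Icc (-1:ℝ) 1, |w' y| ≤ δ
  w''_le : ∀ y ∈ Icc (-1:ℝ) 1, |w'' y| ≤ δ
  df : ∀ y, HasDerivAt f (f' y) y
  df' : ∀ y, HasDerivAt f' (f'' y) y
  cf'' : Continuous f''
  dψ : ∀ y, HasDerivAt ψ (ψ' y) y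
  dψ' : ∀ y, HasDerivAt ψ' (ψ'' y) y
  cψ'' : Continuous ψ''
  ch : Continuous h
  f_left : f (-1) = 0
  f_right : f 1 = 0
  ψ_left : ψ (-1) = 0
  ψ_right : ψ 1 = 0
  stream : ∀ y ∈ Icc (-1:ℝ) 1, ψ'' y - ((q ^ 3 : ℝ) : ℂ) ^ 2 * ψ y = f y
  evol : ∀ y ∈ Icc (-1:ℝ) 1, ft y = -(Complex.I * (σ * q ^ 3 : ℝ) * U y * f y)
      - Complex.I * (σ * q ^ 3 : ℝ) * (w' y * ψ y) + (s ^ 6 : ℝ) * f'' y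
      - Complex.I * (σ * q ^ 3 : ℝ) * h y

namespace IsVorticityState

variable {s q σ δ : ℝ} {U w w' w'' : ℝ → ℝ} {f f' f'' ψ ψ' ψ'' h ft : ℝ → ℂ}

lemma cw' (H : IsVorticityState s q σ δ U w w' w'' f f' f'' ψ ψ' ψ'' h ft) : Continuous w' :=
  continuous_iff_continuousAt.2 fun y => (H.dw' y).continuousAt

lemma cf (H : IsVorticityState s q σ δ U w w' w'' f f' f'' ψ ψ' ψ'' h ft) : Continuous f :=
  continuous_iff_continuousAt.2 fun y => (H.df y).continuousAt

lemma cf' (H : IsVorticityState s q σ δ U w w' w'' f f' f'' ψ ψ' ψ'' h ft) : Continuous f' :=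
  continuous_iff_continuousAt.2 fun y => (H.df' y).continuousAt

lemma cψ (H : IsVorticityState s q σ δ U w w' w'' f f' f'' ψ ψ' ψ'' h ft) : Continuous ψ :=
  continuous_iff_continuousAt.2 fun y => (H.dψ y).continuousAt

lemma cψ' (H : IsVorticityState s q σ δ U w w' w'' f f' f'' ψ ψ' ψ'' h ft) : Continuous ψ' :=
  continuous_iff_continuousAt.2 fun y => (H.dψ' y).continuousAt

lemma hasDerivAt_w'_mul (H : IsVorticityState s q σ δ U w w' w'' f f' f'' ψ ψ' ψ'' h ft)
    {g g' : ℝ → ℂ} (hg : ∀ y, HasDerivAt g (g' y) y) (y : ℝ) :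
    HasDerivAt (fun y => (w' y : ℂ) * g y) (w'' y * g y + w' y * g' y) y :=
  (H.dw' y).ofReal_comp.mul (hg y)

/-- Multiplying by `w'` and then differentiating along the phase gains a factor `δ`. -/
lemma norm_phaseDeriv_w'_mul_sq_le
    (H : IsVorticityState s q σ δ U w w' w'' f f' f'' ψ ψ' ψ'' h ft) (g g' : ℝ → ℂ) {y : ℝ}
    (hy : y ∈ Icc (-1:ℝ) 1) :
    ‖phaseDeriv w w' (fun y => w' y * g y) (fun y => w'' y * g y + w' y * g' y) y‖ ^ 2
      ≤ 18 * δ ^ 2 * (‖g y‖ ^ 2 + ‖g' y‖ ^ 2) := by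
  have h1 := norm_phaseDeriv_le H.phase w' (fun y => w' y * g y)
    (fun y => w'' y * g y + w' y * g' y) hy
  have a1 := H.w'_le y hy
  have a2 := H.w''_le y hy
  have b1 : ‖(w' y : ℂ) * g y‖ ≤ δ * ‖g y‖ := by
    rw [norm_mul, Complex.norm_real, Real.norm_eq_abs]; gcongr
  have b2 : ‖(w'' y : ℂ) * g y + w' y * g' y‖ ≤ δ * ‖g y‖ + δ * ‖g' y‖ := by
    refine (norm_add_le _ _).trans ?_
    rw [norm_mul, norm_mul, Complex.norm_real, Real.norm_eq_abs, Complex.norm_real,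
      Real.norm_eq_abs]
    gcongr
  have h2 : 4 * |w' y| * ‖(w' y : ℂ) * g y‖ ≤ 4 * (1 / 40000000) * (δ * ‖g y‖) := by
    have := a1.trans H.δ_le
    gcongr
  have h3 : ‖phaseDeriv w w' (fun y => w' y * g y) (fun y => w'' y * g y + w' y * g' y) y‖
      ≤ 3 * δ * (‖g y‖ + ‖g' y‖) := by
    have := mul_nonneg H.δ_pos.le (norm_nonneg (g y))
    have := mul_nonneg H.δ_pos.le (norm_nonneg (g' y))
    linarith
  have h4 := pow_le_pow_left₀ (norm_nonneg _) h3 2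
  nlinarith [mul_nonneg (sq_nonneg δ) (sq_nonneg (‖g y‖ - ‖g' y‖))]

lemma integral_phaseDeriv_w'_mul_sq_le
    (H : IsVorticityState s q σ δ U w w' w'' f f' f'' ψ ψ' ψ'' h ft) {g g' : ℝ → ℂ}
    (hg : Continuous g) (hg' : Continuous g') :
    ∫ y in (-1:ℝ)..1,
      ‖phaseDeriv w w' (fun y => w' y * g y) (fun y => w'' y * g y + w' y * g' y) y‖ ^ 2
      ≤ 18 * δ ^ 2 * ((∫ y in (-1:ℝ)..1, ‖g y‖ ^ 2) + ∫ y in (-1:ℝ)..1, ‖g' y‖ ^ 2) := by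
  have i0 := intervalIntegrable_norm_sq hg.continuousOn
  have i1 := intervalIntegrable_norm_sq hg'.continuousOn
  have cw' := H.cw'
  have cw'' := H.cw''
  rw [← intervalIntegral.integral_add i0 i1, ← intervalIntegral.integral_const_mul]
  refine intervalIntegral.integral_mono_on (by norm_num) (intervalIntegrable_norm_sq
    (continuousOn_phaseDeriv H.phase cw'.continuousOn (Continuous.continuousOn (by fun_prop))
      (Continuous.continuousOn (by fun_prop)))) ((i0.add i1).const_mul _) fun y hy => ?_
  exact H.norm_phaseDeriv_w'_mul_sq_le g g' hy

lemma phaseFourier_w'_mul (H : IsVorticityState s q σ δ U w w' w'' f f' f'' ψ ψ' ψ'' h ft)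
    {g g' : ℝ → ℂ} (hg : ∀ y, HasDerivAt g (g' y) y) (hg' : Continuous g') (h0 : g (-1) = 0)
    (h1 : g 1 = 0) (ξ : ℝ) :
    ((2 * Real.pi * ξ : ℝ) : ℂ) * Complex.I * phaseFourier U (fun y => w' y * g y) ξ
      = phaseFourier U
        (phaseDeriv w w' (fun y => w' y * g y) (fun y => w'' y * g y + w' y * g' y)) ξ := by
  have cg : Continuous g := continuous_iff_continuousAt.2 fun y => (hg y).continuousAt
  have cw' := H.cw'
  have cw'' := H.cw''
  exact phaseFourier_phaseDeriv H.phase (fun y _ => H.dw y) cw'.continuousOn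
    (fun y _ => H.hasDerivAt_w'_mul hg y) (Continuous.continuousOn (by fun_prop))
    (by simp [h0]) (by simp [h1]) ξ

lemma integral_weighted_nonlocal_le
    (H : IsVorticityState s q σ δ U w w' w'' f f' f'' ψ ψ' ψ'' h ft) {R : ℝ} (hR : 0 < R) :
    ∫ ξ in (-R)..R, ((q ^ 3) ^ 2 + ξ ^ 2) * ‖phaseFourier U (fun y => w' y * ψ y) ξ‖ ^ 2
      ≤ 3 * δ ^ 2 * ∫ y in (-1:ℝ)..1, (‖ψ' y‖ ^ 2 + (q ^ 3) ^ 2 * ‖ψ y‖ ^ 2) := by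
  have cw' := H.cw'
  have cw'' := H.cw''
  have cψ := H.cψ
  have cψ' := H.cψ'
  have cg : ContinuousOn (fun y => (w' y : ℂ) * ψ y) (Icc (-1:ℝ) 1) :=
    Continuous.continuousOn (by fun_prop)
  have ch := continuousOn_phaseDeriv H.phase cw'.continuousOn cg
    (g' := fun y => w'' y * ψ y + w' y * ψ' y) (Continuous.continuousOn (by fun_prop))
  have hF := H.phaseFourier_w'_mul H.dψ cψ' H.ψ_left H.ψ_right
  have b := integral_weighted_phaseFourier_le H.phase (q ^ 3) cg ch hF
  have b2 : ∫ ξ in (-R)..R, ((q ^ 3) ^ 2 + ξ ^ 2) * ‖phaseFourier U (fun y => w' y * ψ y) ξ‖ ^ 2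
      ≤ ∫ ξ, ((q ^ 3) ^ 2 + ξ ^ 2) * ‖phaseFourier U (fun y => w' y * ψ y) ξ‖ ^ 2 := by
    rw [intervalIntegral.integral_of_le (by linarith)]
    exact setIntegral_le_integral (integrable_weighted_phaseFourier H.phase _ cg ch hF)
      (Filter.Eventually.of_forall fun _ => by positivity)
  have i0 := intervalIntegrable_norm_sq cψ.continuousOn
  have i1 := intervalIntegrable_norm_sq cψ'.continuousOn
  have b3 : ∫ y in (-1:ℝ)..1, ‖(w' y : ℂ) * ψ y‖ ^ 2 ≤ δ ^ 2 * ∫ y in (-1:ℝ)..1, ‖ψ y‖ ^ 2 := by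
    rw [← intervalIntegral.integral_const_mul]
    refine intervalIntegral.integral_mono_on (by norm_num) (intervalIntegrable_norm_sq cg)
      (i0.const_mul _) fun y hy => ?_
    rw [norm_mul, mul_pow, Complex.norm_real, Real.norm_eq_abs]
    have := H.w'_le y hy
    gcongr
  have b4 := H.integral_phaseDeriv_w'_mul_sq_le cψ cψ'
  rw [intervalIntegral.integral_add i1 (i0.const_mul _), intervalIntegral.integral_const_mul]
  have hq : 1 ≤ (q ^ 3) ^ 2 := one_le_pow₀ (one_le_pow₀ H.one_le_q)
  have n0 : 0 ≤ ∫ y in (-1:ℝ)..1, ‖ψ y‖ ^ 2 :=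
    intervalIntegral.integral_nonneg (by norm_num) fun _ _ => by positivity
  have n1 : 0 ≤ ∫ y in (-1:ℝ)..1, ‖ψ' y‖ ^ 2 :=
    intervalIntegral.integral_nonneg (by norm_num) fun _ _ => by positivity
  have b5 := mul_le_mul_of_nonneg_left b3 (by positivity : 0 ≤ 2 * (q ^ 3) ^ 2)
  have b6 := mul_le_mul_of_nonneg_right hq (mul_nonneg (sq_nonneg δ) n0)
  have b7 := mul_nonneg (sq_nonneg δ) n1
  linarith

lemma integral_phaseFourier_shear_le
    (H : IsVorticityState s q σ δ U w w' w'' f f' f'' ψ ψ' ψ'' h ft) {R : ℝ} (hR : 0 < R) :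
    ∫ ξ in (-R)..R, ‖((2 * Real.pi * ξ : ℝ) : ℂ) * Complex.I *
        phaseFourier U (fun y => w' y * f y) ξ‖ ^ 2
      ≤ (∫ y in (-1:ℝ)..1, ‖f y‖ ^ 2) + ∫ y in (-1:ℝ)..1, ‖f' y‖ ^ 2 := by
  have cw' := H.cw'
  have cw'' := H.cw''
  have cf := H.cf
  have cf' := H.cf'
  have ch := continuousOn_phaseDeriv H.phase cw'.continuousOn
    (g := fun y => w' y * f y) (g' := fun y => w'' y * f y + w' y * f' y)
    (Continuous.continuousOn (by fun_prop)) (Continuous.continuousOn (by fun_prop))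
  simp only [H.phaseFourier_w'_mul H.df cf' H.f_left H.f_right]
  have b1 := intervalIntegral_phaseFourier_sq_le H.phase ch hR
  have b2 := H.integral_phaseDeriv_w'_mul_sq_le cf cf'
  have n0 : 0 ≤ ∫ y in (-1:ℝ)..1, ‖f y‖ ^ 2 :=
    intervalIntegral.integral_nonneg (by norm_num) fun _ _ => by positivity
  have n1 : 0 ≤ ∫ y in (-1:ℝ)..1, ‖f' y‖ ^ 2 :=
    intervalIntegral.integral_nonneg (by norm_num) fun _ _ => by positivity
  have hδ : 36 * δ ^ 2 ≤ 1 := by nlinarith [H.δ_pos, H.δ_le]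
  have b3 := mul_le_mul_of_nonneg_right hδ (add_nonneg n0 n1)
  linarith

lemma sq_mul_norm_phaseFourier_le
    (H : IsVorticityState s q σ δ U w w' w'' f f' f'' ψ ψ' ψ'' h ft) (ξ : ℝ) :
    ξ ^ 2 * ‖phaseFourier U f ξ‖ ^ 2
      ≤ (∫ y in (-1:ℝ)..1, ‖f y‖ ^ 2) + ∫ y in (-1:ℝ)..1, ‖f' y‖ ^ 2 := by
  have cw' := H.cw'
  have cf := H.cf
  have cf' := H.cf'
  have ch := continuousOn_phaseDeriv H.phase cw'.continuousOn cf.continuousOn cf'.continuousOn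
  have e := norm_phaseFourier_sq_mul f _ ξ (phaseFourier_phaseDeriv H.phase (fun y _ => H.dw y)
    cw'.continuousOn (fun y _ => H.df y) cf'.continuousOn H.f_left H.f_right ξ)
  have b1 := norm_phaseFourier_sq_le H.phase ch ξ
  have i0 := intervalIntegrable_norm_sq cf.continuousOn
  have i1 := intervalIntegrable_norm_sq cf'.continuousOn
  have b2 : ∫ y in (-1:ℝ)..1, ‖phaseDeriv w w' f f' y‖ ^ 2
      ≤ 8 * ((∫ y in (-1:ℝ)..1, ‖f y‖ ^ 2) + ∫ y in (-1:ℝ)..1, ‖f' y‖ ^ 2) := by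
    rw [← intervalIntegral.integral_add i0 i1, ← intervalIntegral.integral_const_mul]
    refine intervalIntegral.integral_mono_on (by norm_num) (intervalIntegrable_norm_sq ch)
      ((i0.add i1).const_mul _) fun y hy => ?_
    have h1 := norm_phaseDeriv_le H.phase w' f f' hy
    have h2 : 4 * |w' y| * ‖f y‖ ≤ 4 * (1 / 40000000) * ‖f y‖ := by
      have := (H.w'_le y hy).trans H.δ_le
      gcongr
    have h3 : ‖phaseDeriv w w' f f' y‖ ≤ 2 * (‖f y‖ + ‖f' y‖) := by
      linarith [norm_nonneg (f y)]
    have h4 := pow_le_pow_left₀ (norm_nonneg _) h3 2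
    nlinarith [sq_nonneg (‖f y‖ - ‖f' y‖)]
  have hpi := Real.pi_gt_three
  have n : 0 ≤ ξ ^ 2 * ‖phaseFourier U f ξ‖ ^ 2 := by positivity
  have h16 : 16 ≤ (2 * Real.pi) ^ 2 := by nlinarith
  have := mul_le_mul_of_nonneg_right h16 n
  linarith

lemma phaseFourier_evol (H : IsVorticityState s q σ δ U w w' w'' f f' f'' ψ ψ' ψ'' h ft) (ξ : ℝ) :
    phaseFourier U (fun y => ((-2 * Real.pi * -(s ^ 6 * w' y) * ξ : ℝ) : ℂ) * Complex.I * f y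
        + ft y) ξ
      = ((σ * q ^ 3 / (2 * Real.pi) : ℝ) : ℂ) *
          phaseFourier U (fun y => ((-2 * Real.pi * U y : ℝ) : ℂ) * Complex.I * f y) ξ
        + -(Complex.I * (σ * q ^ 3 : ℝ)) * phaseFourier U (fun y => w' y * ψ y) ξ
        + ((s ^ 6 : ℝ) : ℂ) * phaseFourier U f'' ξ
        + -(Complex.I * (σ * q ^ 3 : ℝ)) * phaseFourier U h ξ
        + ((s ^ 6 : ℝ) : ℂ) * (((2 * Real.pi * ξ : ℝ) : ℂ) * Complex.I *
            phaseFourier U (fun y => w' y * f y) ξ) := by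
  have cU := H.phase.continuous
  have cw' := H.cw'
  have cf := H.cf
  have cf'' := H.cf''
  have cψ := H.cψ
  have ch := H.ch
  have hpi : (Real.pi : ℂ) ≠ 0 := by exact_mod_cast Real.pi_ne_zero
  simp only [← phaseFourier_const_mul]
  rw [← phaseFourier_add cU (by fun_prop) (by fun_prop), ← phaseFourier_add cU (by fun_prop)
    (by fun_prop), ← phaseFourier_add cU (by fun_prop) (by fun_prop),
    ← phaseFourier_add cU (by fun_prop) (by fun_prop)]
  refine congrFun (phaseFourier_congr fun y hy => ?_) ξ
  rw [H.evol y hy]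
  push_cast
  field_simp
  ring

end IsVorticityState

namespace IsVorticityState

variable {s q σ δ : ℝ} {U w w' w'' : ℝ → ℝ} {f f' f'' ψ ψ' ψ'' h ft : ℝ → ℂ}

lemma arctan_transport_le (H : IsVorticityState s q σ δ U w w' w'' f f' f'' ψ ψ' ψ'' h ft) :
    σ * ∫ ξ in (-(q ^ 3 / s ^ 6))..(q ^ 3 / s ^ 6), Real.arctan (ξ / q ^ 3) *
        (2 * inner ℝ (phaseFourier U f ξ) (((σ * q ^ 3 / (2 * Real.pi) : ℝ) : ℂ) *
          phaseFourier U (fun y => ((-2 * Real.pi * U y : ℝ) : ℂ) * Complex.I * f y) ξ))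
      ≤ -(1 / 7) * q ^ 6 * (∫ ξ in (-(q ^ 3 / s ^ 6))..(q ^ 3 / s ^ 6),
          ‖phaseFourier U f ξ‖ ^ 2 / ((q ^ 3) ^ 2 + ξ ^ 2))
        + s ^ 6 * ((∫ y in (-1:ℝ)..1, ‖f y‖ ^ 2) + ∫ y in (-1:ℝ)..1, ‖f' y‖ ^ 2) := by
  have hs := H.s_pos
  have hs1 := H.s_le
  have hq := H.one_le_q
  have hq0 : 0 < q := by linarith
  have cU := H.phase.continuous
  have cf := H.cf
  have hpi := Real.pi_gt_three
  have hpi2 := Real.pi_lt_d2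
  set R := q ^ 3 / s ^ 6 with hRdef
  have hR : 0 < R := by positivity
  set P := phaseFourier U f
  set A := ∫ ξ in (-R)..R, ‖P ξ‖ ^ 2 / ((q ^ 3) ^ 2 + ξ ^ 2) with hA
  set N := (∫ y in (-1:ℝ)..1, ‖f y‖ ^ 2) + ∫ y in (-1:ℝ)..1, ‖f' y‖ ^ 2
  have hA0 : 0 ≤ A := intervalIntegral.integral_nonneg (by linarith) fun _ _ => by positivity
  have hσ2 : σ * σ = 1 := by rw [← abs_mul_abs_self, H.abs_sign, one_mul]
  have key := integral_arctan_inner_deriv (R := R) (K := q ^ 3) (by positivity)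
    (hasDerivAt_phaseFourier cU cf) (continuous_phaseFourier cU (by fun_prop))
  have e : ∀ ξ, Real.arctan (ξ / q ^ 3) *
        (2 * inner ℝ (P ξ) (((σ * q ^ 3 / (2 * Real.pi) : ℝ) : ℂ) *
          phaseFourier U (fun y => ((-2 * Real.pi * U y : ℝ) : ℂ) * Complex.I * f y) ξ))
      = σ * q ^ 3 / (2 * Real.pi) * (Real.arctan (ξ / q ^ 3) * (2 * inner ℝ (P ξ)
          (phaseFourier U (fun y => ((-2 * Real.pi * U y : ℝ) : ℂ) * Complex.I * f y) ξ))) := by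
    intro ξ
    rw [← Complex.real_smul, inner_smul_right]
    ring
  simp only [e]
  rw [intervalIntegral.integral_const_mul, key]
  have e2 : σ * (σ * q ^ 3 / (2 * Real.pi) * (Real.arctan (R / q ^ 3) *
      (‖P R‖ ^ 2 + ‖P (-R)‖ ^ 2) - q ^ 3 * A))
      = q ^ 3 / (2 * Real.pi) * Real.arctan (R / q ^ 3) * (‖P R‖ ^ 2 + ‖P (-R)‖ ^ 2)
        - q ^ 6 / (2 * Real.pi) * A := by
    linear_combination (q ^ 3 / (2 * Real.pi) * (Real.arctan (R / q ^ 3) *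
      (‖P R‖ ^ 2 + ‖P (-R)‖ ^ 2) - q ^ 3 * A)) * hσ2
  rw [e2]
  have b1 : 1 / 7 * q ^ 6 * A ≤ q ^ 6 / (2 * Real.pi) * A := by
    gcongr
    rw [le_div_iff₀ (by positivity)]
    nlinarith [pow_pos hq0 6]
  have p1 := H.sq_mul_norm_phaseFourier_le R
  have p2 := H.sq_mul_norm_phaseFourier_le (-R)
  have hq3 : 1 ≤ q ^ 3 := one_le_pow₀ hq
  have hs6 : s ^ 6 ≤ 1 := pow_le_one₀ hs.le hs1
  have hN : 0 ≤ N := le_trans (by positivity) p1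
  have p3 : q ^ 3 * (‖P R‖ ^ 2 + ‖P (-R)‖ ^ 2) ≤ 2 * (s ^ 6 * N) := by
    have hk : q ^ 3 = s ^ 12 / q ^ 3 * R ^ 2 := by
      rw [hRdef]; field_simp
    have h1 : q ^ 3 * (‖P R‖ ^ 2 + ‖P (-R)‖ ^ 2)
        = s ^ 12 / q ^ 3 * (R ^ 2 * ‖P R‖ ^ 2 + (-R) ^ 2 * ‖P (-R)‖ ^ 2) := by
      rw [neg_sq]; linear_combination (‖P R‖ ^ 2 + ‖P (-R)‖ ^ 2) * hk
    have h2 : s ^ 12 / q ^ 3 ≤ s ^ 6 := by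
      rw [div_le_iff₀ (by positivity)]
      nlinarith [pow_pos hs 6, mul_le_mul_of_nonneg_left hq3 (pow_pos hs 6).le]
    rw [h1]
    calc s ^ 12 / q ^ 3 * (R ^ 2 * ‖P R‖ ^ 2 + (-R) ^ 2 * ‖P (-R)‖ ^ 2)
        ≤ s ^ 6 * (N + N) := by gcongr
      _ = _ := by ring
  have b2 : q ^ 3 / (2 * Real.pi) * Real.arctan (R / q ^ 3) * (‖P R‖ ^ 2 + ‖P (-R)‖ ^ 2)
      ≤ s ^ 6 * N := by
    have h1 : Real.arctan (R / q ^ 3) ≤ Real.pi / 2 := (Real.arctan_lt_pi_div_two _).le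
    calc q ^ 3 / (2 * Real.pi) * Real.arctan (R / q ^ 3) * (‖P R‖ ^ 2 + ‖P (-R)‖ ^ 2)
        ≤ q ^ 3 / (2 * Real.pi) * (Real.pi / 2) * (‖P R‖ ^ 2 + ‖P (-R)‖ ^ 2) := by gcongr
      _ = 1 / 4 * (q ^ 3 * (‖P R‖ ^ 2 + ‖P (-R)‖ ^ 2)) := by field_simp; ring
      _ ≤ s ^ 6 * N := by nlinarith [mul_nonneg (pow_pos hs 6).le hN]
  linarith

lemma arctanEnergy_rate_le (H : IsVorticityState s q σ δ U w w' w'' f f' f'' ψ ψ' ψ'' h ft) :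
    σ * ∫ ξ in (-(q ^ 3 / s ^ 6))..(q ^ 3 / s ^ 6), Real.arctan (ξ / q ^ 3) *
        (2 * inner ℝ (phaseFourier U f ξ) (phaseFourier U (fun y =>
          ((-2 * Real.pi * -(s ^ 6 * w' y) * ξ : ℝ) : ℂ) * Complex.I * f y + ft y) ξ))
      ≤ (-(1 / 7) * q ^ 6 + 2 * q ^ 3 * δ) * (∫ ξ in (-(q ^ 3 / s ^ 6))..(q ^ 3 / s ^ 6),
          ‖phaseFourier U f ξ‖ ^ 2 / ((q ^ 3) ^ 2 + ξ ^ 2))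
        + 6 * q ^ 3 * δ * (∫ y in (-1:ℝ)..1, (‖ψ' y‖ ^ 2 + (q ^ 3) ^ 2 * ‖ψ y‖ ^ 2))
        + (8 * (s ^ 2 * q ^ 2) + 7 * s ^ 6) * (∫ y in (-1:ℝ)..1, ‖f y‖ ^ 2)
        + 3 * s ^ 6 * (∫ y in (-1:ℝ)..1, ‖f' y‖ ^ 2)
        + 4 * (s ^ 10 / q ^ 2) * (∫ y in (-1:ℝ)..1, ‖f'' y‖ ^ 2)
        + 4 * (q ^ 4 / s ^ 2) * (∫ y in (-1:ℝ)..1, ‖h y‖ ^ 2) := by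
  have hs := H.s_pos
  have hq0 : 0 < q := by linarith [H.one_le_q]
  have hδ := H.δ_pos
  have cU := H.phase.continuous
  have cf := H.cf
  have cf'' := H.cf''
  have ch := H.ch
  have cw' := H.cw'
  have cψ := H.cψ
  have T0 := H.arctan_transport_le
  set R := q ^ 3 / s ^ 6 with hRdef
  have hR : 0 < R := by positivity
  have hσK : ‖-(Complex.I * ((σ * q ^ 3 : ℝ) : ℂ))‖ ^ 2 = q ^ 6 := by
    rw [norm_neg, norm_mul, Complex.norm_I, Complex.norm_real, Real.norm_eq_abs, abs_mul,
      H.abs_sign, abs_of_pos (by positivity)]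
    ring
  have hμ : ‖((s ^ 6 : ℝ) : ℂ)‖ ^ 2 = s ^ 12 := by
    rw [Complex.norm_real, Real.norm_of_nonneg (by positivity)]
    ring
  have cP := continuous_phaseFourier cU cf
  have c1 := continuous_phaseFourier cU (f := fun y => w' y * ψ y) (by fun_prop)
  have c2 := continuous_phaseFourier cU cf''
  have c3 := continuous_phaseFourier cU ch
  have c4 : Continuous fun ξ => ((2 * Real.pi * ξ : ℝ) : ℂ) * Complex.I *
      phaseFourier U (fun y => w' y * f y) ξ := by
    have := continuous_phaseFourier cU (f := fun y => w' y * f y) (by fun_prop)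
    fun_prop
  have c0 := continuous_phaseFourier cU
    (f := fun y => ((-2 * Real.pi * U y : ℝ) : ℂ) * Complex.I * f y) (by fun_prop)
  have ca := continuous_arctan_div (q ^ 3)
  have hm : Continuous fun ξ : ℝ => q ^ 3 * δ / ((q ^ 3) ^ 2 + ξ ^ 2) :=
    continuous_const.div (by fun_prop) fun ξ => by positivity
  have B1 := abs_integral_arctan_inner_le (K := q ^ 3) hR cP c1
    (-(Complex.I * ((σ * q ^ 3 : ℝ) : ℂ))) hm (fun ξ => by positivity)
  have B2 := abs_integral_arctan_inner_le (K := q ^ 3) hR cP c2 ((s ^ 6 : ℝ) : ℂ)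
    (m := fun _ => s ^ 2 * q ^ 2) continuous_const (fun ξ => by positivity)
  have B3 := abs_integral_arctan_inner_le (K := q ^ 3) hR cP c3
    (-(Complex.I * ((σ * q ^ 3 : ℝ) : ℂ))) (m := fun _ => s ^ 2 * q ^ 2) continuous_const
    (fun ξ => by positivity)
  have B4 := abs_integral_arctan_inner_le (K := q ^ 3) hR cP c4 ((s ^ 6 : ℝ) : ℂ)
    (m := fun _ => s ^ 6) continuous_const (fun ξ => by positivity)
  rw [hσK] at B1 B3
  rw [hμ] at B2 B4
  simp only [H.phaseFourier_evol, inner_add_right, mul_add]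
  rw [intervalIntegral.integral_add (Continuous.intervalIntegrable (by fun_prop) _ _)
      (Continuous.intervalIntegrable (by fun_prop) _ _),
    intervalIntegral.integral_add (Continuous.intervalIntegrable (by fun_prop) _ _)
      (Continuous.intervalIntegrable (by fun_prop) _ _),
    intervalIntegral.integral_add (Continuous.intervalIntegrable (by fun_prop) _ _)
      (Continuous.intervalIntegrable (by fun_prop) _ _),
    intervalIntegral.integral_add (Continuous.intervalIntegrable (by fun_prop) _ _)
      (Continuous.intervalIntegrable (by fun_prop) _ _)]
  simp only [intervalIntegral.integral_const_mul] at B2 B3 B4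
  have hle : ∀ {x y : ℝ}, |x| ≤ y → σ * x ≤ y := fun {x y} hxy => by
    simpa using le_mul_of_abs_le hxy σ H.abs_sign.le
  have B1' := hle B1
  have B2' := hle B2
  have B3' := hle B3
  have B4' := hle B4
  have Q0 := intervalIntegral_phaseFourier_sq_le H.phase cf.continuousOn hR
  have Q2 := intervalIntegral_phaseFourier_sq_le H.phase cf''.continuousOn hR
  have Q3 := intervalIntegral_phaseFourier_sq_le H.phase ch.continuousOn hR
  have Q4 := H.integral_phaseFourier_shear_le hR
  have Q1 := H.integral_weighted_nonlocal_le hR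
  have e1 : ∫ ξ in (-R)..R, q ^ 3 * δ / ((q ^ 3) ^ 2 + ξ ^ 2) * ‖phaseFourier U f ξ‖ ^ 2
      = q ^ 3 * δ * ∫ ξ in (-R)..R, ‖phaseFourier U f ξ‖ ^ 2 / ((q ^ 3) ^ 2 + ξ ^ 2) := by
    rw [← intervalIntegral.integral_const_mul]
    refine intervalIntegral.integral_congr fun ξ _ => ?_
    ring
  have e2 : q ^ 6 * ∫ ξ in (-R)..R, (q ^ 3 * δ / ((q ^ 3) ^ 2 + ξ ^ 2))⁻¹ *
        ‖phaseFourier U (fun y => w' y * ψ y) ξ‖ ^ 2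
      = q ^ 3 / δ * ∫ ξ in (-R)..R, ((q ^ 3) ^ 2 + ξ ^ 2) *
        ‖phaseFourier U (fun y => w' y * ψ y) ξ‖ ^ 2 := by
    rw [← intervalIntegral.integral_const_mul, ← intervalIntegral.integral_const_mul]
    refine intervalIntegral.integral_congr fun ξ _ => ?_
    field_simp
  rw [e1, e2] at B1'
  have R1 := mul_le_mul_of_nonneg_left Q1 (by positivity : 0 ≤ q ^ 3 / δ)
  have r1 : q ^ 3 / δ * (3 * δ ^ 2 * ∫ y in (-1:ℝ)..1, (‖ψ' y‖ ^ 2 + (q ^ 3) ^ 2 * ‖ψ y‖ ^ 2))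
      = 3 * q ^ 3 * δ * ∫ y in (-1:ℝ)..1, (‖ψ' y‖ ^ 2 + (q ^ 3) ^ 2 * ‖ψ y‖ ^ 2) := by
    field_simp
  have R0 := mul_le_mul_of_nonneg_left Q0 (by positivity : 0 ≤ s ^ 2 * q ^ 2)
  have R0' := mul_le_mul_of_nonneg_left Q0 (by positivity : 0 ≤ s ^ 6)
  have R2 := mul_le_mul_of_nonneg_left Q2 (by positivity : 0 ≤ s ^ 10 / q ^ 2)
  have R3 := mul_le_mul_of_nonneg_left Q3 (by positivity : 0 ≤ q ^ 4 / s ^ 2)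
  have R4 := mul_le_mul_of_nonneg_left Q4 (by positivity : 0 ≤ s ^ 6)
  have k2 : ∀ x : ℝ, s ^ 12 * ((s ^ 2 * q ^ 2)⁻¹ * x) = s ^ 10 / q ^ 2 * x := fun x => by
    field_simp
  have k3 : ∀ x : ℝ, q ^ 6 * ((s ^ 2 * q ^ 2)⁻¹ * x) = q ^ 4 / s ^ 2 * x := fun x => by
    field_simp
  have k4 : ∀ x : ℝ, s ^ 12 * ((s ^ 6)⁻¹ * x) = s ^ 6 * x := fun x => by
    field_simp
  rw [k2] at B2'
  rw [k3] at B3'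
  rw [k4] at B4'
  linarith

end IsVorticityState

namespace IsVorticityState

variable {s q σ δ : ℝ} {U w w' w'' : ℝ → ℝ} {f f' f'' ψ ψ' ψ'' h ft : ℝ → ℂ}

/-- The contribution of the nonlocal term to the `L²` balance. -/
lemma nonlocal_inner_le (H : IsVorticityState s q σ δ U w w' w'' f f' f'' ψ ψ' ψ'' h ft) :
    -2 * (σ * q ^ 3) * (∫ y in (-1:ℝ)..1, inner ℝ (f y) (Complex.I * (w' y * ψ y)))
      ≤ δ * ∫ y in (-1:ℝ)..1, (‖ψ' y‖ ^ 2 + (q ^ 3) ^ 2 * ‖ψ y‖ ^ 2) := by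
  have hq0 : 0 < q := by linarith [H.one_le_q]
  have cw' := H.cw'
  have cw'' := H.cw''
  have cψ := H.cψ
  have cψ' := H.cψ'
  have cψ'' := H.cψ''
  have hI := integral_eq_zero_of_hasDerivAt
    (T := fun y => inner ℝ (ψ' y) (Complex.I * (w' y * ψ y)))
    (fun y _ => (H.dψ' y).inner ℝ ((H.hasDerivAt_w'_mul H.dψ y).const_mul Complex.I))
    (Continuous.continuousOn (by fun_prop)) (by simp [H.ψ_left]) (by simp [H.ψ_right])
  have e : ∀ y ∈ uIcc (-1:ℝ) 1, inner ℝ (f y) (Complex.I * (w' y * ψ y))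
      = inner ℝ (ψ' y) (Complex.I * (w'' y * ψ y + w' y * ψ' y))
        + inner ℝ (ψ'' y) (Complex.I * (w' y * ψ y)) - w'' y * inner ℝ (ψ' y) (Complex.I * ψ y) := by
    intro y hy
    rw [uIcc_of_le (by norm_num)] at hy
    rw [← H.stream y hy, ← Complex.ofReal_pow]
    simp only [cinner_eq, Complex.add_re, Complex.add_im,
      Complex.sub_re, Complex.sub_im, Complex.mul_re, Complex.mul_im,
      Complex.I_re, Complex.I_im, Complex.ofReal_re, Complex.ofReal_im]
    ring
  rw [intervalIntegral.integral_congr e, intervalIntegral.integral_sub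
    (Continuous.intervalIntegrable (by fun_prop) _ _)
    (Continuous.intervalIntegrable (by fun_prop) _ _), hI,
    ← intervalIntegral.integral_const_mul δ, zero_sub, mul_neg,
    ← intervalIntegral.integral_const_mul, ← intervalIntegral.integral_neg]
  refine intervalIntegral.integral_mono_on (by norm_num)
    (Continuous.intervalIntegrable (by fun_prop) _ _)
    (Continuous.intervalIntegrable (by fun_prop) _ _) fun y hy => ?_
  have h1 : |w'' y * inner ℝ (ψ' y) (Complex.I * ψ y)| ≤ δ * (‖ψ' y‖ * ‖ψ y‖) := by
    rw [abs_mul]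
    exact mul_le_mul (H.w''_le y hy) (abs_inner_I_mul_le _ _) (abs_nonneg _) H.δ_pos.le
  have h2 := le_mul_of_abs_le h1 (2 * (σ * q ^ 3)) (c := 2 * q ^ 3) (le_of_eq (by
    rw [abs_mul, abs_mul, H.abs_sign, abs_of_pos (pow_pos hq0 3), abs_of_pos (by norm_num)]; ring))
  nlinarith [mul_nonneg H.δ_pos.le (sq_nonneg (‖ψ' y‖ - q ^ 3 * ‖ψ y‖))]

lemma integral_deriv_nonlocal_sq_le
    (H : IsVorticityState s q σ δ U w w' w'' f f' f'' ψ ψ' ψ'' h ft) :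
    ∫ y in (-1:ℝ)..1, ‖(w'' y : ℂ) * ψ y + w' y * ψ' y‖ ^ 2
      ≤ 2 * δ ^ 2 * ∫ y in (-1:ℝ)..1, (‖ψ' y‖ ^ 2 + (q ^ 3) ^ 2 * ‖ψ y‖ ^ 2) := by
  have cw' := H.cw'
  have cw'' := H.cw''
  have cψ := H.cψ
  have cψ' := H.cψ'
  have hq : 1 ≤ (q ^ 3) ^ 2 := one_le_pow₀ (one_le_pow₀ H.one_le_q)
  rw [← intervalIntegral.integral_const_mul]
  refine intervalIntegral.integral_mono_on (by norm_num)
    (Continuous.intervalIntegrable (by fun_prop) _ _)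
    (Continuous.intervalIntegrable (by fun_prop) _ _) fun y hy => ?_
  have h1 : ‖(w'' y : ℂ) * ψ y + w' y * ψ' y‖ ≤ δ * ‖ψ y‖ + δ * ‖ψ' y‖ := by
    refine (norm_add_le _ _).trans ?_
    rw [norm_mul, norm_mul, Complex.norm_real, Real.norm_eq_abs, Complex.norm_real,
      Real.norm_eq_abs]
    have := H.w'_le y hy
    have := H.w''_le y hy
    gcongr
  have h2 := pow_le_pow_left₀ (norm_nonneg _) h1 2
  have h3 := mul_le_mul_of_nonneg_right hq (mul_nonneg (sq_nonneg δ) (sq_nonneg ‖ψ y‖))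
  nlinarith [mul_nonneg (sq_nonneg δ) (sq_nonneg (‖ψ y‖ - ‖ψ' y‖))]

/-- The combined hypocoercive and `arctan` energies dissipate at the enhanced rate. -/
lemma total_rate_le (H : IsVorticityState s q σ δ U w w' w'' f f' f'' ψ ψ' ψ'' h ft) :
    (∫ y in (-1:ℝ)..1, hypoRate (s ^ 4 / (100 * q ^ 2)) (s ^ 2 / (100 * q)) σ
        (f y) (f' y) (f'' y) (ft y))
      + 1 / 100000 * (σ * ∫ ξ in (-(q ^ 3 / s ^ 6))..(q ^ 3 / s ^ 6), Real.arctan (ξ / q ^ 3) *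
        (2 * inner ℝ (phaseFourier U f ξ) (phaseFourier U (fun y =>
          ((-2 * Real.pi * -(s ^ 6 * w' y) * ξ : ℝ) : ℂ) * Complex.I * f y + ft y) ξ)))
      ≤ -(1 / 800) * (s ^ 2 * q ^ 2) * (∫ y in (-1:ℝ)..1, ‖f y‖ ^ 2)
        - 1 / 2 * s ^ 6 * (∫ y in (-1:ℝ)..1, ‖f' y‖ ^ 2)
        + 1610 * (q ^ 4 / s ^ 2) * (∫ y in (-1:ℝ)..1, ‖h y‖ ^ 2) := by
  have hs := H.s_pos
  have hs1 := H.s_le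
  have hq := H.one_le_q
  have hq0 : 0 < q := by linarith
  have hδ := H.δ_pos
  have hδ1 := H.δ_le
  have cw' := H.cw'
  have cw'' := H.cw''
  have cψ := H.cψ
  have cψ' := H.cψ'
  have T1 := integral_hypoRate_le hs hq0 H.abs_sign H.phase (g := fun y => w' y * ψ y)
    (fun y _ => H.df y) (fun y _ => H.df' y) H.cf''.continuousOn
    (fun y _ => H.hasDerivAt_w'_mul H.dψ y) (Continuous.continuousOn (by fun_prop))
    H.ch.continuousOn H.f_left H.f_right (by simp [H.ψ_left]) (by simp [H.ψ_right]) H.evol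
  have T2 := H.arctanEnergy_rate_le
  have T3 := H.nonlocal_inner_le
  have T4 := mul_le_mul_of_nonneg_left H.integral_deriv_nonlocal_sq_le
    (by positivity : 0 ≤ s ^ 2 * q ^ 2)
  have T5 := stream_energy_le H.phase (K := q ^ 3) (by positivity) (R := q ^ 3 / s ^ 6)
    (by positivity) (fun y _ => H.dψ y) (fun y _ => H.dψ' y) H.cψ''.continuousOn H.ψ_left
    H.ψ_right H.stream
  have n0 : 0 ≤ ∫ y in (-1:ℝ)..1, ‖f y‖ ^ 2 :=
    intervalIntegral.integral_nonneg (by norm_num) fun _ _ => by positivity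
  have n1 : 0 ≤ ∫ y in (-1:ℝ)..1, ‖f' y‖ ^ 2 :=
    intervalIntegral.integral_nonneg (by norm_num) fun _ _ => by positivity
  have n2 : 0 ≤ ∫ y in (-1:ℝ)..1, ‖f'' y‖ ^ 2 :=
    intervalIntegral.integral_nonneg (by norm_num) fun _ _ => by positivity
  have nh : 0 ≤ ∫ y in (-1:ℝ)..1, ‖h y‖ ^ 2 :=
    intervalIntegral.integral_nonneg (by norm_num) fun _ _ => by positivity
  have nD : 0 ≤ ∫ y in (-1:ℝ)..1, (‖ψ' y‖ ^ 2 + (q ^ 3) ^ 2 * ‖ψ y‖ ^ 2) :=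
    intervalIntegral.integral_nonneg (by norm_num) fun _ _ => by positivity
  have nA : 0 ≤ ∫ ξ in (-(q ^ 3 / s ^ 6))..(q ^ 3 / s ^ 6),
      ‖phaseFourier U f ξ‖ ^ 2 / ((q ^ 3) ^ 2 + ξ ^ 2) :=
    intervalIntegral.integral_nonneg
      ((neg_nonpos.2 (by positivity)).trans (by positivity)) fun _ _ => by positivity
  have eR : q ^ 6 * (2 / (q ^ 3 / s ^ 6) ^ 2) = 2 * s ^ 12 := by field_simp
  generalize (∫ y in (-1:ℝ)..1, ‖f y‖ ^ 2) = N0 at *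
  generalize (∫ y in (-1:ℝ)..1, ‖f' y‖ ^ 2) = N1 at *
  generalize (∫ y in (-1:ℝ)..1, ‖f'' y‖ ^ 2) = N2 at *
  generalize (∫ y in (-1:ℝ)..1, ‖h y‖ ^ 2) = Nh at *
  generalize (∫ y in (-1:ℝ)..1, (‖ψ' y‖ ^ 2 + (q ^ 3) ^ 2 * ‖ψ y‖ ^ 2)) = D at *
  generalize (∫ ξ in (-(q ^ 3 / s ^ 6))..(q ^ 3 / s ^ 6),
      ‖phaseFourier U f ξ‖ ^ 2 / ((q ^ 3) ^ 2 + ξ ^ 2)) = 𝒜 at *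
  have q3 : 1 ≤ q ^ 3 := one_le_pow₀ hq
  have q6 : q ^ 3 ≤ q ^ 6 := pow_le_pow_right₀ hq (by norm_num)
  have sq : s ^ 2 * q ^ 2 ≤ q ^ 6 :=
    calc s ^ 2 * q ^ 2 ≤ 1 * q ^ 2 := by gcongr; exact pow_le_one₀ hs.le hs1
      _ = q ^ 2 := one_mul _
      _ ≤ q ^ 6 := pow_le_pow_right₀ hq (by norm_num)
  have q2 : 1 ≤ q ^ 2 := one_le_pow₀ hq
  have s12 : s ^ 12 ≤ s ^ 2 * q ^ 2 :=
    (pow_le_pow_of_le_one hs.le hs1 (by norm_num : 2 ≤ 12)).trans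
      (le_mul_of_one_le_right (by positivity) q2)
  have s6 : s ^ 6 ≤ s ^ 2 * q ^ 2 :=
    (pow_le_pow_of_le_one hs.le hs1 (by norm_num : 2 ≤ 6)).trans
      (le_mul_of_one_le_right (by positivity) q2)
  have dq3 : δ * q ^ 3 ≤ 1 / 40000000 * q ^ 6 := by gcongr
  have dq : δ ≤ 1 / 40000000 * q ^ 6 := by linarith
  have ddq : δ ^ 2 * (s ^ 2 * q ^ 2) ≤ 1 / 40000000 * q ^ 6 := by
    have : δ ^ 2 ≤ 1 / 40000000 := by nlinarith
    gcongr
  have cD : δ + 2 * (δ ^ 2 * (s ^ 2 * q ^ 2)) + 6 / 100000 * (δ * q ^ 3)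
      ≤ 1 / 5000000 * q ^ 6 := by linarith [pow_pos hq0 6]
  have D1 := mul_le_mul_of_nonneg_right cD nD
  have D2 := mul_le_mul_of_nonneg_left T5 (by positivity : 0 ≤ q ^ 6)
  have D3 : q ^ 6 * (9 / 2 * (𝒜 + 2 / (q ^ 3 / s ^ 6) ^ 2 * N0))
      = 9 / 2 * (q ^ 6 * 𝒜) + 9 * (s ^ 12 * N0) := by linear_combination 9 / 2 * N0 * eR
  have A1 := mul_le_mul_of_nonneg_right dq3 nA
  have A2 := mul_nonneg (by positivity : 0 ≤ q ^ 6) nA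
  have M0 := mul_le_mul_of_nonneg_right s12 n0
  have M6 := mul_le_mul_of_nonneg_right s6 n0
  have P0 := mul_nonneg (by positivity : 0 ≤ s ^ 2 * q ^ 2) n0
  have P1 := mul_nonneg (by positivity : 0 ≤ s ^ 6) n1
  have P2 := mul_nonneg (by positivity : 0 ≤ s ^ 10 / q ^ 2) n2
  have Ph := mul_nonneg (by positivity : 0 ≤ q ^ 4 / s ^ 2) nh
  linarith

end IsVorticityState

/-- Enhanced dissipation for the linearized vorticity driven by an exponentially decaying
source. -/
lemma vorticity_decay {s q σ δ B L P : ℝ} (hs : 0 < s) (hs1 : s ≤ 1) (hq : 1 ≤ q) (hσ : |σ| = 1)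
    (hδ : 0 < δ) (hδ1 : δ ≤ 1 / 40000000) {W : ℝ → ℝ → ℝ} (hW : IsHeatSolution (s ^ 6) W)
    (hWb : ∀ t ≥ (0:ℝ), ∀ y ∈ Icc (-1:ℝ) 1, |W t y| ≤ δ ∧ |dY W t y| ≤ δ ∧ |dY (dY W) t y| ≤ δ)
    {f ψ h : ℝ → ℝ → ℂ} (hf : Smooth₂ f) (hψ : Smooth₂ ψ) (hh : Smooth₂ h)
    (hfb : ∀ t ≥ (0:ℝ), f t (-1) = 0 ∧ f t 1 = 0) (hψb : ∀ t ≥ (0:ℝ), ψ t (-1) = 0 ∧ ψ t 1 = 0)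
    (hstream : ∀ t ≥ (0:ℝ), ∀ y ∈ Icc (-1:ℝ) 1,
      dY (dY ψ) t y - ((q ^ 3 : ℝ) : ℂ) ^ 2 * ψ t y = f t y)
    (hevol : ∀ t ≥ (0:ℝ), ∀ y ∈ Icc (-1:ℝ) 1, dT f t y
      = -(Complex.I * (σ * q ^ 3 : ℝ) * shearFlow W t y * f t y)
        - Complex.I * (σ * q ^ 3 : ℝ) * (dY W t y * ψ t y) + (s ^ 6 : ℝ) * dY (dY f) t y
        - Complex.I * (σ * q ^ 3 : ℝ) * h t y)
    (hP : 0 ≤ P) (hhb : ∀ t ≥ (0:ℝ), ∫ y in (-1:ℝ)..1, ‖h t y‖ ^ 2 ≤ P * Real.exp (-(2 * B * t)))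
    (hL : 0 < L) (hLA : L ≤ 1 / 3200 * (s ^ 2 * q ^ 2)) (hLB : L ≤ B) {t : ℝ} (ht : 0 ≤ t) :
    (∫ y in (-1:ℝ)..1, ‖f t y‖ ^ 2) + s ^ 4 / q ^ 2 * ∫ y in (-1:ℝ)..1, ‖dY f t y‖ ^ 2
      ≤ 400 * ((∫ y in (-1:ℝ)..1, ‖f 0 y‖ ^ 2)
          + s ^ 4 / q ^ 2 * ∫ y in (-1:ℝ)..1, ‖dY f 0 y‖ ^ 2)
          * Real.exp (-(2 * (1 / 3200 * (s ^ 2 * q ^ 2)) * t))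
        + 200 * (1610 * (q ^ 4 / s ^ 2) * P / L) * Real.exp (-(L * t)) := by
  have hq0 : 0 < q := by linarith
  have hN0 : ∀ t, 0 ≤ ∫ y in (-1:ℝ)..1, ‖f t y‖ ^ 2 := fun t =>
    intervalIntegral.integral_nonneg (by norm_num) fun _ _ => by positivity
  have hN1 : ∀ t, 0 ≤ ∫ y in (-1:ℝ)..1, ‖dY f t y‖ ^ 2 := fun t =>
    intervalIntegral.integral_nonneg (by norm_num) fun _ _ => by positivity
  have hr : 0 < s ^ 4 / q ^ 2 := by positivity
  have hR : 0 < q ^ 3 / s ^ 6 := by positivity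
  have hp : ∀ t ≥ (0:ℝ), IsPhase (shearFlow W t) (W t) := fun t ht =>
    isPhase_shearFlow hW.smooth fun y hy => (hWb t ht y hy).1.trans (by linarith)
  set E : ℝ → ℝ := fun t => hypoEnergy (s ^ 4 / (100 * q ^ 2)) (s ^ 2 / (100 * q)) σ f t
    + 1 / 100000 * (σ * arctanEnergy (q ^ 3) (q ^ 3 / s ^ 6) (shearFlow W) f t) with hE
  have e100 : s ^ 4 / (100 * q ^ 2) = 1 / 100 * (s ^ 4 / q ^ 2) := by field_simp
  have hbd : ∀ t ≥ (0:ℝ), 1 / 200 * ((∫ y in (-1:ℝ)..1, ‖f t y‖ ^ 2)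
        + s ^ 4 / q ^ 2 * ∫ y in (-1:ℝ)..1, ‖dY f t y‖ ^ 2) ≤ E t
      ∧ E t ≤ 2 * ((∫ y in (-1:ℝ)..1, ‖f t y‖ ^ 2)
        + s ^ 4 / q ^ 2 * ∫ y in (-1:ℝ)..1, ‖dY f t y‖ ^ 2) := by
    intro t ht
    have h1 := abs_le.1 (hypoEnergy_bounds hs hq0 hσ hf t)
    have h2 := abs_arctanEnergy_le (K := q ^ 3) hR (hp t ht) (hf.continuous_snd t)
    have h3 : |σ * arctanEnergy (q ^ 3) (q ^ 3 / s ^ 6) (shearFlow W) f t|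
        ≤ 4 * ∫ y in (-1:ℝ)..1, ‖f t y‖ ^ 2 := by rwa [abs_mul, hσ, one_mul]
    have h4 := abs_le.1 h3
    have := hN0 t
    have := mul_nonneg hr.le (hN1 t)
    simp only [hE]
    have e1 : s ^ 4 / (100 * q ^ 2) * (∫ y in (-1:ℝ)..1, ‖dY f t y‖ ^ 2)
        = 1 / 100 * (s ^ 4 / q ^ 2 * ∫ y in (-1:ℝ)..1, ‖dY f t y‖ ^ 2) := by rw [e100]; ring
    rw [e1] at h1
    constructor <;> linarith [h1.1, h1.2, h4.1, h4.2]
  have hW' := hW.smooth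
  have key := gronwall_exp_source (E := E) (A := 1 / 3200 * (s ^ 2 * q ^ 2)) (B := B)
    (M := 1610 * (q ^ 4 / s ^ 2) * P) hL hLA hLB (by positivity) (fun t ht => ?_) ht
  · have h1 := (hbd t ht).1
    have h2 := mul_le_mul_of_nonneg_right (hbd 0 le_rfl).2
      (Real.exp_pos (-(2 * (1 / 3200 * (s ^ 2 * q ^ 2)) * t))).le
    linarith
  · have hd1 := hasDerivAt_hypoEnergy (s ^ 4 / (100 * q ^ 2)) (s ^ 2 / (100 * q)) σ hf
      (hf.dT_eq_zero (fun t ht => (hfb t ht).1) ht) (hf.dT_eq_zero (fun t ht => (hfb t ht).2) ht)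
    have cv : Continuous (Function.uncurry fun t y => shearFlow (dT W) t y - y) :=
      (continuous_shearFlow hW'.dT.continuous).sub continuous_snd
    have hd2 := hasDerivAt_arctanEnergy (q ^ 3) (q ^ 3 / s ^ 6)
      (continuous_shearFlow hW'.continuous) cv (hasDerivAt_shearFlow_time hW') hf t
    refine ⟨_, hd1.add ((hd2.const_mul σ).const_mul (1 / 100000)), ?_⟩
    have H : IsVorticityState s q σ δ (shearFlow W t) (W t) (dY W t) (dY (dY W) t) (f t) (dY f t)
        (dY (dY f) t) (ψ t) (dY ψ t) (dY (dY ψ) t) (h t) (dT f t) :=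
      { s_pos := hs, s_le := hs1, one_le_q := hq, abs_sign := hσ, δ_pos := hδ, δ_le := hδ1
        phase := hp t ht
        dw := hW'.hasDerivAt_snd t
        dw' := hW'.dY.hasDerivAt_snd t
        cw'' := hW'.dY.dY.continuous_snd t
        w'_le := fun y hy => (hWb t ht y hy).2.1
        w''_le := fun y hy => (hWb t ht y hy).2.2
        df := hf.hasDerivAt_snd t
        df' := hf.dY.hasDerivAt_snd t
        cf'' := hf.dY.dY.continuous_snd t
        dψ := hψ.hasDerivAt_snd t
        dψ' := hψ.dY.hasDerivAt_snd t
        cψ'' := hψ.dY.dY.continuous_snd t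
        ch := hh.continuous_snd t
        f_left := (hfb t ht).1
        f_right := (hfb t ht).2
        ψ_left := (hψb t ht).1
        ψ_right := (hψb t ht).2
        stream := hstream t ht
        evol := hevol t ht }
    have hrate := H.total_rate_le
    have hcongr : ∀ ξ, phaseFourier (shearFlow W t) (fun y =>
          ((-2 * Real.pi * (shearFlow (dT W) t y - y) * ξ : ℝ) : ℂ) * Complex.I * f t y
            + dT f t y) ξ
        = phaseFourier (shearFlow W t) (fun y =>
          ((-2 * Real.pi * -(s ^ 6 * dY W t y) * ξ : ℝ) : ℂ) * Complex.I * f t y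
            + dT f t y) ξ := fun ξ =>
      congrFun (phaseFourier_congr fun y hy => by rw [hW.shearFlow_dT ht hy]) ξ
    simp only [hcongr]
    refine hrate.trans ?_
    have hub := mul_le_mul_of_nonneg_left (hbd t ht).2 (by positivity : 0 ≤ s ^ 2 * q ^ 2)
    have e2 : s ^ 2 * q ^ 2 * (s ^ 4 / q ^ 2 * ∫ y in (-1:ℝ)..1, ‖dY f t y‖ ^ 2)
        = s ^ 6 * ∫ y in (-1:ℝ)..1, ‖dY f t y‖ ^ 2 := by field_simp
    have h4 := mul_nonneg (by positivity : 0 ≤ s ^ 6) (hN1 t)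
    have h5 := mul_le_mul_of_nonneg_left (hhb t ht) (by positivity : 0 ≤ 1610 * (q ^ 4 / s ^ 2))
    nlinarith [h4, h5, e2, hub]

/-- The decay estimate for the linearized system in terms of the sixth roots `s`, `r` of the
viscosity and the diffusivity and the cube root `q` of the modulus of the wave number. -/
lemma linearized_decay {s r m q σ δ : ℝ} (hs : 0 < s) (hs1 : s ≤ 1) (hr : 0 < r) (hm : 0 < m)
    (hms : m ≤ s) (hmr : m ≤ r) (hq : 1 ≤ q) (hσ : |σ| = 1)
    (hδ : 0 < δ) (hδ1 : δ ≤ 1 / 40000000) {W : ℝ → ℝ → ℝ} (hW : IsHeatSolution (s ^ 6) W)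
    (hWb : ∀ t ≥ (0:ℝ), ∀ y ∈ Icc (-1:ℝ) 1, |W t y| ≤ δ ∧ |dY W t y| ≤ δ ∧ |dY (dY W) t y| ≤ δ)
    {ω ψ θ : ℝ → ℝ → ℂ} (hω : Smooth₂ ω) (hψ : Smooth₂ ψ) (hθ : Smooth₂ θ)
    (hωb : ∀ t ≥ (0:ℝ), ω t (-1) = 0 ∧ ω t 1 = 0) (hψb : ∀ t ≥ (0:ℝ), ψ t (-1) = 0 ∧ ψ t 1 = 0)
    (hθb : ∀ t ≥ (0:ℝ), θ t (-1) = 0 ∧ θ t 1 = 0)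
    (hstream : ∀ t ≥ (0:ℝ), ∀ y ∈ Icc (-1:ℝ) 1,
      dY (dY ψ) t y - ((q ^ 3 : ℝ) : ℂ) ^ 2 * ψ t y = ω t y)
    (hevol : ∀ t ≥ (0:ℝ), ∀ y ∈ Icc (-1:ℝ) 1, dT ω t y
      = -(Complex.I * (σ * q ^ 3 : ℝ) * shearFlow W t y * ω t y)
        - Complex.I * (σ * q ^ 3 : ℝ) * (dY W t y * ψ t y) + (s ^ 6 : ℝ) * dY (dY ω) t y
        - Complex.I * (σ * q ^ 3 : ℝ) * θ t y)
    (hscalar : ∀ t ≥ (0:ℝ), ∀ y ∈ Icc (-1:ℝ) 1, dT θ t y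
      = -(Complex.I * (σ * q ^ 3 : ℝ) * shearFlow W t y * θ t y) + (r ^ 6 : ℝ) * dY (dY θ) t y)
    {t : ℝ} (ht : 0 ≤ t) :
    (∫ y in (-1:ℝ)..1, ‖ω t y‖ ^ 2) + s ^ 4 / q ^ 2 * ∫ y in (-1:ℝ)..1, ‖dY ω t y‖ ^ 2
      ≤ 2060800000 * ((∫ y in (-1:ℝ)..1, ‖ω 0 y‖ ^ 2)
          + s ^ 4 / q ^ 2 * ∫ y in (-1:ℝ)..1, ‖dY ω 0 y‖ ^ 2)
          * Real.exp (-(1 / 3200 * s ^ 2 * q ^ 2 * t))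
        + 2060800000 * (q ^ 2 / m ^ 4) * ((∫ y in (-1:ℝ)..1, ‖θ 0 y‖ ^ 2)
          + r ^ 4 / q ^ 2 * ∫ y in (-1:ℝ)..1, ‖dY θ 0 y‖ ^ 2)
          * Real.exp (-(1 / 3200 * m ^ 2 * q ^ 2 * t)) := by
  have hq0 : 0 < q := by linarith
  have hp : ∀ t ≥ (0:ℝ), IsPhase (shearFlow W t) (W t) := fun t ht =>
    isPhase_shearFlow hW.smooth fun y hy => (hWb t ht y hy).1.trans (by linarith)
  have nonneg : ∀ (f : ℝ → ℝ → ℂ) (a : ℝ), 0 < a → 0 ≤ (∫ y in (-1:ℝ)..1, ‖f 0 y‖ ^ 2)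
      + a * ∫ y in (-1:ℝ)..1, ‖dY f 0 y‖ ^ 2 := fun f a ha =>
    add_nonneg (intervalIntegral.integral_nonneg (by norm_num) fun _ _ => by positivity)
      (mul_nonneg ha.le
        (intervalIntegral.integral_nonneg (by norm_num) fun _ _ => by positivity))
  have nω := nonneg ω (s ^ 4 / q ^ 2) (by positivity)
  have nθ := nonneg θ (r ^ 4 / q ^ 2) (by positivity)
  have key := vorticity_decay hs hs1 hq hσ hδ hδ1 hW hWb hω hψ hθ hωb hψb hstream hevol
    (mul_nonneg zero_le_two nθ)
    (fun t ht => passive_scalar_decay hr hq hσ hp hθ hθb hscalar ht)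
    (L := 1 / 3200 * (m ^ 2 * q ^ 2)) (by positivity) (by gcongr) (by gcongr) ht
  refine key.trans (add_le_add ?_ ?_)
  · refine mul_le_mul ?_ (Real.exp_le_exp.2 ?_) (Real.exp_pos _).le
      (mul_nonneg (by norm_num) nω)
    · exact mul_le_mul_of_nonneg_right (by norm_num) nω
    · have : 0 ≤ s ^ 2 * q ^ 2 * t := by positivity
      linarith
  · have e : 1 / 3200 * (m ^ 2 * q ^ 2) * t = 1 / 3200 * m ^ 2 * q ^ 2 * t := by ring
    rw [e]
    refine mul_le_mul_of_nonneg_right ?_ (Real.exp_pos _).le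
    set Φ := (∫ y in (-1:ℝ)..1, ‖θ 0 y‖ ^ 2) + r ^ 4 / q ^ 2 * ∫ y in (-1:ℝ)..1, ‖dY θ 0 y‖ ^ 2
    calc 200 * (1610 * (q ^ 4 / s ^ 2) * (2 * Φ) / (1 / 3200 * (m ^ 2 * q ^ 2)))
        = 2060800000 * (q ^ 2 / (s ^ 2 * m ^ 2)) * Φ := by field_simp; ring
      _ ≤ 2060800000 * (q ^ 2 / (m ^ 2 * m ^ 2)) * Φ := by gcongr
      _ = _ := by ring

end EnhancedDissipation

theorem stmt_16 :
    ∃ δ₀ : ℝ, δ₀ ∈ Ioo (0:ℝ) (1/2) ∧ ∃ C₀ : ℝ, 0 < C₀ ∧ ∃ c₀ : ℝ, 0 < c₀ ∧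
    ∀ μ ν : ℝ, μ ∈ Ioc (0:ℝ) 1 → ν ∈ Ioc (0:ℝ) 1 →
    ∀ k : ℤ, k ≠ 0 →
    ∀ W : ℝ → ℝ → ℝ, ContDiff ℝ (⊤ : ℕ∞) (Function.uncurry W) →
    (∀ t ≥ (0:ℝ), ∀ y ∈ Icc (-1:ℝ) 1,
      deriv (fun s => W s y) t = μ * deriv (deriv (W t)) y) →
    (∀ t ≥ (0:ℝ), W t (-1) = 0 ∧ W t 1 = 0) →
    (∑ j ∈ Finset.range 5, ∫ y in (-1:ℝ)..1, (deriv^[j] (W 0) y)^2) ≤ δ₀^2 →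
    ∀ U : ℝ → ℝ → ℝ,
    (∀ t y, U t y = y + deriv (fun z => ∫ y' in (-1:ℝ)..1, G z y' * W t y') y) →
    ∀ ω ψ θ : ℝ → ℝ → ℂ,
    ContDiff ℝ (⊤ : ℕ∞) (Function.uncurry ω) → ContDiff ℝ (⊤ : ℕ∞) (Function.uncurry ψ) →
    ContDiff ℝ (⊤ : ℕ∞) (Function.uncurry θ) →
    (∀ t ≥ (0:ℝ), ω t (-1) = 0 ∧ ω t 1 = 0 ∧ ψ t (-1) = 0 ∧ ψ t 1 = 0 ∧
      θ t (-1) = 0 ∧ θ t 1 = 0) →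
    (∀ t ≥ (0:ℝ), ∀ y ∈ Icc (-1:ℝ) 1,
      deriv (fun s => ω s y) t + Complex.I * (k : ℂ) * (U t y : ℂ) * ω t y
        - Complex.I * (k : ℂ) * (Complex.ofReal (deriv (deriv (U t)) y)) * ψ t y
        - (μ : ℂ) * deriv (deriv (ω t)) y = -(Complex.I * (k : ℂ) * θ t y)) →
    (∀ t ≥ (0:ℝ), ∀ y ∈ Icc (-1:ℝ) 1,
      deriv (fun s => θ s y) t + Complex.I * (k : ℂ) * (U t y : ℂ) * θ t y
        - (ν : ℂ) * deriv (deriv (θ t)) y = 0) →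
    (∀ t ≥ (0:ℝ), ∀ y ∈ Icc (-1:ℝ) 1,
      deriv (deriv (ψ t)) y - (k : ℂ)^2 * ψ t y = ω t y) →
    ∀ t ≥ (0:ℝ),
      (∫ y in (-1:ℝ)..1, ‖ω t y‖^2)
          + μ ^ ((2:ℝ)/3) * |(k : ℝ)| ^ (-(2:ℝ)/3) *
              (∫ y in (-1:ℝ)..1, ‖deriv (ω t) y‖^2) ≤
        C₀ * ((∫ y in (-1:ℝ)..1, ‖ω 0 y‖^2)
            + μ ^ ((2:ℝ)/3) * |(k : ℝ)| ^ (-(2:ℝ)/3) *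
                (∫ y in (-1:ℝ)..1, ‖deriv (ω 0) y‖^2)) *
            Real.exp (-(c₀ * μ ^ ((1:ℝ)/3) * |(k : ℝ)| ^ ((2:ℝ)/3) * t))
          + C₀ * (min μ ν) ^ (-(2:ℝ)/3) * |(k : ℝ)| ^ ((2:ℝ)/3) *
              ((∫ y in (-1:ℝ)..1, ‖θ 0 y‖^2)
                + ν ^ ((2:ℝ)/3) * |(k : ℝ)| ^ (-(2:ℝ)/3) *
                    (∫ y in (-1:ℝ)..1, ‖deriv (θ 0) y‖^2)) *
              Real.exp (-(c₀ * (min μ ν) ^ ((1:ℝ)/3) * |(k : ℝ)| ^ ((2:ℝ)/3) * t)) := by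
  refine ⟨1 / 1000000000, by norm_num, 2060800000, by norm_num, 1 / 3200, by norm_num, ?_⟩
  intro μ ν hμ hν k hk W (hWs : Smooth₂ W) hheat hWb hsum U hU ω ψ θ (hω : Smooth₂ ω)
    (hψ : Smooth₂ ψ) (hθ : Smooth₂ θ) hb heqω heqθ heqψ t ht
  have edd : ∀ (f : ℝ → ℝ → ℂ) (t y : ℝ), dY (dY f) t y = deriv (deriv (f t)) y :=
    fun _ _ _ => rfl
  have hm : 0 < min μ ν := lt_min hμ.1 hν.1
  have hk1 : 1 ≤ |(k : ℝ)| := by exact_mod_cast Int.one_le_abs hk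
  have hk0 : 0 < |(k : ℝ)| := by linarith
  have root : ∀ {x : ℝ}, 0 < x → ∀ (p : ℝ) (n : ℕ) (e : ℝ), p * n = e → x ^ e = (x ^ p) ^ n :=
    fun {x} hx p n e h => by rw [← h, Real.rpow_mul_natCast hx.le]
  have s6 : ((μ ^ ((1:ℝ) / 6)) ^ 6) = μ := by
    rw [← root hμ.1 (1 / 6) 6 1 (by norm_num), Real.rpow_one]
  have r6 : ((ν ^ ((1:ℝ) / 6)) ^ 6) = ν := by
    rw [← root hν.1 (1 / 6) 6 1 (by norm_num), Real.rpow_one]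
  have q3 : ((|(k : ℝ)| ^ ((1:ℝ) / 3)) ^ 3) = |(k : ℝ)| := by
    rw [← root hk0 (1 / 3) 3 1 (by norm_num), Real.rpow_one]
  have ek : SignType.sign (k : ℝ) * |(k : ℝ)| = k := sign_mul_abs _
  have hσ : |((SignType.sign (k : ℝ) : SignType) : ℝ)| = 1 := by
    rcases lt_or_gt_of_ne (Int.cast_ne_zero.2 hk : (k : ℝ) ≠ 0) with h | h
    · simp [sign_neg h]
    · simp [sign_pos h]
  have hheat : IsHeatSolution ((μ ^ ((1:ℝ) / 6)) ^ 6) W :=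
    ⟨hWs, fun t ht y hy => s6.symm ▸ hheat t ht y hy, fun t ht => (hWb t ht).1,
      fun t ht => (hWb t ht).2⟩
  have hterm : ∀ j ∈ Finset.range 5,
      ∫ y in (-1:ℝ)..1, (deriv^[j] (W 0) y) ^ 2 ≤ (1 / 1000000000) ^ 2 := fun j hj =>
    (Finset.single_le_sum (f := fun j => ∫ y in (-1:ℝ)..1, (deriv^[j] (W 0) y) ^ 2)
      (fun j _ => intervalIntegral.integral_nonneg (by norm_num) fun _ _ => by positivity)
      hj).trans hsum
  have hWsup : ∀ t ≥ (0:ℝ), ∀ y ∈ Icc (-1:ℝ) 1, |W t y| ≤ 3 / 2 * (1 / 1000000000) ∧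
      |dY W t y| ≤ 3 / 2 * (1 / 1000000000) ∧ |dY (dY W) t y| ≤ 3 / 2 * (1 / 1000000000) :=
    fun t ht y hy => hheat.sup_bounds (by rw [s6]; exact hμ.1) (by norm_num) (hterm 1 (by simp))
      (hterm 2 (by simp)) (hterm 3 (by simp)) ht hy
  have hUs : ∀ t, ∀ y ∈ Ioo (-1:ℝ) 1, U t y = shearFlow W t y := fun t y hy =>
    (hU t y).trans (shearFlow_eq (hWs.continuous_snd t) hy)
  have cU : ∀ t, Continuous (shearFlow W t) := fun t =>
    (continuous_shearFlow hWs.continuous).comp (Continuous.prodMk_right t)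
  have key := linearized_decay (Real.rpow_pos_of_pos hμ.1 (1 / 6))
    (Real.rpow_le_one hμ.1.le hμ.2 (by norm_num)) (Real.rpow_pos_of_pos hν.1 (1 / 6))
    (Real.rpow_pos_of_pos hm (1 / 6))
    (Real.rpow_le_rpow hm.le (min_le_left μ ν) (by norm_num))
    (Real.rpow_le_rpow hm.le (min_le_right μ ν) (by norm_num))
    (Real.one_le_rpow hk1 (by norm_num : (0:ℝ) ≤ 1 / 3)) hσ (by norm_num) (by norm_num) hheat hWsup
    hω hψ hθ (fun t ht => ⟨(hb t ht).1, (hb t ht).2.1⟩)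
    (fun t ht => ⟨(hb t ht).2.2.1, (hb t ht).2.2.2.1⟩)
    (fun t ht => ⟨(hb t ht).2.2.2.2.1, (hb t ht).2.2.2.2.2⟩) ?_ ?_ ?_ ht
  · have e1 : μ ^ ((2:ℝ) / 3) = (μ ^ ((1:ℝ) / 6)) ^ 4 := root hμ.1 _ _ _ (by norm_num)
    have e2 : ν ^ ((2:ℝ) / 3) = (ν ^ ((1:ℝ) / 6)) ^ 4 := root hν.1 _ _ _ (by norm_num)
    have e3 : μ ^ ((1:ℝ) / 3) = (μ ^ ((1:ℝ) / 6)) ^ 2 := root hμ.1 _ _ _ (by norm_num)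
    have e4 : min μ ν ^ ((1:ℝ) / 3) = (min μ ν ^ ((1:ℝ) / 6)) ^ 2 := root hm _ _ _ (by norm_num)
    have e5 : min μ ν ^ (-(2:ℝ) / 3) = ((min μ ν ^ ((1:ℝ) / 6)) ^ 4)⁻¹ := by
      rw [neg_div, Real.rpow_neg hm.le, root hm (1 / 6) 4 _ (by norm_num)]
    have e6 : |(k : ℝ)| ^ ((2:ℝ) / 3) = (|(k : ℝ)| ^ ((1:ℝ) / 3)) ^ 2 :=
      root hk0 _ _ _ (by norm_num)
    have e7 : |(k : ℝ)| ^ (-(2:ℝ) / 3) = ((|(k : ℝ)| ^ ((1:ℝ) / 3)) ^ 2)⁻¹ := by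
      rw [neg_div, Real.rpow_neg hk0.le, e6]
    rw [e1, e2, e3, e4, e5, e6, e7]
    refine key.trans (le_of_eq ?_)
    simp only [dY, div_eq_mul_inv]
    ring
  · intro t ht y hy
    rw [← heqψ t ht y hy, q3, ← Complex.ofReal_pow, sq_abs]
    simp [edd]
  · intro t ht
    rw [q3, s6, ek]
    refine eqOn_Icc_of_Ioo (hω.dT.continuous_snd t) ?_ fun y hy => ?_
    · have := cU t
      have := hω.continuous_snd t
      have := hψ.continuous_snd t
      have := hθ.continuous_snd t
      have := hω.dY.dY.continuous_snd t
      have := hWs.dY.continuous_snd t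
      fun_prop
    · have h := heqω t ht y (Ioo_subset_Icc_self hy)
      rw [deriv_deriv_shearFlow hWs hy (hUs t), hUs t y hy] at h
      simp only [dT, edd] at h ⊢
      push_cast at h ⊢
      linear_combination h
  · intro t ht
    rw [q3, r6, ek]
    refine eqOn_Icc_of_Ioo (hθ.dT.continuous_snd t) ?_ fun y hy => ?_
    · have := cU t
      have := hθ.continuous_snd t
      have := hθ.dY.dY.continuous_snd t
      fun_prop
    · have h := heqθ t ht y (Ioo_subset_Icc_self hy)
      rw [hUs t y hy] at h
      simp only [dT, edd] at h ⊢
      push_cast at h ⊢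
      linear_combination h
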